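/- For all 0 ≤ i,j ≤ n and all m, n ∈ ℤ^{N+1}, [ρ(E_i)_m, ρ(F_j)_n] = −δ_{ij} ( ρ(H_i)_{m+n} − ( Σ_{l=0}^N m_l κ_{−m−n,l} ) · id_V ) as operators on V. -/

import Mathlib

noncomputable section

namespace Stmt14

/-- Multi-indices `m ∈ ℤ^{N+1}`. -/
abbrev MM (N : ℕ) := Fin (N + 1) → ℤ

/-- Index type for the polynomial variables `x_{ij}(m)`, `1 ≤ i < j ≤ n+1`. -/
def XIdx (n N : ℕ) := {ij : ℕ × ℕ // 1 ≤ ij.1 ∧ ij.1 < ij.2 ∧ ij.2 ≤ n + 1} × MM N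

/-- Index type for the polynomial variables `y_i(k)`, `1 ≤ i ≤ n`, `k > 0`. -/
def YIdx (n N : ℕ) (pos : MM N → Prop) :=
  {i : ℕ // 1 ≤ i ∧ i ≤ n} × {k : MM N // pos k}

/-- The Fock space `V = ℂ[x] ⊗ ℂ[y]`, realized as the polynomial ring in the
two (disjoint) families of variables. -/
abbrev Fock (n N : ℕ) (pos : MM N → Prop) :=
  MvPolynomial (XIdx n N ⊕ YIdx n N pos) ℂ

/-- `a_{ij,m}`: multiplication by `-x_{ij}(m)` (and `0` for out-of-range indices). -/
def aop (n N : ℕ) (pos : MM N → Prop) (i j : ℕ) (m : MM N) :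
    Fock n N pos → Fock n N pos := fun w =>
  if h : 1 ≤ i ∧ i < j ∧ j ≤ n + 1 then
    -(MvPolynomial.X (Sum.inl ((⟨(i, j), h⟩, m) : XIdx n N)) : Fock n N pos) * w
  else 0

/-- `a*_{ij,m}`: the partial derivative `∂/∂x_{ij}(-m)` (and `0` for
out-of-range indices). -/
def astar (n N : ℕ) (pos : MM N → Prop) (i j : ℕ) (m : MM N) :
    Fock n N pos → Fock n N pos := fun w =>
  if h : 1 ≤ i ∧ i < j ∧ j ≤ n + 1 then
    MvPolynomial.pderiv (Sum.inl ((⟨(i, j), h⟩, -m) : XIdx n N)) w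
  else 0

/-- `(κ·D a*_{ij})_v := Σ_{q ∈ ℤ^{N+1}} Σ_{p=0}^N κ_{q-v,p}(-q_p) a*_{ij,q}`,
a pointwise locally finite sum of operators. -/
def kD (n N : ℕ) (pos : MM N → Prop) (kappa : MM N → Fin (N + 1) → ℂ)
    (i j : ℕ) (v : MM N) : Fock n N pos → Fock n N pos := fun w =>
  ∑ᶠ q : MM N,
    (∑ p : Fin (N + 1), kappa (q - v) p * (-(q p : ℂ))) • astar n N pos i j q w

open Classical in
/-- `θ(m) = 1` if `m > 0` and `0` otherwise. -/
def theta {N : ℕ} (pos : MM N → Prop) (m : MM N) : ℂ := if pos m then 1 else 0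

open Classical in
/-- `∂/∂y_i(s)`, with the convention that it is `0` unless `1 ≤ i ≤ n` and `s > 0`. -/
def ydot (n N : ℕ) (pos : MM N → Prop) (i : ℕ) (s : MM N) :
    Fock n N pos → Fock n N pos := fun w =>
  if h : (1 ≤ i ∧ i ≤ n) ∧ pos s then
    MvPolynomial.pderiv (Sum.inr ((⟨i, h.1⟩, ⟨s, h.2⟩) : YIdx n N pos)) w
  else 0

/-- `Σ_{p=0}^N m_p κ_{-m+s,p}`. -/
def cnum {N : ℕ} (kappa : MM N → Fin (N + 1) → ℂ) (m s : MM N) : ℂ :=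
  ∑ p : Fin (N + 1), (m p : ℂ) * kappa (-m + s) p

open Classical in
/-- The operator `Φ(b_i(m))` (for `1 ≤ i ≤ n`), acting on `V`. -/
def Phi (n N : ℕ) (pos : MM N → Prop) (kappa : MM N → Fin (N + 1) → ℂ)
    (lam : ℕ → ℂ) (i : ℕ) (m : MM N) : Fock n N pos → Fock n N pos := fun w =>
  theta pos (-m) • (∑ᶠ s : MM N, cnum kappa m s •
      (ydot n N pos (i - 1) s w - ydot n N pos i s w))
  + theta pos m • (∑ᶠ s : MM N, cnum kappa m s •
      (ydot n N pos (i - 1) s w - (2 : ℂ) • ydot n N pos i s w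
        + ydot n N pos (i + 1) s w))
  + (if h : (1 ≤ i ∧ i ≤ n) ∧ pos (-m) then
      (MvPolynomial.X (Sum.inr ((⟨i, h.1⟩, ⟨-m, h.2⟩) : YIdx n N pos)) :
          Fock n N pos) * w
    else 0)
  - (if m = 0 then lam i else 0) • w

/-- `Φ(b_0(m)) := -Σ_{i=1}^n Φ(b_i(m))`, and `Φ(b_i(m))` for `1 ≤ i ≤ n`. -/
def PhiHat (n N : ℕ) (pos : MM N → Prop) (kappa : MM N → Fin (N + 1) → ℂ)
    (lam : ℕ → ℂ) (i : ℕ) (m : MM N) : Fock n N pos → Fock n N pos :=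
  if i = 0 then -(∑ r ∈ Finset.Icc 1 n, Phi n N pos kappa lam r m)
  else Phi n N pos kappa lam i m

/-- The `m`-th mode of the product of two families of operators:
`(XY)_m := Σ_{k+l=m} X_k Y_l` (pointwise locally finite sum). -/
def fmul (n N : ℕ) (pos : MM N → Prop)
    (X Y : MM N → Fock n N pos → Fock n N pos) :
    MM N → Fock n N pos → Fock n N pos :=
  fun m w => ∑ᶠ k : MM N, X k (Y (m - k) w)

/-- Modewise product of a finite list of families of operators; the empty
product is the identity family (the delta family supported at `0`). -/
def fprod (n N : ℕ) (pos : MM N → Prop) :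
    List (MM N → Fock n N pos → Fock n N pos) →
      MM N → Fock n N pos → Fock n N pos
  | [] => fun m w => if m = 0 then w else 0
  | X :: L => fmul n N pos X (fprod n N pos L)

/-- The affine Cartan matrix of type `A_n^{(1)}` (indices `0 ≤ i, j ≤ n`), as an
integer matrix. -/
def AcarZ (n i j : ℕ) : ℤ :=
  if i = j then 2
  else if (i + 1) % (n + 1) = j % (n + 1) ∨ (j + 1) % (n + 1) = i % (n + 1) then -1
  else 0

/-- The affine Cartan matrix of type `A_n^{(1)}`, with complex entries. -/
def Acar (n i j : ℕ) : ℂ := (AcarZ n i j : ℂ)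

/-- `ρ(F_r)_m` for `1 ≤ r ≤ n`. -/
def rhoF (n N : ℕ) (pos : MM N → Prop) (r : ℕ) (m : MM N) :
    Fock n N pos → Fock n N pos :=
  aop n N pos r (r + 1) m
    - ∑ j ∈ Finset.Ico 1 r, fmul n N pos (aop n N pos j (r + 1)) (astar n N pos j r) m

/-- `ρ(H_r)_m` for `1 ≤ r ≤ n`. -/
def rhoHn (n N : ℕ) (pos : MM N → Prop) (kappa : MM N → Fin (N + 1) → ℂ)
    (lam : ℕ → ℂ) (r : ℕ) (m : MM N) : Fock n N pos → Fock n N pos :=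
  (2 : ℂ) • fmul n N pos (aop n N pos r (r + 1)) (astar n N pos r (r + 1)) m
  + ∑ i ∈ Finset.Ico 1 r,
      (fmul n N pos (aop n N pos i (r + 1)) (astar n N pos i (r + 1)) m
        - fmul n N pos (aop n N pos i r) (astar n N pos i r) m)
  + ∑ j ∈ Finset.Icc (r + 2) (n + 1),
      (fmul n N pos (aop n N pos r j) (astar n N pos r j) m
        - fmul n N pos (aop n N pos (r + 1) j) (astar n N pos (r + 1) j) m)
  + Phi n N pos kappa lam r m

/-- `ρ(H_r)_m` for `0 ≤ r ≤ n`, with `ρ(H_0)_m := -Σ_{r=1}^n ρ(H_r)_m`. -/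
def rhoH (n N : ℕ) (pos : MM N → Prop) (kappa : MM N → Fin (N + 1) → ℂ)
    (lam : ℕ → ℂ) (r : ℕ) (m : MM N) : Fock n N pos → Fock n N pos :=
  if r = 0 then -(∑ s ∈ Finset.Icc 1 n, rhoHn n N pos kappa lam s m)
  else rhoHn n N pos kappa lam r m

/-- `ρ(E_r)_m` for `1 ≤ r ≤ n`. -/
def rhoEn (n N : ℕ) (pos : MM N → Prop) (kappa : MM N → Fin (N + 1) → ℂ)
    (lam : ℕ → ℂ) (r : ℕ) (m : MM N) : Fock n N pos → Fock n N pos :=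
  fmul n N pos (aop n N pos r (r + 1))
      (fmul n N pos (astar n N pos r (r + 1)) (astar n N pos r (r + 1))) m
  - ∑ j ∈ Finset.Icc (r + 2) (n + 1),
      fmul n N pos (aop n N pos (r + 1) j) (astar n N pos r j) m
  + ∑ j ∈ Finset.Ico 1 r,
      fmul n N pos (aop n N pos j r) (astar n N pos j (r + 1)) m
  + ∑ j ∈ Finset.Icc (r + 2) (n + 1),
      (fmul n N pos (fmul n N pos (aop n N pos r j) (astar n N pos r j))
          (astar n N pos r (r + 1)) m
        - fmul n N pos (fmul n N pos (aop n N pos (r + 1) j) (astar n N pos (r + 1) j))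
            (astar n N pos r (r + 1)) m)
  + fmul n N pos (astar n N pos r (r + 1)) (Phi n N pos kappa lam r) m
  + kD n N pos kappa r (r + 1) m

/-- `ρ(E_r)_m` for `0 ≤ r ≤ n`, with `ρ(E_0)_m := -a_{1,n+1;m}`. -/
def rhoE (n N : ℕ) (pos : MM N → Prop) (kappa : MM N → Fin (N + 1) → ℂ)
    (lam : ℕ → ℂ) (r : ℕ) (m : MM N) : Fock n N pos → Fock n N pos :=
  if r = 0 then -(aop n N pos 1 (n + 1) m) else rhoEn n N pos kappa lam r m

/-- The strictly increasing sequence `1 = q_1 < q_2 < ⋯ < q_i` encoded by a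
subset `s ⊆ {2,…,n+1}`, as the sorted list `1 :: sort s`. -/
def ql (s : Finset ℕ) : List ℕ := 1 :: s.sort (· ≤ ·)

/-- The last entry `q_i` of the sequence encoded by `s`. -/
def qend (s : Finset ℕ) : ℕ := ((ql s).getLast?).getD 0

/-- The second-to-last entry `q_{i-1}` of the sequence encoded by `s`
(`0` if the sequence has length `1`, so that the condition `q_{i-1} ≤ r` is
vacuous in that case). -/
def qpen (s : Finset ℕ) : ℕ := (((ql s).dropLast).getLast?).getD 0

/-- The list of adjacent pairs `(q_l, q_{l+1})` of a list. -/
def qpairs (l : List ℕ) : List (ℕ × ℕ) := l.zip l.tail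

/-- `ρ(F_0)_m`. -/
def rhoF0 (n N : ℕ) (pos : MM N → Prop) (kappa : MM N → Fin (N + 1) → ℂ)
    (lam : ℕ → ℂ) (m : MM N) : Fock n N pos → Fock n N pos :=
  -(∑ r ∈ Finset.Icc 1 (n + 1), ∑ j ∈ Finset.Icc 1 (n + 1),
      ∑ s ∈ (Finset.Icc 2 (n + 1)).powerset,
        if r < j ∧ qend s = j ∧ qpen s ≤ r then
          fprod n N pos
            (aop n N pos r j ::
              ((qpairs (ql s)).map fun p => astar n N pos p.1 p.2)
                ++ [astar n N pos r (n + 1)]) m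
        else 0)
  - (∑ r ∈ Finset.Icc 1 n, ∑ s ∈ (Finset.Icc 2 (n + 1)).powerset,
      if qend s ≤ r then
        fprod n N pos
          (((qpairs (ql s ++ [n + 1])).map fun p => astar n N pos p.1 p.2)
            ++ [Phi n N pos kappa lam r]) m
      else 0)
  - (∑ r ∈ Finset.Icc 1 n, ∑ s ∈ (Finset.Icc 2 (n + 1)).powerset,
      if qend s = r then
        fprod n N pos
          (((qpairs (ql s)).map fun p => astar n N pos p.1 p.2)
            ++ [kD n N pos kappa r (n + 1)]) m
      else 0)

/-- `ρ(F_r)_m` for `0 ≤ r ≤ n`. -/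
def rhoFa (n N : ℕ) (pos : MM N → Prop) (kappa : MM N → Fin (N + 1) → ℂ)
    (lam : ℕ → ℂ) (r : ℕ) (m : MM N) : Fock n N pos → Fock n N pos :=
  if r = 0 then rhoF0 n N pos kappa lam m else rhoF n N pos r m

/-- The commutator of two operators. -/
def comm {V : Type*} [AddCommGroup V] (f g : V → V) : V → V :=
  fun w => f (g w) - g (f w)

section FieldCalculus

variable {N : ℕ} {V : Type*} [AddCommGroup V] [Module ℂ V]

/-- Laurent polynomials in `N + 1` variables with coefficients in `V`. -/
abbrev Loop (N : ℕ) (V : Type*) [AddCommGroup V] := MM N →₀ V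

/-- Multiplication by the Laurent monomial with exponent `k`. -/
def shift (k : MM N) : Module.End ℂ (Loop N V) :=
  Finsupp.lsum ℂ fun l => Finsupp.lsingle (k + l)

/-- Coefficientwise action of an operator. -/
def lift (A : Module.End ℂ V) : Module.End ℂ (Loop N V) :=
  Finsupp.lsum ℂ fun l => Finsupp.lsingle l ∘ₗ A

/-- The degree derivation `-k_p` on Laurent polynomials. -/
def euler (p : Fin (N + 1)) : Module.End ℂ (Loop N V) :=
  Finsupp.lsum ℂ fun l => (-(l p : ℂ)) • Finsupp.lsingle l

/-- Pairing of a Laurent polynomial with the family `X`, mode `m`. -/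
def contract (X : MM N → Module.End ℂ V) (m : MM N) : Loop N V →ₗ[ℂ] V :=
  Finsupp.lsum ℂ fun k => X (m - k)

/-- Constant Laurent polynomials. -/
def const : V →ₗ[ℂ] Loop N V := Finsupp.lsingle 0

/-- The `m`-th mode of the product of the family `X` with the field `Θ`. -/
def modeMul (X : MM N → Module.End ℂ V) (Θ : Module.End ℂ (Loop N V)) (m : MM N) :
    Module.End ℂ V :=
  contract X m ∘ₗ Θ ∘ₗ const

@[simp] lemma shift_single (k l : MM N) (u : V) :
    shift k (Finsupp.single l u) = Finsupp.single (k + l) u := by simp [shift]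

@[simp] lemma lift_single (A : Module.End ℂ V) (l : MM N) (u : V) :
    lift A (Finsupp.single l u) = Finsupp.single l (A u) := by simp [lift]

@[simp] lemma euler_single (p : Fin (N + 1)) (l : MM N) (u : V) :
    euler p (Finsupp.single l u) = (-(l p : ℂ)) • Finsupp.single l u := by simp [euler]

@[simp] lemma contract_single (X : MM N → Module.End ℂ V) (m l : MM N) (u : V) :
    contract X m (Finsupp.single l u) = X (m - l) u := by simp [contract]

@[simp] lemma const_apply (u : V) : const u = (Finsupp.single 0 u : Loop N V) := rfl

lemma lift_comm_shift (A : Module.End ℂ V) (k : MM N) : Commute (lift A) (shift k) := by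
  refine Finsupp.lhom_ext fun l u => ?_
  simp

lemma lift_comm_euler (A : Module.End ℂ V) (p : Fin (N + 1)) :
    Commute (lift A) (euler (N := N) p) := by
  refine Finsupp.lhom_ext fun l u => ?_
  simp

lemma euler_mul_shift (p : Fin (N + 1)) (k : MM N) :
    (euler p * shift k : Module.End ℂ (Loop N V)) = shift k * euler p - (k p : ℂ) • shift k := by
  refine Finsupp.lhom_ext fun l u => ?_
  simp [-Finsupp.smul_single]
  module

lemma shift_mul_shift (k l : MM N) :
    (shift k * shift l : Module.End ℂ (Loop N V)) = shift (k + l) := by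
  refine Finsupp.lhom_ext fun l u => ?_
  simp [add_assoc]

lemma shift_zero : (shift 0 : Module.End ℂ (Loop N V)) = 1 := by
  refine Finsupp.lhom_ext fun l u => ?_
  simp

lemma contract_comp_shift (X : MM N → Module.End ℂ V) (m k : MM N) :
    contract X m ∘ₗ shift k = contract X (m - k) := by
  refine Finsupp.lhom_ext fun l u => ?_
  simp [sub_sub]

lemma comp_contract (A : Module.End ℂ V) (X : MM N → Module.End ℂ V) (m : MM N) :
    A ∘ₗ contract X m = contract (fun l => A * X l) m := by
  refine Finsupp.lhom_ext fun l u => ?_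
  simp

lemma contract_comp_lift (A : Module.End ℂ V) (X : MM N → Module.End ℂ V) (m : MM N) :
    contract X m ∘ₗ lift A = contract (fun l => X l * A) m := by
  refine Finsupp.lhom_ext fun l u => ?_
  simp

lemma contract_sub (X Y : MM N → Module.End ℂ V) (m : MM N) :
    contract (fun l => X l - Y l) m = contract X m - contract Y m := by
  refine Finsupp.lhom_ext fun l u => ?_
  simp

lemma contract_modeMul (X : MM N → Module.End ℂ V) {Θ : Module.End ℂ (Loop N V)}
    (hΘ : ∀ k, Commute Θ (shift k)) (m : MM N) :
    contract (modeMul X Θ) m = contract X m ∘ₗ Θ := by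
  refine Finsupp.lhom_ext fun l u => ?_
  have h : Finsupp.single l u = shift l (Finsupp.single 0 u) := by simp
  have h2 : Θ (shift l (Finsupp.single 0 u)) = shift l (Θ (Finsupp.single 0 u)) :=
    LinearMap.congr_fun (hΘ l).eq _
  have h3 : ∀ f, contract X m (shift l f) = contract X (m - l) f := fun f =>
    LinearMap.congr_fun (contract_comp_shift X m l) f
  rw [contract_single, LinearMap.comp_apply, h, h2, h3]
  rfl

lemma contract_zero (m : MM N) : contract (fun _ => (0 : Module.End ℂ V)) m = 0 := by
  refine Finsupp.lhom_ext fun l u => ?_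
  simp

lemma modeMul_modeMul (X : MM N → Module.End ℂ V) {Θ : Module.End ℂ (Loop N V)}
    (hΘ : ∀ k, Commute Θ (shift k)) (Ξ : Module.End ℂ (Loop N V)) (m : MM N) :
    modeMul (modeMul X Θ) Ξ m = modeMul X (Θ * Ξ) m := by
  rw [modeMul, contract_modeMul X hΘ]
  rfl

lemma modeMul_one (X : MM N → Module.End ℂ V) (m : MM N) : modeMul X 1 m = X m := by
  ext u
  simp [modeMul]

lemma modeMul_add (X : MM N → Module.End ℂ V) (Θ Ξ : Module.End ℂ (Loop N V)) (m : MM N) :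
    modeMul X (Θ + Ξ) m = modeMul X Θ m + modeMul X Ξ m := by
  ext u; simp [modeMul]

lemma modeMul_sub (X : MM N → Module.End ℂ V) (Θ Ξ : Module.End ℂ (Loop N V)) (m : MM N) :
    modeMul X (Θ - Ξ) m = modeMul X Θ m - modeMul X Ξ m := by
  ext u; simp [modeMul]

lemma modeMul_smul (X : MM N → Module.End ℂ V) (c : ℂ) (Θ : Module.End ℂ (Loop N V))
    (m : MM N) : modeMul X (c • Θ) m = c • modeMul X Θ m := by
  ext u; simp [modeMul]

lemma modeMul_zero (X : MM N → Module.End ℂ V) (m : MM N) : modeMul X 0 m = 0 := by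
  ext u; simp [modeMul]

lemma modeMul_shift (X : MM N → Module.End ℂ V) (k : MM N) (Θ : Module.End ℂ (Loop N V))
    (m : MM N) : modeMul X (shift k * Θ) m = modeMul X Θ (m - k) := by
  rw [modeMul, modeMul, ← contract_comp_shift]
  rfl

/-- Commutator of an operator with a mode of a product. -/
lemma commutator_modeMul (A : Module.End ℂ V) (X : MM N → Module.End ℂ V)
    (Θ : Module.End ℂ (Loop N V)) (m : MM N) :
    A * modeMul X Θ m - modeMul X Θ m * A
      = modeMul (fun l => A * X l - X l * A) Θ m
        + modeMul X (lift A * Θ - Θ * lift A) m := by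
  have h1 : ∀ f, A (contract X m f) = contract (fun l => A * X l) m f := fun f =>
    LinearMap.congr_fun (comp_contract A X m) f
  have h2 : ∀ f, contract X m (lift A f) = contract (fun l => X l * A) m f := fun f =>
    LinearMap.congr_fun (contract_comp_lift A X m) f
  ext u
  simp [modeMul, contract_sub, h1, h2]

lemma commute_modeMul {A : Module.End ℂ V} {X : MM N → Module.End ℂ V}
    {Θ : Module.End ℂ (Loop N V)} (hX : ∀ l, Commute A (X l)) (hΘ : Commute (lift A) Θ)
    (m : MM N) : Commute A (modeMul X Θ m) := by
  have h := commutator_modeMul A X Θ m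
  have h0 : (fun l => A * X l - X l * A) = fun _ => 0 := by
    funext l; rw [(hX l).eq, sub_self]
  rw [h0, hΘ.eq, sub_self, modeMul_zero, add_zero] at h
  rw [commute_iff_eq, ← sub_eq_zero, h, modeMul, contract_zero, LinearMap.zero_comp]

/-- The Laurent polynomial with coefficients `X m u`, for a pointwise finite family `X`. -/
def series (X : MM N → Module.End ℂ V) (hX : ∀ u, (Function.support fun m => X m u).Finite) :
    V →ₗ[ℂ] Loop N V where
  toFun u := Finsupp.ofSupportFinite (fun m => X m u) (hX u)
  map_add' u v := Finsupp.ext fun m => map_add (X m) u v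
  map_smul' c u := Finsupp.ext fun m => map_smul (X m) c u

@[simp] lemma series_apply (X : MM N → Module.End ℂ V)
    (hX : ∀ u, (Function.support fun m => X m u).Finite) (u : V) (m : MM N) :
    series X hX u m = X m u := rfl

lemma series_commute (X : MM N → Module.End ℂ V)
    (hX : ∀ u, (Function.support fun m => X m u).Finite) (A : Module.End ℂ V)
    (h : ∀ m, Commute A (X m)) (u : V) : series X hX (A u) = lift A (series X hX u) := by
  have key : ∀ f : Loop N V, ∀ m, lift A f m = A (f m) := by
    intro f m
    induction f using Finsupp.induction_linear with
    | zero => simp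
    | add f g hf hg => simp [hf, hg]
    | single k v =>
      by_cases hk : k = m <;> simp [hk]
  ext m
  rw [key, series_apply, series_apply]
  exact (LinearMap.congr_fun (h m).eq u).symm

/-- The translation invariant operator on Laurent polynomials attached to a family. -/
def field (X : MM N → Module.End ℂ V) (hX : ∀ u, (Function.support fun m => X m u).Finite) :
    Module.End ℂ (Loop N V) :=
  Finsupp.lsum ℂ fun l => shift l ∘ₗ series X hX

@[simp] lemma field_single (X : MM N → Module.End ℂ V)
    (hX : ∀ u, (Function.support fun m => X m u).Finite) (l : MM N) (u : V) :
    field X hX (Finsupp.single l u) = shift l (series X hX u) := by simp [field]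

lemma field_comm_shift (X : MM N → Module.End ℂ V)
    (hX : ∀ u, (Function.support fun m => X m u).Finite) (k : MM N) :
    Commute (field X hX) (shift k) := by
  refine Finsupp.lhom_ext fun l u => ?_
  simp [← shift_mul_shift]

lemma lift_comm_field (X : MM N → Module.End ℂ V)
    (hX : ∀ u, (Function.support fun m => X m u).Finite) (A : Module.End ℂ V)
    (h : ∀ m, Commute A (X m)) : Commute (lift A) (field X hX) := by
  refine Finsupp.lhom_ext fun l u => ?_
  have := LinearMap.congr_fun (lift_comm_shift (N := N) A l).eq (series X hX u)
  simpa [series_commute X hX A h u] using this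

lemma field_commute (X Y : MM N → Module.End ℂ V)
    (hX : ∀ u, (Function.support fun m => X m u).Finite)
    (hY : ∀ u, (Function.support fun m => Y m u).Finite)
    (h : ∀ k l, Commute (X k) (Y l)) : Commute (field X hX) (field Y hY) := by
  have expand : ∀ (Z : MM N → Module.End ℂ V) (hZ) (F : Finset (MM N)) (u : V),
      (∀ m, Z m u ≠ 0 → m ∈ F) →
        series Z hZ u = ∑ m ∈ F, Finsupp.single m (Z m u) := by
    intro Z hZ F u hF
    ext m
    rw [Finsupp.finsetSum_apply]
    simp only [Finsupp.single_apply, series_apply]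
    rw [Finset.sum_ite_eq']
    split_ifs with hm
    · rfl
    · by_contra hne
      exact hm (hF m hne)
  refine Finsupp.lhom_ext fun l u => ?_
  set FX := (hX u).toFinset
  set FY := (hY u).toFinset
  have eX := expand X hX FX u (fun m hm => by simpa [FX] using hm)
  have eY := expand Y hY FY u (fun m hm => by simpa [FY] using hm)
  have eXY : ∀ k, series X hX (Y k u) = ∑ m ∈ FX, Finsupp.single m (X m (Y k u)) := by
    intro k
    refine expand X hX FX _ fun m hm => ?_
    have h1 : X m (Y k u) = Y k (X m u) := LinearMap.congr_fun (h m k).eq u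
    rw [h1] at hm
    simp only [FX, Set.Finite.mem_toFinset, Function.mem_support]
    intro h0; rw [h0, map_zero] at hm; exact hm rfl
  have eYX : ∀ k, series Y hY (X k u) = ∑ m ∈ FY, Finsupp.single m (Y m (X k u)) := by
    intro k
    refine expand Y hY FY _ fun m hm => ?_
    have h1 : X k (Y m u) = Y m (X k u) := LinearMap.congr_fun (h k m).eq u
    rw [← h1] at hm
    simp only [FY, Set.Finite.mem_toFinset, Function.mem_support]
    intro h0; rw [h0, map_zero] at hm; exact hm rfl
  simp only [Module.End.mul_apply, field_single, eX, eY, map_sum, shift_single, eXY, eYX]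
  rw [Finset.sum_comm]
  refine Finset.sum_congr rfl fun a _ => Finset.sum_congr rfl fun b _ => ?_
  have h1 : X a (Y b u) = Y b (X a u) := LinearMap.congr_fun (h a b).eq u
  rw [h1, add_right_comm]

lemma shift_apply (k : MM N) (f : Loop N V) (m : MM N) : shift k f m = f (m - k) := by
  induction f using Finsupp.induction_linear with
  | zero => simp
  | add f g hf hg => simp [hf, hg]
  | single l v =>
    simp only [shift_single, Finsupp.single_apply, eq_sub_iff_add_eq, add_comm l k]

lemma lift_apply (A : Module.End ℂ V) (f : Loop N V) (m : MM N) : lift A f m = A (f m) := by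
  induction f using Finsupp.induction_linear with
  | zero => simp
  | add f g hf hg => simp [hf, hg]
  | single k v =>
    by_cases hk : k = m <;> simp [hk]

lemma contract_delta (c : ℂ) (m q : MM N) (f : Loop N V) :
    contract (fun l => (if l + q = 0 then c else 0) • (1 : Module.End ℂ V)) m f
      = c • f (m + q) := by
  induction f using Finsupp.induction_linear with
  | zero => simp
  | add f g hf hg => rw [map_add, hf, hg, Finsupp.add_apply, smul_add]
  | single k v =>
    have : m - k + q = 0 ↔ k = m + q := by
      rw [← sub_eq_zero (a := k), ← neg_eq_zero (a := k - (m + q))]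
      ring_nf
    by_cases hk : k = m + q <;> simp [hk, this]

end FieldCalculus

section Coordinates

/-- Positive roots: pairs `1 ≤ i < j ≤ n + 1`. -/
abbrev Root (n : ℕ) := {ij : ℕ × ℕ // 1 ≤ ij.1 ∧ ij.1 < ij.2 ∧ ij.2 ≤ n + 1}

instance (n : ℕ) : Finite (Root n) := by
  refine Set.Finite.subset (s := ↑(Finset.range (n + 2) ×ˢ Finset.range (n + 2)))
    (Finset.finite_toSet _) fun ij h => ?_
  obtain ⟨h1, h2, h3⟩ : 1 ≤ ij.1 ∧ ij.1 < ij.2 ∧ ij.2 ≤ n + 1 := h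
  simp only [Finset.coe_product, Finset.coe_range, Set.mem_prod, Set.mem_Iio]
  omega

instance (n : ℕ) : Fintype (Root n) := Fintype.ofFinite _

/-- Polynomial functions on the unipotent group. -/
abbrev Coord (n : ℕ) := MvPolynomial (Root n) ℂ

/-- The coordinate function `z_{ij}`, zero for out-of-range indices. -/
def zc (n i j : ℕ) : Coord n :=
  if h : 1 ≤ i ∧ i < j ∧ j ≤ n + 1 then MvPolynomial.X ⟨(i, j), h⟩ else 0

/-- The partial derivative `∂/∂z_{ij}`, zero for out-of-range indices. -/
def del (n i j : ℕ) : Derivation ℂ (Coord n) (Coord n) :=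
  if h : 1 ≤ i ∧ i < j ∧ j ≤ n + 1 then MvPolynomial.pderiv ⟨(i, j), h⟩ else 0

end Coordinates

section Heisenberg

variable {n N : ℕ} {pos : MM N → Prop}

/-- The polynomial variable `x_{ij}(m)`. -/
def xvar (σ : Root n) (m : MM N) : XIdx n N ⊕ YIdx n N pos := Sum.inl (σ, m)

/-- The polynomial variable `y_i(k)`. -/
def yvar (i : {i : ℕ // 1 ≤ i ∧ i ≤ n}) (k : {k : MM N // pos k}) :
    XIdx n N ⊕ YIdx n N pos := Sum.inr (i, k)

lemma xvar_inj {σ τ : Root n} {m k : MM N} :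
    (xvar σ m : XIdx n N ⊕ YIdx n N pos) = xvar τ k ↔ σ = τ ∧ m = k :=
  Sum.inl_injective.eq_iff.trans (Prod.mk_inj)

lemma yvar_inj {i j : {i : ℕ // 1 ≤ i ∧ i ≤ n}} {m k : {k : MM N // pos k}} :
    yvar i m = yvar j k ↔ i = j ∧ m = k :=
  Sum.inr_injective.eq_iff.trans (Prod.mk_inj)

lemma xvar_ne_yvar (σ : Root n) (m : MM N) (i : {i : ℕ // 1 ≤ i ∧ i ≤ n})
    (k : {k : MM N // pos k}) : xvar σ m ≠ yvar i k := Sum.inl_ne_inr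

/-- `aop` as a linear map. -/
def aL (i j : ℕ) (m : MM N) : Module.End ℂ (Fock n N pos) :=
  if h : 1 ≤ i ∧ i < j ∧ j ≤ n + 1 then
    LinearMap.mulLeft ℂ (-MvPolynomial.X (xvar ⟨(i, j), h⟩ m))
  else 0

/-- `astar` as a linear map. -/
def starL (i j : ℕ) (m : MM N) : Module.End ℂ (Fock n N pos) :=
  if h : 1 ≤ i ∧ i < j ∧ j ≤ n + 1 then
    (MvPolynomial.pderiv (xvar ⟨(i, j), h⟩ (-m)) :
      Derivation ℂ (Fock n N pos) (Fock n N pos)).toLinearMap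
  else 0

open Classical in
/-- `ydot` as a linear map. -/
def ydotL (i : ℕ) (s : MM N) : Module.End ℂ (Fock n N pos) :=
  if h : (1 ≤ i ∧ i ≤ n) ∧ pos s then
    (MvPolynomial.pderiv (yvar ⟨i, h.1⟩ ⟨s, h.2⟩) :
      Derivation ℂ (Fock n N pos) (Fock n N pos)).toLinearMap
  else 0

open Classical in
/-- Multiplication by `y_i(-m)`, zero for out-of-range indices. -/
def ymulL (i : ℕ) (m : MM N) : Module.End ℂ (Fock n N pos) :=
  if h : (1 ≤ i ∧ i ≤ n) ∧ pos (-m) then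
    LinearMap.mulLeft ℂ (MvPolynomial.X (yvar ⟨i, h.1⟩ ⟨-m, h.2⟩))
  else 0

lemma coe_aL (i j : ℕ) (m : MM N) : ⇑(aL i j m) = aop n N pos i j m := by
  funext w
  by_cases h : 1 ≤ i ∧ i < j ∧ j ≤ n + 1
  · rw [aL, aop, dif_pos h, dif_pos h]; rfl
  · rw [aL, aop, dif_neg h, dif_neg h]; rfl

lemma coe_starL (i j : ℕ) (m : MM N) : ⇑(starL i j m) = astar n N pos i j m := by
  funext w
  by_cases h : 1 ≤ i ∧ i < j ∧ j ≤ n + 1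
  · rw [starL, dif_pos h]
    exact (dif_pos (α := Fock n N pos) (t := fun h => MvPolynomial.pderiv (xvar ⟨(i, j), h⟩ (-m)) w)
      (e := fun _ => 0) h).symm
  · rw [starL, dif_neg h]
    exact (dif_neg (α := Fock n N pos) (t := fun h => MvPolynomial.pderiv (xvar ⟨(i, j), h⟩ (-m)) w)
      (e := fun _ => 0) h).symm

lemma coe_ydotL (i : ℕ) (s : MM N) : ⇑(ydotL i s) = ydot n N pos i s := by
  funext w
  by_cases h : (1 ≤ i ∧ i ≤ n) ∧ pos s
  · rw [ydotL, dif_pos h]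
    exact (dif_pos (α := Fock n N pos)
      (t := fun h => MvPolynomial.pderiv (yvar ⟨i, h.1⟩ ⟨s, h.2⟩) w)
      (e := fun _ => 0) h).symm
  · rw [ydotL, dif_neg h]
    exact (dif_neg (α := Fock n N pos)
      (t := fun h => MvPolynomial.pderiv (yvar ⟨i, h.1⟩ ⟨s, h.2⟩) w)
      (e := fun _ => 0) h).symm

/-- A partial derivative as an element of the endomorphism algebra. -/
abbrev pderivL {σ : Type*} (i : σ) : Module.End ℂ (MvPolynomial σ ℂ) :=
  (MvPolynomial.pderiv i : Derivation ℂ (MvPolynomial σ ℂ) _).toLinearMap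

/-- A multiplication operator as an element of the endomorphism algebra. -/
abbrev mulL {A : Type*} [CommRing A] [Algebra ℂ A] (a : A) : Module.End ℂ A :=
  LinearMap.mulLeft ℂ a

lemma pderiv_commute {σ : Type*} (i j : σ) : Commute (pderivL i) (pderivL j) := by
  classical
  have h : ⁅(MvPolynomial.pderiv i : Derivation ℂ (MvPolynomial σ ℂ) (MvPolynomial σ ℂ)),
      (MvPolynomial.pderiv j : Derivation ℂ (MvPolynomial σ ℂ) (MvPolynomial σ ℂ))⁆ = 0 := by
    refine MvPolynomial.derivation_ext fun k => ?_
    simp only [Derivation.commutator_apply, MvPolynomial.pderiv_X, Derivation.coe_zero,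
      Pi.zero_apply, Pi.single_apply]
    split_ifs <;> simp
  refine LinearMap.ext fun w => ?_
  have := congrArg (fun D => D w) h
  simpa [Derivation.commutator_apply, sub_eq_zero] using this

lemma mulL_commute {A : Type*} [CommRing A] [Algebra ℂ A] (a b : A) :
    Commute (mulL a) (mulL b) :=
  LinearMap.ext fun w => by simp [mul_left_comm]

lemma pderiv_mulL {σ : Type*} (i : σ) (P : MvPolynomial σ ℂ) :
    pderivL i * mulL P - mulL P * pderivL i = mulL (MvPolynomial.pderiv i P) := by
  refine LinearMap.ext fun w => ?_
  simp [mul_comm]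

lemma pderiv_mulL_X {σ : Type*} [DecidableEq σ] (i j : σ) :
    pderivL i * mulL (MvPolynomial.X j) - mulL (MvPolynomial.X j) * pderivL i
      = (if i = j then (1 : ℂ) else 0) • 1 := by
  rw [pderiv_mulL, MvPolynomial.pderiv_X, Pi.single_apply]
  refine LinearMap.ext fun w => ?_
  by_cases h : i = j
  · simp [h]
  · simp [h, Ne.symm h]

lemma pderiv_mulL_neg_X {σ : Type*} [DecidableEq σ] (i j : σ) :
    pderivL i * mulL (-MvPolynomial.X j) - mulL (-MvPolynomial.X j) * pderivL i
      = (if i = j then (-1 : ℂ) else 0) • 1 := by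
  rw [pderiv_mulL, map_neg, MvPolynomial.pderiv_X, Pi.single_apply]
  refine LinearMap.ext fun w => ?_
  by_cases h : i = j
  · simp [h]
  · simp [h, Ne.symm h]

lemma pderiv_commute_mulL_X {σ : Type*} {i j : σ} (h : i ≠ j) :
    Commute (pderivL i) (mulL (MvPolynomial.X j)) := by
  classical
  have := pderiv_mulL_X i j
  rwa [if_neg h, zero_smul, sub_eq_zero] at this

lemma pderiv_commute_mulL_neg_X {σ : Type*} {i j : σ} (h : i ≠ j) :
    Commute (pderivL i) (mulL (-MvPolynomial.X j)) := by
  classical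
  have := pderiv_mulL_neg_X i j
  rwa [if_neg h, zero_smul, sub_eq_zero] at this

lemma starL_commute (i j k l : ℕ) (m q : MM N) :
    Commute (starL i j m : Module.End ℂ (Fock n N pos)) (starL k l q) := by
  unfold starL
  split_ifs
  exacts [pderiv_commute _ _, Commute.zero_right _, Commute.zero_left _, Commute.zero_right _]

lemma ydotL_commute (i j : ℕ) (m q : MM N) :
    Commute (ydotL i m : Module.End ℂ (Fock n N pos)) (ydotL j q) := by
  unfold ydotL
  split_ifs
  exacts [pderiv_commute _ _, Commute.zero_right _, Commute.zero_left _, Commute.zero_right _]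

lemma starL_commute_ydotL (i j k : ℕ) (m q : MM N) :
    Commute (starL i j m : Module.End ℂ (Fock n N pos)) (ydotL k q) := by
  unfold starL ydotL
  split_ifs
  exacts [pderiv_commute _ _, Commute.zero_right _, Commute.zero_left _, Commute.zero_right _]

lemma aL_commute (i j k l : ℕ) (m q : MM N) :
    Commute (aL i j m : Module.End ℂ (Fock n N pos)) (aL k l q) := by
  unfold aL
  split_ifs
  exacts [mulL_commute _ _, Commute.zero_right _, Commute.zero_left _,
    Commute.zero_right _]

lemma ymulL_commute (i k : ℕ) (m q : MM N) :
    Commute (ymulL i m : Module.End ℂ (Fock n N pos)) (ymulL k q) := by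
  unfold ymulL
  split_ifs
  exacts [mulL_commute _ _, Commute.zero_right _, Commute.zero_left _, Commute.zero_right _]

lemma aL_commute_ymulL (i j k : ℕ) (m q : MM N) :
    Commute (aL i j m : Module.End ℂ (Fock n N pos)) (ymulL k q) := by
  unfold aL ymulL
  split_ifs
  exacts [mulL_commute _ _, Commute.zero_right _, Commute.zero_left _,
    Commute.zero_right _]

lemma aL_commute_ydotL (i j k : ℕ) (m q : MM N) :
    Commute (aL i j m : Module.End ℂ (Fock n N pos)) (ydotL k q) := by
  unfold aL ydotL
  split_ifs
  exacts [(pderiv_commute_mulL_neg_X (xvar_ne_yvar _ _ _ _).symm).symm, Commute.zero_right _,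
    Commute.zero_left _, Commute.zero_right _]

lemma starL_commute_ymulL (i j k : ℕ) (m q : MM N) :
    Commute (starL i j m : Module.End ℂ (Fock n N pos)) (ymulL k q) := by
  unfold starL ymulL
  split_ifs
  exacts [pderiv_commute_mulL_X (xvar_ne_yvar _ _ _ _), Commute.zero_right _,
    Commute.zero_left _, Commute.zero_right _]

lemma starL_aL_commutator (σ τ : Root n) (q l : MM N) :
    (starL σ.1.1 σ.1.2 q * aL τ.1.1 τ.1.2 l - aL τ.1.1 τ.1.2 l * starL σ.1.1 σ.1.2 q :
      Module.End ℂ (Fock n N pos))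
      = (if l + q = 0 then (if σ = τ then -1 else 0 : ℂ) else 0) • 1 := by
  classical
  obtain ⟨⟨i, j⟩, hσ⟩ := σ
  obtain ⟨⟨k, r⟩, hτ⟩ := τ
  dsimp only at hσ hτ ⊢
  rw [starL, aL, dif_pos hσ, dif_pos hτ, pderiv_mulL_neg_X]
  have h1 : -q = l ↔ l + q = 0 := by
    rw [add_eq_zero_iff_eq_neg, eq_comm]
  simp only [xvar_inj, h1]
  congr 1
  by_cases h2 : l + q = 0 <;> simp [h2]

lemma ydotL_ymulL_commutator (i j : ℕ) (s m : MM N) :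
    (ydotL i s * ymulL j m - ymulL j m * ydotL i s : Module.End ℂ (Fock n N pos))
      = open Classical in
        (if i = j ∧ (1 ≤ j ∧ j ≤ n) ∧ pos (-m) ∧ s = -m then (1 : ℂ) else 0) • 1 := by
  classical
  by_cases hi : (1 ≤ i ∧ i ≤ n) ∧ pos s
  · by_cases hj : (1 ≤ j ∧ j ≤ n) ∧ pos (-m)
    · rw [ydotL, ymulL, dif_pos hi, dif_pos hj, pderiv_mulL_X]
      simp [yvar_inj, hj.1, hj.2]
    · rw [ymulL, dif_neg hj, if_neg (by tauto)]
      simp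
  · rw [ydotL, dif_neg hi, if_neg]
    · simp
    · rintro ⟨rfl, h1, h2, rfl⟩
      exact hi ⟨h1, h2⟩

lemma pderiv_support_finite {σ τ : Type*} (f : τ → σ) (hf : Function.Injective f)
    (u : MvPolynomial σ ℂ) :
    (Function.support fun m => MvPolynomial.pderiv (f m) u).Finite := by
  refine Set.Finite.subset (u.vars.finite_toSet.preimage hf.injOn) fun m hm => ?_
  by_contra h
  exact hm (MvPolynomial.pderiv_eq_zero_of_notMem_vars h)

lemma starL_finite (i j : ℕ) (u : Fock n N pos) :
    (Function.support fun m => starL i j m u).Finite := by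
  by_cases h : 1 ≤ i ∧ i < j ∧ j ≤ n + 1
  · simp only [starL, dif_pos h]
    refine pderiv_support_finite
      (fun m : MM N => (xvar ⟨(i, j), h⟩ (-m) : XIdx n N ⊕ YIdx n N pos)) ?_ u
    intro a b hab
    exact neg_injective (xvar_inj.1 hab).2
  · simp [starL, dif_neg h]

lemma ydotL_finite (i : ℕ) (u : Fock n N pos) :
    (Function.support fun m => ydotL i m u).Finite := by
  classical
  by_cases h : 1 ≤ i ∧ i ≤ n
  · have key := pderiv_support_finite
      (fun m : {k : MM N // pos k} => yvar (⟨i, h⟩ : {i : ℕ // 1 ≤ i ∧ i ≤ n}) m)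
      (fun a b hab => (yvar_inj.1 hab).2) u
    refine (key.image Subtype.val).subset fun m hm => ?_
    by_cases hp : pos m
    · refine ⟨⟨m, hp⟩, ?_, rfl⟩
      simpa [ydotL, h, hp] using hm
    · simp [ydotL, hp] at hm
  · simp [ydotL, h]

/-- The field `a^*_{ij}`. -/
def starField (i j : ℕ) : Module.End ℂ (Loop N (Fock n N pos)) :=
  field (starL i j) (starL_finite i j)

open scoped IsMulCommutative in
/-- Polynomials in the fields `a^*_{ij}`. -/
def hat : Coord n →ₐ[ℂ] Module.End ℂ (Loop N (Fock n N pos)) :=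
  let s : Set (Module.End ℂ (Loop N (Fock n N pos))) :=
    Set.range fun σ : Root n => starField σ.1.1 σ.1.2
  haveI : IsMulCommutative (Algebra.adjoin ℂ s) := Algebra.isMulCommutative_adjoin ℂ (by
    rintro _ ⟨σ, rfl⟩ _ ⟨τ, rfl⟩
    exact field_commute _ _ _ _ fun k l => starL_commute _ _ _ _ _ _)
  (Algebra.adjoin ℂ s).val.comp
    (MvPolynomial.aeval fun σ => ⟨starField σ.1.1 σ.1.2, Algebra.subset_adjoin ⟨σ, rfl⟩⟩)

open scoped IsMulCommutative in
lemma hat_X (σ : Root n) :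
    (hat (MvPolynomial.X σ) : Module.End ℂ (Loop N (Fock n N pos)))
      = starField σ.1.1 σ.1.2 := by
  simp [hat]

lemma hat_zc (i j : ℕ) :
    (hat (zc n i j) : Module.End ℂ (Loop N (Fock n N pos))) = starField i j := by
  by_cases h : 1 ≤ i ∧ i < j ∧ j ≤ n + 1
  · rw [zc, dif_pos h, hat_X]
  · rw [zc, dif_neg h, map_zero]
    refine Finsupp.lhom_ext fun l u => ?_
    rw [starField, field_single]
    have : series (starL i j) (starL_finite i j) u = 0 := by
      ext m
      simp [starL, dif_neg h]
    rw [this, map_zero, LinearMap.zero_apply]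

lemma hat_commute_of_X {Θ : Module.End ℂ (Loop N (Fock n N pos))}
    (h : ∀ σ : Root n, Commute (hat (MvPolynomial.X σ)) Θ) (P : Coord n) :
    Commute (hat P) Θ := by
  induction P using MvPolynomial.induction_on with
  | C c =>
    rw [← MvPolynomial.algebraMap_eq, AlgHom.commutes]
    exact Algebra.commutes c Θ
  | add P Q hP hQ => rw [map_add]; exact hP.add_left hQ
  | mul_X P σ hP => rw [map_mul]; exact hP.mul_left (h σ)

lemma hat_comm_shift (P : Coord n) (k : MM N) :
    Commute (hat P : Module.End ℂ (Loop N (Fock n N pos))) (shift k) :=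
  hat_commute_of_X (fun σ => by rw [hat_X]; exact field_comm_shift _ _ _) P

lemma lift_comm_hat {A : Module.End ℂ (Fock n N pos)} (h : ∀ i j m, Commute A (starL i j m))
    (P : Coord n) : Commute (lift A) (hat P) :=
  (hat_commute_of_X
    (fun σ => by rw [hat_X]; exact (lift_comm_field _ _ _ fun m => h _ _ _).symm) P).symm

lemma lift_hat_commutator {A : Module.End ℂ (Fock n N pos)}
    {v : Derivation ℂ (Coord n) (Coord n)} {m : MM N}
    (h : ∀ σ : Root n, lift A * hat (MvPolynomial.X σ) - hat (MvPolynomial.X σ) * lift A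
      = shift (-m) * hat (v (MvPolynomial.X σ))) (P : Coord n) :
    lift A * hat P - hat P * lift A = shift (-m) * hat (v P) := by
  induction P using MvPolynomial.induction_on with
  | C c =>
    have : v (MvPolynomial.C c) = 0 := by
      rw [← MvPolynomial.algebraMap_eq]; exact v.map_algebraMap c
    rw [this, map_zero, mul_zero, ← MvPolynomial.algebraMap_eq, AlgHom.commutes, sub_eq_zero]
    exact (Algebra.commutes c _).symm
  | add P Q hP hQ => rw [map_add, map_add, map_add, mul_add, add_mul, mul_add, ← hP, ← hQ]; abel
  | mul_X P σ hP =>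
    have e : lift A * hat (P * MvPolynomial.X σ) - hat (P * MvPolynomial.X σ) * lift A
        = (lift A * hat P - hat P * lift A) * hat (MvPolynomial.X σ)
          + hat P * (lift A * hat (MvPolynomial.X σ) - hat (MvPolynomial.X σ) * lift A) := by
      simp only [map_mul, sub_mul, mul_sub, mul_assoc]; abel
    have e2 : v (P * MvPolynomial.X σ) = v P * MvPolynomial.X σ + P * v (MvPolynomial.X σ) := by
      rw [v.leibniz, smul_eq_mul, smul_eq_mul]; ring
    rw [e, hP, h σ, e2, map_add, map_mul, map_mul, mul_add, mul_assoc, ← mul_assoc (hat P),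
      (hat_comm_shift P _).eq, mul_assoc]

/-- The mode `m` of the vector field `v`. -/
def vecOp (v : Derivation ℂ (Coord n) (Coord n)) (m : MM N) : Module.End ℂ (Fock n N pos) :=
  ∑ σ : Root n, modeMul (aL σ.1.1 σ.1.2) (hat (v (MvPolynomial.X σ))) m

lemma starL_vecOp_commutator (σ : Root n) (q : MM N) (v : Derivation ℂ (Coord n) (Coord n))
    (m : MM N) (u : Fock n N pos) :
    vecOp v m (starL σ.1.1 σ.1.2 q u) - starL σ.1.1 σ.1.2 q (vecOp v m u)
      = hat (v (MvPolynomial.X σ)) (const u) (m + q) := by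
  have key : ∀ τ : Root n,
      (starL σ.1.1 σ.1.2 q * modeMul (aL τ.1.1 τ.1.2) (hat (v (MvPolynomial.X τ))) m
        - modeMul (aL τ.1.1 τ.1.2) (hat (v (MvPolynomial.X τ))) m * starL σ.1.1 σ.1.2 q :
          Module.End ℂ (Fock n N pos)) u
      = (if σ = τ then -1 else 0 : ℂ) • hat (v (MvPolynomial.X τ)) (const u) (m + q) := by
    intro τ
    rw [commutator_modeMul]
    have h0 : Commute (lift (starL σ.1.1 σ.1.2 q : Module.End ℂ (Fock n N pos)))
        (hat (v (MvPolynomial.X τ))) := lift_comm_hat (fun i j m => starL_commute _ _ _ _ _ _) _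
    rw [h0.eq, sub_self, modeMul_zero, add_zero]
    simp only [starL_aL_commutator]
    rw [modeMul, LinearMap.comp_apply, contract_delta]
    rfl
  have := Finset.sum_congr (rfl : (Finset.univ : Finset (Root n)) = _) fun τ _ => key τ
  simp only [ite_smul, zero_smul, Finset.sum_ite_eq, Finset.mem_univ, if_true] at this
  rw [neg_one_smul] at this
  rw [← neg_inj, ← this, vecOp]
  simp [LinearMap.sum_apply]

lemma lift_vecOp_hat (v : Derivation ℂ (Coord n) (Coord n)) (m : MM N) (P : Coord n) :
    (lift (vecOp v m) * hat P - hat P * lift (vecOp v m) :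
      Module.End ℂ (Loop N (Fock n N pos))) = shift (-m) * hat (v P) := by
  refine lift_hat_commutator (fun σ => Finsupp.lhom_ext fun l u => ?_) P
  have e : lift (vecOp v m) (series (starL σ.1.1 σ.1.2) (starL_finite _ _) u)
      - series (starL σ.1.1 σ.1.2) (starL_finite _ _) (vecOp v m u)
      = shift (-m) (hat (v (MvPolynomial.X σ)) (const u)) := by
    ext1 q
    rw [Finsupp.sub_apply, lift_apply, series_apply, series_apply, starL_vecOp_commutator,
      shift_apply, sub_neg_eq_add, add_comm]
  have e1 := LinearMap.congr_fun (lift_comm_shift (N := N) (vecOp v m) l).eq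
    (series (starL σ.1.1 σ.1.2) (starL_finite _ _) u)
  have e2 := LinearMap.congr_fun
    (hat_comm_shift (pos := pos) (v (MvPolynomial.X σ)) l).eq (const u)
  simp only [Module.End.mul_apply, const_apply, shift_single, add_zero] at e e1 e2
  simp only [LinearMap.sub_apply, Module.End.mul_apply, hat_X, starField, field_single,
    lift_single]
  rw [e1, ← map_sub, e, e2]
  simp only [← Module.End.mul_apply]
  rw [← mul_assoc, ← mul_assoc, shift_mul_shift, shift_mul_shift, add_comm]

end Heisenberg

section LinearModes

variable {n N : ℕ} {pos : MM N → Prop}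

lemma modeMul_translate {V : Type*} [AddCommGroup V] [Module ℂ V] (X : MM N → Module.End ℂ V)
    (k : MM N) (Θ : Module.End ℂ (Loop N V)) (m : MM N) :
    modeMul (fun l => X (k + l)) Θ m = modeMul X Θ (k + m) := by
  have : contract (fun l => X (k + l)) m = contract X (k + m) := by
    refine Finsupp.lhom_ext fun l u => ?_
    simp [add_sub_assoc]
  rw [modeMul, this, modeMul]

lemma modeMul_family_sum {V ι : Type*} [AddCommGroup V] [Module ℂ V] (s : Finset ι)
    (X : ι → MM N → Module.End ℂ V) (Θ : Module.End ℂ (Loop N V)) (m : MM N) :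
    modeMul (fun l => ∑ i ∈ s, X i l) Θ m = ∑ i ∈ s, modeMul (X i) Θ m := by
  have : contract (fun l => ∑ i ∈ s, X i l) m = ∑ i ∈ s, contract (X i) m := by
    refine Finsupp.lhom_ext fun l u => ?_
    simp
  rw [modeMul, this]
  ext u
  simp [modeMul]

lemma modeMul_family_smul {V : Type*} [AddCommGroup V] [Module ℂ V] (c : ℂ)
    (X : MM N → Module.End ℂ V) (Θ : Module.End ℂ (Loop N V)) (m : MM N) :
    modeMul (fun l => c • X l) Θ m = c • modeMul X Θ m := by
  have : contract (fun l => c • X l) m = c • contract X m := by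
    refine Finsupp.lhom_ext fun l u => ?_
    simp
  rw [modeMul, this, LinearMap.smul_comp]
  rfl

lemma modeMul_family_neg {V : Type*} [AddCommGroup V] [Module ℂ V]
    (X : MM N → Module.End ℂ V) (Θ : Module.End ℂ (Loop N V)) (m : MM N) :
    modeMul (fun l => -X l) Θ m = -modeMul X Θ m := by
  have : contract (fun l => -X l) m = -contract X m := by
    refine Finsupp.lhom_ext fun l u => ?_
    simp
  rw [modeMul, this, LinearMap.neg_comp]
  rfl

/-- The mode `m` of the product of the family `X` with a polynomial in the fields `a^*_{ij}`. -/
def modeL (X : MM N → Module.End ℂ (Fock n N pos)) (m : MM N) :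
    Coord n →ₗ[ℂ] Module.End ℂ (Fock n N pos) where
  toFun P := modeMul X (hat P) m
  map_add' P Q := by rw [map_add, modeMul_add]
  map_smul' c P := by rw [map_smul, modeMul_smul, RingHom.id_apply]

lemma modeL_apply (X : MM N → Module.End ℂ (Fock n N pos)) (m : MM N) (P : Coord n) :
    modeL X m P = modeMul X (hat P) m := rfl

lemma modeL_one (X : MM N → Module.End ℂ (Fock n N pos)) (m : MM N) :
    modeL X m 1 = X m := by
  rw [modeL_apply, map_one, modeMul_one]

/-- The modes of vector fields, as a linear map. -/
def vecL (m : MM N) :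
    Derivation ℂ (Coord n) (Coord n) →ₗ[ℂ] Module.End ℂ (Fock n N pos) where
  toFun v := vecOp v m
  map_add' v w := by
    simp only [vecOp, Derivation.add_apply, map_add, modeMul_add, Finset.sum_add_distrib]
  map_smul' c v := by
    simp only [vecOp, Derivation.smul_apply, map_smul, modeMul_smul, Finset.smul_sum,
      RingHom.id_apply]

lemma vecL_apply (v : Derivation ℂ (Coord n) (Coord n)) (m : MM N) :
    (vecL m v : Module.End ℂ (Fock n N pos)) = vecOp v m := rfl

lemma vecL_smul_del (P : Coord n) (i j : ℕ) (m : MM N) :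
    (vecL m (P • del n i j) : Module.End ℂ (Fock n N pos)) = modeL (aL i j) m P := by
  classical
  rw [vecL_apply, vecOp, modeL_apply]
  by_cases h : 1 ≤ i ∧ i < j ∧ j ≤ n + 1
  · rw [Finset.sum_eq_single (⟨(i, j), h⟩ : Root n)]
    · rw [del, dif_pos h, Derivation.smul_apply, MvPolynomial.pderiv_X_self, smul_eq_mul, mul_one]
    · intro σ _ hσ
      rw [del, dif_pos h, Derivation.smul_apply, MvPolynomial.pderiv_X_of_ne hσ, smul_zero,
        map_zero, modeMul_zero]
    · simp
  · rw [del, dif_neg h, smul_zero]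
    have : (aL i j : MM N → Module.End ℂ (Fock n N pos)) = fun _ => 0 := by
      funext m; rw [aL, dif_neg h]
    rw [this, modeMul, contract_zero]
    simp [modeMul_zero]

lemma vecL_del (i j : ℕ) (m : MM N) :
    (vecL m (del n i j) : Module.End ℂ (Fock n N pos)) = aL i j m := by
  rw [← one_smul (Coord n) (del n i j), vecL_smul_del, modeL_one]

lemma vecL_pderiv (σ : Root n) (m : MM N) :
    (vecOp (MvPolynomial.pderiv σ) m : Module.End ℂ (Fock n N pos)) = aL σ.1.1 σ.1.2 m := by
  rw [← vecL_del, del, dif_pos σ.2]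
  rfl

lemma derivation_sum_apply {ι : Type*} (s : Finset ι)
    (D : ι → Derivation ℂ (Coord n) (Coord n)) (f : Coord n) :
    (∑ i ∈ s, D i) f = ∑ i ∈ s, D i f := by
  rw [← Derivation.coeFnAddMonoidHom_apply, map_sum, Finset.sum_apply]
  rfl

lemma derivation_chain (v : Derivation ℂ (Coord n) (Coord n)) (f : Coord n) :
    v f = ∑ σ : Root n, MvPolynomial.pderiv σ f * v (MvPolynomial.X σ) := by
  classical
  have : v = ∑ σ : Root n, v (MvPolynomial.X σ) •
      (MvPolynomial.pderiv σ : Derivation ℂ (Coord n) (Coord n)) := by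
    refine MvPolynomial.derivation_ext fun τ => ?_
    rw [derivation_sum_apply]
    simp [MvPolynomial.pderiv_X, Pi.single_apply]
  conv_lhs => rw [this]
  rw [derivation_sum_apply]
  simp [mul_comm]

lemma vecOp_aL_commutator (v : Derivation ℂ (Coord n) (Coord n)) (m : MM N) (τ : Root n)
    (k : MM N) :
    (vecOp v m * aL τ.1.1 τ.1.2 k - aL τ.1.1 τ.1.2 k * vecOp v m :
      Module.End ℂ (Fock n N pos))
    = -∑ σ : Root n, modeMul (aL σ.1.1 σ.1.2)
        (hat (MvPolynomial.pderiv τ (v (MvPolynomial.X σ)))) (m + k) := by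
  rw [← neg_sub, neg_inj, vecOp, Finset.mul_sum, Finset.sum_mul,
    ← Finset.sum_sub_distrib]
  refine Finset.sum_congr rfl fun σ _ => ?_
  rw [commutator_modeMul, ← vecL_pderiv, lift_vecOp_hat, modeMul_shift, sub_neg_eq_add]
  have : (fun l => vecOp (MvPolynomial.pderiv τ) k * aL σ.1.1 σ.1.2 l
      - aL σ.1.1 σ.1.2 l * vecOp (MvPolynomial.pderiv τ) k :
        MM N → Module.End ℂ (Fock n N pos)) = fun _ => 0 := by
    funext l
    rw [vecL_pderiv, (aL_commute _ _ _ _ _ _).eq, sub_self]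
  rw [this, modeMul, contract_zero, LinearMap.zero_comp, zero_add]

lemma vecOp_modeMul_aL_commutator (v : Derivation ℂ (Coord n) (Coord n)) (m : MM N)
    (τ : Root n) (P : Coord n) (l : MM N) :
    (vecOp v m * modeMul (aL τ.1.1 τ.1.2) (hat P) l
      - modeMul (aL τ.1.1 τ.1.2) (hat P) l * vecOp v m : Module.End ℂ (Fock n N pos))
    = modeL (aL τ.1.1 τ.1.2) (m + l) (v P)
      - ∑ σ : Root n, modeL (aL σ.1.1 σ.1.2) (m + l)
        (MvPolynomial.pderiv τ (v (MvPolynomial.X σ)) * P) := by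
  rw [commutator_modeMul, lift_vecOp_hat, modeMul_shift, sub_neg_eq_add, add_comm l m,
    funext (vecOp_aL_commutator v m τ), modeMul_family_neg, modeMul_family_sum,
    neg_add_eq_sub]
  refine congrArg₂ _ rfl (Finset.sum_congr rfl fun σ _ => ?_)
  rw [modeMul_translate, modeMul_modeMul _ (hat_comm_shift _), modeL_apply, map_mul]

lemma vecOp_commutator (v v' : Derivation ℂ (Coord n) (Coord n)) (m l : MM N) :
    (vecOp v m * vecOp v' l - vecOp v' l * vecOp v m : Module.End ℂ (Fock n N pos))
      = vecOp ⁅v, v'⁆ (m + l) := by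
  have h4 : (vecOp v' l : Module.End ℂ (Fock n N pos))
      = ∑ σ : Root n, modeMul (aL σ.1.1 σ.1.2) (hat (v' (MvPolynomial.X σ))) l := rfl
  have h5 : (vecOp ⁅v, v'⁆ (m + l) : Module.End ℂ (Fock n N pos))
      = ∑ σ : Root n, modeL (aL σ.1.1 σ.1.2) (m + l) (⁅v, v'⁆ (MvPolynomial.X σ)) := rfl
  rw [h4, h5, Finset.mul_sum, Finset.sum_mul, ← Finset.sum_sub_distrib]
  simp only [vecOp_modeMul_aL_commutator]
  rw [Finset.sum_sub_distrib, Finset.sum_comm, ← Finset.sum_sub_distrib]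
  refine Finset.sum_congr rfl fun σ _ => ?_
  rw [Derivation.commutator_apply, map_sub, derivation_chain v' (v _), map_sum]

lemma vecOp_commutator_modeL {X : MM N → Module.End ℂ (Fock n N pos)}
    (v : Derivation ℂ (Coord n) (Coord n)) (m : MM N) (h : ∀ l, Commute (vecOp v m) (X l))
    (P : Coord n) (l : MM N) :
    vecOp v m * modeL X l P - modeL X l P * vecOp v m = modeL X (m + l) (v P) := by
  rw [modeL_apply, commutator_modeMul, lift_vecOp_hat, modeMul_shift, sub_neg_eq_add,
    add_comm l m]
  have : (fun k => vecOp v m * X k - X k * vecOp v m) = fun _ => 0 := by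
    funext k; rw [(h k).eq, sub_self]
  rw [this, modeMul, contract_zero, LinearMap.zero_comp, zero_add]
  rfl

end LinearModes

section Forms

variable {n N : ℕ} {pos : MM N → Prop}

/-- The `p`-th derivative of the field attached to `P`. -/
def eulerD (p : Fin (N + 1)) (P : Coord n) : Module.End ℂ (Loop N (Fock n N pos)) :=
  euler p * hat P - hat P * euler p

/-- The scalar family `κ_{-m,p}`. -/
def kmode (kappa : MM N → Fin (N + 1) → ℂ) (p : Fin (N + 1)) (m : MM N) :
    Module.End ℂ (Fock n N pos) := kappa (-m) p • 1

lemma eulerD_add (p : Fin (N + 1)) (P Q : Coord n) :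
    (eulerD p (P + Q) : Module.End ℂ (Loop N (Fock n N pos))) = eulerD p P + eulerD p Q := by
  simp only [eulerD, map_add, mul_add, add_mul]; abel

lemma eulerD_smul (p : Fin (N + 1)) (c : ℂ) (P : Coord n) :
    (eulerD p (c • P) : Module.End ℂ (Loop N (Fock n N pos))) = c • eulerD p P := by
  simp only [eulerD, map_smul, mul_smul_comm, smul_mul_assoc, smul_sub]

lemma eulerD_mul (p : Fin (N + 1)) (P Q : Coord n) :
    (eulerD p (P * Q) : Module.End ℂ (Loop N (Fock n N pos)))
      = eulerD p P * hat Q + hat P * eulerD p Q := by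
  simp only [eulerD, map_mul, mul_sub, sub_mul, mul_assoc]; abel

lemma eulerD_C (p : Fin (N + 1)) (c : ℂ) :
    (eulerD p (MvPolynomial.C c : Coord n) : Module.End ℂ (Loop N (Fock n N pos))) = 0 := by
  rw [eulerD, ← MvPolynomial.algebraMap_eq, AlgHom.commutes, sub_eq_zero]
  exact (Algebra.commutes c _).symm

lemma eulerD_one (p : Fin (N + 1)) :
    (eulerD p (1 : Coord n) : Module.End ℂ (Loop N (Fock n N pos))) = 0 := by
  rw [eulerD, map_one, mul_one, one_mul, sub_self]

lemma euler_apply {V : Type*} [AddCommGroup V] [Module ℂ V] (p : Fin (N + 1))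
    (f : Loop N V) (m : MM N) : euler p f m = (-(m p : ℂ)) • f m := by
  induction f using Finsupp.induction_linear with
  | zero => simp
  | add f g hf hg => simp only [map_add, Finsupp.add_apply, hf, hg, smul_add]
  | single l u =>
    rw [euler_single, Finsupp.smul_apply, Finsupp.single_apply]
    by_cases h : l = m <;> simp [h]

lemma eulerD_X (p : Fin (N + 1)) (σ : Root n) :
    (eulerD p (MvPolynomial.X σ) : Module.End ℂ (Loop N (Fock n N pos)))
      = field (fun m => (-(m p : ℂ)) • starL σ.1.1 σ.1.2 m) (fun u =>
        (starL_finite σ.1.1 σ.1.2 u).subset fun m hm h => hm (by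
          change (-(m p : ℂ)) • starL σ.1.1 σ.1.2 m u = 0
          rw [show starL σ.1.1 σ.1.2 m u = 0 from h, smul_zero])) := by
  refine Finsupp.lhom_ext fun l u => ?_
  have h1 := LinearMap.congr_fun (euler_mul_shift p l)
    (series (starL σ.1.1 σ.1.2) (starL_finite (pos := pos) σ.1.1 σ.1.2) u)
  simp only [Module.End.mul_apply, LinearMap.sub_apply, LinearMap.smul_apply] at h1
  simp only [eulerD, hat_X, starField, LinearMap.sub_apply, Module.End.mul_apply, field_single,
    euler_single, map_smul, h1]
  rw [neg_smul, sub_neg_eq_add, sub_add_cancel]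
  congr 1
  ext1 m
  rw [euler_apply, series_apply, series_apply, LinearMap.smul_apply]

lemma eulerD_commute_hat (p : Fin (N + 1)) (P Q : Coord n) :
    Commute (eulerD p P : Module.End ℂ (Loop N (Fock n N pos))) (hat Q) := by
  refine (hat_commute_of_X (fun σ => ?_) Q).symm
  induction P using MvPolynomial.induction_on with
  | C c => rw [eulerD_C]; exact Commute.zero_right _
  | add P Q hP hQ => rw [eulerD_add]; exact hP.add_right hQ
  | mul_X P τ hP =>
    rw [eulerD_mul]
    have h1 : ∀ R : Coord n, Commute
        (hat (MvPolynomial.X σ) : Module.End ℂ (Loop N (Fock n N pos))) (hat R) := fun R => by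
      rw [commute_iff_eq, ← map_mul, ← map_mul, mul_comm]
    refine (hP.mul_right (h1 _)).add_right ((h1 _).mul_right ?_)
    rw [eulerD_X, hat_X, starField]
    exact field_commute _ _ _ _ fun k l => (starL_commute _ _ _ _ _ _).smul_right _

lemma eulerD_comm_shift (p : Fin (N + 1)) (P : Coord n) (k : MM N) :
    Commute (eulerD p P : Module.End ℂ (Loop N (Fock n N pos))) (shift k) := by
  rw [commute_iff_eq, eulerD, sub_mul, mul_sub, mul_assoc, mul_assoc, (hat_comm_shift P k).eq,
    euler_mul_shift, ← mul_assoc, euler_mul_shift, mul_sub, sub_mul, ← mul_assoc (hat P),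
    (hat_comm_shift P k).eq, mul_smul_comm, smul_mul_assoc, (hat_comm_shift P k).eq]
  simp only [mul_assoc]
  abel

lemma lift_comm_eulerD {A : Module.End ℂ (Fock n N pos)} (h : ∀ i j m, Commute A (starL i j m))
    (p : Fin (N + 1)) (P : Coord n) : Commute (lift A) (eulerD p P) :=
  ((lift_comm_euler A p).mul_right (lift_comm_hat h P)).sub_right
    ((lift_comm_hat h P).mul_right (lift_comm_euler A p))

lemma commute_modeMul_kmode {A : Module.End ℂ (Fock n N pos)}
    (kappa : MM N → Fin (N + 1) → ℂ) (p : Fin (N + 1))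
    {Θ : Module.End ℂ (Loop N (Fock n N pos))} (h : Commute (lift A) Θ) (m : MM N) :
    Commute A (modeMul (kmode kappa p) Θ m) :=
  commute_modeMul (fun _ => (Commute.one_right A).smul_right _) h m

lemma commutator_modeMul_kmode (A : Module.End ℂ (Fock n N pos))
    (kappa : MM N → Fin (N + 1) → ℂ) (p : Fin (N + 1))
    (Θ : Module.End ℂ (Loop N (Fock n N pos))) (m : MM N) :
    A * modeMul (kmode kappa p) Θ m - modeMul (kmode kappa p) Θ m * A
      = modeMul (kmode kappa p) (lift A * Θ - Θ * lift A) m := by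
  rw [commutator_modeMul]
  have : (fun l => A * kmode kappa p l - kmode kappa p l * A) = fun _ => 0 := by
    funext l; rw [kmode, ((Commute.one_right A).smul_right (kappa (-l) p)).eq, sub_self]
  rw [this, modeMul, contract_zero, LinearMap.zero_comp, zero_add]

/-- The mode `m` of the pairing of `κ` with the one-form `Q dP`. -/
def formL (kappa : MM N → Fin (N + 1) → ℂ) (m : MM N) :
    Coord n →ₗ[ℂ] Coord n →ₗ[ℂ] Module.End ℂ (Fock n N pos) :=
  LinearMap.mk₂ ℂ
    (fun Q P => ∑ p : Fin (N + 1), modeMul (kmode kappa p) (eulerD p P * hat Q) m)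
    (fun Q Q' P => by simp only [map_add, mul_add, modeMul_add, Finset.sum_add_distrib])
    (fun c Q P => by simp only [map_smul, mul_smul_comm, modeMul_smul, Finset.smul_sum])
    (fun Q P P' => by simp only [eulerD_add, add_mul, modeMul_add, Finset.sum_add_distrib])
    (fun c Q P => by simp only [eulerD_smul, smul_mul_assoc, modeMul_smul, Finset.smul_sum])

lemma formL_apply (kappa : MM N → Fin (N + 1) → ℂ) (m : MM N) (Q P : Coord n) :
    (formL kappa m Q P : Module.End ℂ (Fock n N pos))
      = ∑ p : Fin (N + 1), modeMul (kmode kappa p) (eulerD p P * hat Q) m := rfl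

/-- The pairing `Σ_p m_p (κ_p P)` in mode `l`. -/
def scalL (kappa : MM N → Fin (N + 1) → ℂ) (m l : MM N) :
    Coord n →ₗ[ℂ] Module.End ℂ (Fock n N pos) :=
  ∑ p : Fin (N + 1), (m p : ℂ) • modeL (kmode kappa p) l

lemma scalL_apply (kappa : MM N → Fin (N + 1) → ℂ) (m l : MM N) (P : Coord n) :
    (scalL kappa m l P : Module.End ℂ (Fock n N pos))
      = ∑ p : Fin (N + 1), (m p : ℂ) • modeMul (kmode kappa p) (hat P) l := by
  simp [scalL, modeL_apply]

lemma scalL_one (kappa : MM N → Fin (N + 1) → ℂ) (m l : MM N) :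
    (scalL kappa m l 1 : Module.End ℂ (Fock n N pos))
      = (∑ p : Fin (N + 1), (m p : ℂ) * kappa (-l) p) • 1 := by
  simp only [scalL_apply, map_one, modeMul_one, kmode, Finset.sum_smul, mul_smul]

lemma scalL_add_left (kappa : MM N → Fin (N + 1) → ℂ) (m k l : MM N) (P : Coord n) :
    (scalL kappa (m + k) l P : Module.End ℂ (Fock n N pos))
      = scalL kappa m l P + scalL kappa k l P := by
  simp only [scalL_apply, Pi.add_apply, Int.cast_add, add_smul, Finset.sum_add_distrib]

lemma formL_one_right (kappa : MM N → Fin (N + 1) → ℂ) (m : MM N) (Q : Coord n) :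
    (formL kappa m Q 1 : Module.End ℂ (Fock n N pos)) = 0 := by
  simp [formL_apply, eulerD_one, modeMul_zero]

lemma formL_leibniz (kappa : MM N → Fin (N + 1) → ℂ) (m : MM N) (Q P P' : Coord n) :
    (formL kappa m Q (P * P') : Module.End ℂ (Fock n N pos))
      = formL kappa m (Q * P') P + formL kappa m (Q * P) P' := by
  simp only [formL_apply, ← Finset.sum_add_distrib, ← modeMul_add]
  refine Finset.sum_congr rfl fun p _ => ?_
  rw [eulerD_mul, add_mul, ← (eulerD_commute_hat p P' P).eq, mul_assoc, mul_assoc, ← map_mul,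
    ← map_mul, mul_comm P' Q, mul_comm P Q]

lemma commute_formL {A : Module.End ℂ (Fock n N pos)} (h : ∀ i j m, Commute A (starL i j m))
    (kappa : MM N → Fin (N + 1) → ℂ) (m : MM N) (Q P : Coord n) :
    Commute A (formL kappa m Q P) := by
  rw [formL_apply]
  exact Commute.sum_right _ _ _ fun p _ => commute_modeMul_kmode kappa p
    ((lift_comm_eulerD h p P).mul_right (lift_comm_hat h Q)) m

lemma starL_commute_formL (kappa : MM N → Fin (N + 1) → ℂ) (m : MM N) (Q P : Coord n)
    (i j : ℕ) (l : MM N) :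
    Commute (formL kappa m Q P : Module.End ℂ (Fock n N pos)) (starL i j l) :=
  (commute_formL (fun _ _ _ => starL_commute _ _ _ _ _ _) kappa m Q P).symm

lemma formL_commute_formL (kappa : MM N → Fin (N + 1) → ℂ) (m l : MM N) (Q P Q' P' : Coord n) :
    Commute (formL kappa m Q P : Module.End ℂ (Fock n N pos)) (formL kappa l Q' P') :=
  commute_formL (starL_commute_formL kappa m Q P) _ _ _ _

/-- Pairing of `κ` with a total derivative. -/
lemma sum_contract_euler {kappa : MM N → Fin (N + 1) → ℂ}
    (hE1 : ∀ m : MM N, ∑ p : Fin (N + 1), (m p : ℂ) * kappa m p = 0) (m : MM N)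
    (f : Loop N (Fock n N pos)) :
    ∑ p, contract (kmode kappa p) m (euler p f)
      = -∑ p, (m p : ℂ) • contract (kmode kappa p) m f := by
  induction f using Finsupp.induction_linear with
  | zero => simp
  | add f g hf hg =>
    simp only [map_add, smul_add, Finset.sum_add_distrib, hf, hg, neg_add]
  | single l u =>
    have h := hE1 (-(m - l))
    simp only [Pi.neg_apply, Pi.sub_apply, Int.cast_neg, Int.cast_sub] at h
    simp only [euler_single, map_smul, contract_single, kmode, LinearMap.smul_apply,
      Module.End.one_apply, smul_smul, ← Finset.sum_smul, ← neg_smul, ← Finset.sum_neg_distrib]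
    congr 1
    rw [← sub_eq_zero, ← Finset.sum_sub_distrib, ← neg_eq_zero, ← Finset.sum_neg_distrib, ← h]
    refine Finset.sum_congr rfl fun p _ => ?_
    ring

lemma sum_modeMul_euler {kappa : MM N → Fin (N + 1) → ℂ}
    (hE1 : ∀ m : MM N, ∑ p : Fin (N + 1), (m p : ℂ) * kappa m p = 0) (m : MM N)
    (Θ : Module.End ℂ (Loop N (Fock n N pos))) :
    ∑ p, modeMul (kmode kappa p) (euler p * Θ) m
      = -∑ p, (m p : ℂ) • modeMul (kmode kappa p) Θ m := by
  refine LinearMap.ext fun u => ?_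
  have := sum_contract_euler hE1 m (Θ (const u))
  simpa [modeMul, LinearMap.sum_apply] using this

lemma formL_one_left {kappa : MM N → Fin (N + 1) → ℂ}
    (hE1 : ∀ m : MM N, ∑ p : Fin (N + 1), (m p : ℂ) * kappa m p = 0) (m : MM N) (P : Coord n) :
    (formL kappa m 1 P : Module.End ℂ (Fock n N pos)) = -scalL kappa m m P := by
  have h : ∀ p, (modeMul (kmode kappa p) (hat P * euler p) m : Module.End ℂ (Fock n N pos))
      = 0 := by
    intro p
    refine LinearMap.ext fun u => ?_
    simp [modeMul]
  rw [formL_apply, scalL_apply, ← sum_modeMul_euler hE1]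
  refine Finset.sum_congr rfl fun p _ => ?_
  rw [map_one, mul_one, eulerD, modeMul_sub, h, sub_zero]

lemma euler_mul_shift_neg {V : Type*} [AddCommGroup V] [Module ℂ V] (p : Fin (N + 1))
    (k : MM N) : (euler p * shift (-k) : Module.End ℂ (Loop N V))
      = shift (-k) * euler p + (k p : ℂ) • shift (-k) := by
  refine LinearMap.ext fun f => ?_
  rw [euler_mul_shift]
  simp

lemma lift_vecOp_eulerD (v : Derivation ℂ (Coord n) (Coord n)) (m : MM N) (p : Fin (N + 1))
    (P : Coord n) :
    (lift (vecOp v m) * eulerD p P - eulerD p P * lift (vecOp v m) :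
      Module.End ℂ (Loop N (Fock n N pos)))
      = shift (-m) * (eulerD p (v P) + (m p : ℂ) • hat (v P)) := by
  have h := (lift_comm_euler (N := N) (vecOp v m : Module.End ℂ (Fock n N pos)) p).eq
  have e : (lift (vecOp v m) * eulerD p P - eulerD p P * lift (vecOp v m) :
      Module.End ℂ (Loop N (Fock n N pos)))
      = euler p * (lift (vecOp v m) * hat P - hat P * lift (vecOp v m))
        - (lift (vecOp v m) * hat P - hat P * lift (vecOp v m)) * euler p := by
    simp only [eulerD, mul_sub, sub_mul, ← mul_assoc, h]
    simp only [mul_assoc, h]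
    abel
  rw [e, lift_vecOp_hat, ← mul_assoc, euler_mul_shift_neg, eulerD]
  simp only [add_mul, mul_add, mul_sub, mul_assoc, mul_smul_comm, smul_mul_assoc]
  rw [add_sub_right_comm]

lemma vecOp_commutator_formL (kappa : MM N → Fin (N + 1) → ℂ)
    (v : Derivation ℂ (Coord n) (Coord n)) (m l : MM N) (Q P : Coord n) :
    (vecOp v m * formL kappa l Q P - formL kappa l Q P * vecOp v m :
      Module.End ℂ (Fock n N pos))
      = formL kappa (m + l) (v Q) P + formL kappa (m + l) Q (v P)
        + scalL kappa m (m + l) (Q * v P) := by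
  simp only [formL_apply, scalL_apply, Finset.mul_sum, Finset.sum_mul, ← Finset.sum_sub_distrib,
    ← Finset.sum_add_distrib, commutator_modeMul_kmode]
  refine Finset.sum_congr rfl fun p _ => ?_
  have e : (lift (vecOp v m) * (eulerD p P * hat Q) - eulerD p P * hat Q * lift (vecOp v m) :
      Module.End ℂ (Loop N (Fock n N pos)))
      = shift (-m) * (eulerD p P * hat (v Q) + eulerD p (v P) * hat Q
        + (m p : ℂ) • hat (Q * v P)) := by
    have e1 : (lift (vecOp v m) * (eulerD p P * hat Q) - eulerD p P * hat Q * lift (vecOp v m) :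
      Module.End ℂ (Loop N (Fock n N pos)))
      = (lift (vecOp v m) * eulerD p P - eulerD p P * lift (vecOp v m)) * hat Q
        + eulerD p P * (lift (vecOp v m) * hat Q - hat Q * lift (vecOp v m)) := by
      simp only [mul_sub, sub_mul, mul_assoc]; abel
    rw [e1, lift_vecOp_hat, lift_vecOp_eulerD, ← mul_assoc (eulerD p P),
      (eulerD_comm_shift p P _).eq, mul_comm Q, map_mul]
    simp only [mul_add, add_mul, mul_assoc, smul_mul_assoc, mul_smul_comm]
    abel
  rw [e, modeMul_shift, sub_neg_eq_add, modeMul_add, modeMul_add, modeMul_smul, add_comm l m]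

lemma formL_one_left_commutator_vecOp {kappa : MM N → Fin (N + 1) → ℂ}
    (hE1 : ∀ m : MM N, ∑ p : Fin (N + 1), (m p : ℂ) * kappa m p = 0)
    (v : Derivation ℂ (Coord n) (Coord n)) (m l : MM N) (P : Coord n) :
    (formL kappa m 1 P * vecOp v l - vecOp v l * formL kappa m 1 P :
      Module.End ℂ (Fock n N pos)) = scalL kappa m (m + l) (v P) := by
  rw [← neg_sub, vecOp_commutator_formL, v.map_one_eq_zero, map_zero, LinearMap.zero_apply,
    formL_one_left hE1, add_comm l m, scalL_add_left, one_mul]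
  abel

end Forms

section Bosons

variable {n N : ℕ} {pos : MM N → Prop}

/-- The operator `Σ_s f(s) ∂/∂y_i(s)`. -/
def ydotSum (i : ℕ) (f : MM N → ℂ) : Module.End ℂ (Fock n N pos) :=
  (Finsupp.lsum ℂ fun s => f s • (1 : Module.End ℂ (Fock n N pos)))
    ∘ₗ series (ydotL i) (ydotL_finite i)

lemma ydotSum_apply (i : ℕ) (f : MM N → ℂ) (u : Fock n N pos) :
    ydotSum i f u = ∑ᶠ s : MM N, f s • ydotL i s u := by
  rw [finsum_eq_sum_of_support_subset (s := (ydotL_finite i u).toFinset)]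
  · have h : (series (ydotL i) (ydotL_finite i) u).support = (ydotL_finite i u).toFinset := by
      ext m; simp
    rw [ydotSum, LinearMap.comp_apply, Finsupp.lsum_apply, Finsupp.sum, h]
    rfl
  · intro s hs
    simp only [Set.Finite.coe_toFinset, Function.mem_support] at hs ⊢
    intro h0
    rw [h0, smul_zero] at hs
    exact hs rfl

lemma ydotSum_finite (i : ℕ) (f : MM N → ℂ) (u : Fock n N pos) :
    (Function.support fun s => f s • ydotL i s u).Finite :=
  (ydotL_finite i u).subset fun s hs h0 => hs (by
    change f s • ydotL i s u = 0
    rw [show ydotL i s u = 0 from h0, smul_zero])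

lemma commute_ydotSum {A : Module.End ℂ (Fock n N pos)} {i : ℕ}
    (h : ∀ s, Commute A (ydotL i s)) (f : MM N → ℂ) : Commute A (ydotSum i f) := by
  refine LinearMap.ext fun u => ?_
  rw [Module.End.mul_apply, Module.End.mul_apply, ydotSum_apply, ydotSum_apply,
    map_finsum _ (ydotSum_finite i f u)]
  refine finsum_congr fun s => ?_
  rw [map_smul]
  exact congrArg _ (LinearMap.congr_fun (h s).eq u)

open Classical in
lemma ydotSum_ymulL_commutator (i j : ℕ) (f : MM N → ℂ) (m : MM N) :
    (ydotSum i f * ymulL j m - ymulL j m * ydotSum i f : Module.End ℂ (Fock n N pos))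
      = (if i = j ∧ (1 ≤ j ∧ j ≤ n) ∧ pos (-m) then f (-m) else 0) • 1 := by
  refine LinearMap.ext fun u => ?_
  rw [LinearMap.sub_apply, Module.End.mul_apply, Module.End.mul_apply, ydotSum_apply,
    ydotSum_apply, map_finsum _ (ydotSum_finite i f u),
    ← finsum_sub_distrib (ydotSum_finite i f _)]
  · have key : ∀ s, f s • ydotL i s (ymulL j m u) - ymulL j m (f s • ydotL i s u)
        = if s = -m then
          (if i = j ∧ (1 ≤ j ∧ j ≤ n) ∧ pos (-m) then f (-m) else 0) • u else 0 := by
      intro s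
      have h := LinearMap.congr_fun (ydotL_ymulL_commutator (pos := pos) (n := n) i j s m) u
      simp only [LinearMap.sub_apply, Module.End.mul_apply, LinearMap.smul_apply,
        Module.End.one_apply] at h
      rw [map_smul, ← smul_sub, h, smul_smul]
      by_cases hs : s = -m
      · subst hs
        by_cases hc : i = j ∧ (1 ≤ j ∧ j ≤ n) ∧ pos (-m)
        · simp [hc]
        · rw [if_pos rfl, if_neg hc, if_neg (by tauto), mul_zero]
      · rw [if_neg hs, if_neg (by tauto), mul_zero, zero_smul]
    rw [finsum_congr key, finsum_eq_single _ (-m) fun s hs => if_neg hs, if_pos rfl]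
    rfl
  · exact (ydotSum_finite i f u).subset fun s hs h0 => hs (by
      change ymulL j m (f s • ydotL i s u) = 0
      rw [show f s • ydotL i s u = 0 from h0, map_zero])

/-- The annihilation part of `Phi`. -/
def PhiDot (kappa : MM N → Fin (N + 1) → ℂ) (i : ℕ) (m : MM N) :
    Module.End ℂ (Fock n N pos) :=
  theta pos (-m) • (ydotSum (i - 1) (cnum kappa m) - ydotSum i (cnum kappa m))
    + theta pos m • (ydotSum (i - 1) (cnum kappa m) - (2 : ℂ) • ydotSum i (cnum kappa m)
      + ydotSum (i + 1) (cnum kappa m))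

/-- `Phi` as a linear map. -/
def PhiL (kappa : MM N → Fin (N + 1) → ℂ) (lam : ℕ → ℂ) (i : ℕ) (m : MM N) :
    Module.End ℂ (Fock n N pos) :=
  PhiDot kappa i m + ymulL i m - (if m = 0 then lam i else 0) • 1

lemma coe_PhiL (kappa : MM N → Fin (N + 1) → ℂ) (lam : ℕ → ℂ) (i : ℕ) (m : MM N) :
    ⇑(PhiL kappa lam i m) = Phi n N pos kappa lam i m := by
  classical
  funext w
  have h1 : ∑ᶠ s : MM N, cnum kappa m s • (ydot n N pos (i - 1) s w - ydot n N pos i s w)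
      = ydotSum (i - 1) (cnum kappa m) w - ydotSum i (cnum kappa m) w := by
    rw [ydotSum_apply, ydotSum_apply, ← finsum_sub_distrib (ydotSum_finite _ _ _)
      (ydotSum_finite _ _ _)]
    simp only [smul_sub, coe_ydotL]
  have h2 : ∑ᶠ s : MM N, cnum kappa m s • (ydot n N pos (i - 1) s w
        - (2 : ℂ) • ydot n N pos i s w + ydot n N pos (i + 1) s w)
      = ydotSum (i - 1) (cnum kappa m) w - (2 : ℂ) • ydotSum i (cnum kappa m) w
        + ydotSum (i + 1) (cnum kappa m) w := by
    have hf : (Function.support fun s => (2 : ℂ) • (cnum kappa m s • ydotL i s w)).Finite :=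
      (ydotSum_finite i (cnum kappa m) w).subset fun s hs h0 => hs (by
        change (2 : ℂ) • (cnum kappa m s • ydotL i s w) = 0
        rw [show cnum kappa m s • ydotL i s w = 0 from h0, smul_zero])
    rw [ydotSum_apply, ydotSum_apply, ydotSum_apply, smul_finsum,
      ← finsum_sub_distrib (ydotSum_finite _ _ _) hf, ← finsum_add_distrib _
      (ydotSum_finite _ _ _)]
    · refine finsum_congr fun s => ?_
      rw [smul_add, smul_sub, smul_comm _ (2 : ℂ)]
      simp only [coe_ydotL]
    · exact ((ydotSum_finite (i - 1) (cnum kappa m) w).union hf).subset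
        (Function.support_sub _ _)
  have h3 : ymulL i m w = if h : (1 ≤ i ∧ i ≤ n) ∧ pos (-m) then
      (MvPolynomial.X (Sum.inr ((⟨i, h.1⟩, ⟨-m, h.2⟩) : YIdx n N pos)) :
          Fock n N pos) * w else 0 := by
    by_cases h : (1 ≤ i ∧ i ≤ n) ∧ pos (-m)
    · rw [ymulL, dif_pos h]
      exact (dif_pos (α := Fock n N pos)
        (t := fun h => (MvPolynomial.X (yvar ⟨i, h.1⟩ ⟨-m, h.2⟩) : Fock n N pos) * w)
        (e := fun _ => 0) h).symm
    · rw [ymulL, dif_neg h]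
      exact (dif_neg (α := Fock n N pos)
        (t := fun h => (MvPolynomial.X (yvar ⟨i, h.1⟩ ⟨-m, h.2⟩) : Fock n N pos) * w)
        (e := fun _ => 0) h).symm
  rw [Phi, h1, h2, ← h3]
  rfl

lemma starL_commute_PhiL (kappa : MM N → Fin (N + 1) → ℂ) (lam : ℕ → ℂ) (r : ℕ) (k : MM N)
    (i j : ℕ) (m : MM N) :
    Commute (starL i j m : Module.End ℂ (Fock n N pos)) (PhiL kappa lam r k) := by
  have h : ∀ q f, Commute (starL i j m : Module.End ℂ (Fock n N pos)) (ydotSum q f) :=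
    fun q f => commute_ydotSum (fun s => starL_commute_ydotL _ _ _ _ _) f
  exact ((((((h _ _).sub_right (h _ _)).smul_right _).add_right
    ((((h _ _).sub_right ((h _ _).smul_right _)).add_right (h _ _)).smul_right _)).add_right
    (starL_commute_ymulL _ _ _ _ _)).sub_right ((Commute.one_right _).smul_right _))

lemma aL_commute_PhiL (kappa : MM N → Fin (N + 1) → ℂ) (lam : ℕ → ℂ) (r : ℕ) (k : MM N)
    (i j : ℕ) (m : MM N) :
    Commute (aL i j m : Module.End ℂ (Fock n N pos)) (PhiL kappa lam r k) := by
  have h : ∀ q f, Commute (aL i j m : Module.End ℂ (Fock n N pos)) (ydotSum q f) :=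
    fun q f => commute_ydotSum (fun s => aL_commute_ydotL _ _ _ _ _) f
  exact ((((((h _ _).sub_right (h _ _)).smul_right _).add_right
    ((((h _ _).sub_right ((h _ _).smul_right _)).add_right (h _ _)).smul_right _)).add_right
    (aL_commute_ymulL _ _ _ _ _)).sub_right ((Commute.one_right _).smul_right _))

lemma vecOp_commute_PhiL (v : Derivation ℂ (Coord n) (Coord n)) (m : MM N)
    (kappa : MM N → Fin (N + 1) → ℂ) (lam : ℕ → ℂ) (r : ℕ) (k : MM N) :
    Commute (vecOp v m : Module.End ℂ (Fock n N pos)) (PhiL kappa lam r k) := by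
  refine Commute.sum_left _ _ _ fun σ _ => (commute_modeMul (fun l => ?_) ?_ m).symm
  · exact (aL_commute_PhiL _ _ _ _ _ _ _).symm
  · exact lift_comm_hat (fun i j q => (starL_commute_PhiL _ _ _ _ _ _ _).symm) _

/-- The Cartan matrix of type `A`. -/
def cartan (i j : ℕ) : ℂ :=
  2 * (if i = j then 1 else 0) - (if i = j + 1 then 1 else 0) - (if i + 1 = j then 1 else 0)

open Classical in
lemma PhiDot_ymulL_commutator (kappa : MM N → Fin (N + 1) → ℂ) {i j : ℕ} (hi : 1 ≤ i)
    (hj : 1 ≤ j) (hjn : j ≤ n) (m l : MM N) :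
    (PhiDot kappa i m * ymulL j l - ymulL j l * PhiDot kappa i m : Module.End ℂ (Fock n N pos))
      = (if pos (-l) then (theta pos (-m) * ((if i = j + 1 then 1 else 0) - (if i = j then 1 else 0))
        - theta pos m * cartan i j) * cnum kappa m (-l) else 0) • 1 := by
  have e : (PhiDot kappa i m * ymulL j l - ymulL j l * PhiDot kappa i m :
      Module.End ℂ (Fock n N pos))
      = theta pos (-m) •
          ((ydotSum (i - 1) (cnum kappa m) * ymulL j l
            - ymulL j l * ydotSum (i - 1) (cnum kappa m))
          - (ydotSum i (cnum kappa m) * ymulL j l - ymulL j l * ydotSum i (cnum kappa m)))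
        + theta pos m •
          ((ydotSum (i - 1) (cnum kappa m) * ymulL j l
            - ymulL j l * ydotSum (i - 1) (cnum kappa m))
          - (2 : ℂ) • (ydotSum i (cnum kappa m) * ymulL j l
            - ymulL j l * ydotSum i (cnum kappa m))
          + (ydotSum (i + 1) (cnum kappa m) * ymulL j l
            - ymulL j l * ydotSum (i + 1) (cnum kappa m))) := by
    refine LinearMap.ext fun u => ?_
    simp only [PhiDot, LinearMap.sub_apply, Module.End.mul_apply, LinearMap.add_apply,
      LinearMap.smul_apply, map_add, map_sub, map_smul]
    module
  rw [e, ydotSum_ymulL_commutator, ydotSum_ymulL_commutator, ydotSum_ymulL_commutator]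
  have h1 : i - 1 = j ↔ i = j + 1 := by omega
  by_cases hl : pos (-l)
  · refine LinearMap.ext fun u => ?_
    simp only [h1, hj, hjn, hl, and_true, if_true, LinearMap.sub_apply, LinearMap.add_apply,
      LinearMap.smul_apply, Module.End.one_apply, cartan]
    split_ifs <;> first | omega | module
  · simp [hl]

lemma PhiL_commutator {kappa : MM N → Fin (N + 1) → ℂ} (lam : ℕ → ℂ)
    (htri : ∀ a : MM N, pos a ∨ a = 0 ∨ pos (-a))
    (hzero : ¬ pos (0 : MM N))
    (hdisj : ∀ a : MM N, pos a → ¬ pos (-a))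
    (hE1 : ∀ m : MM N, ∑ p : Fin (N + 1), (m p : ℂ) * kappa m p = 0)
    (hE2 : ∀ m k : MM N, pos m → pos k →
      ∑ p : Fin (N + 1), (m p : ℂ) * kappa (-m - k) p = 0)
    {i j : ℕ} (hi : 1 ≤ i) (hin : i ≤ n) (hj : 1 ≤ j) (hjn : j ≤ n) (m l : MM N) :
    (PhiL kappa lam i m * PhiL kappa lam j l - PhiL kappa lam j l * PhiL kappa lam i m :
      Module.End ℂ (Fock n N pos)) = (-cartan i j * cnum kappa m (-l)) • 1 := by
  classical
  have hd : ∀ a b f g, (ydotSum a f * ydotSum b g : Module.End ℂ (Fock n N pos))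
      = ydotSum b g * ydotSum a f := fun a b f g =>
    (commute_ydotSum (fun s => (commute_ydotSum (fun t => ydotL_commute _ _ _ _) _).symm) _).eq
  have hD : (PhiDot kappa i m * PhiDot kappa j l : Module.End ℂ (Fock n N pos))
      = PhiDot kappa j l * PhiDot kappa i m := by
    have h : ∀ a b f g, Commute (ydotSum a f : Module.End ℂ (Fock n N pos)) (ydotSum b g) := hd
    have h2 : ∀ a f, Commute (ydotSum a f : Module.End ℂ (Fock n N pos)) (PhiDot kappa j l) :=
      fun a f => (((h _ _ _ _).sub_right (h _ _ _ _)).smul_right _).add_right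
        ((((h _ _ _ _).sub_right ((h _ _ _ _).smul_right _)).add_right
          (h _ _ _ _)).smul_right _)
    exact (((((h2 _ _).sub_left (h2 _ _)).smul_left _).add_left
        ((((h2 _ _).sub_left ((h2 _ _).smul_left _)).add_left
          (h2 _ _)).smul_left _))).eq
  have hy : (ymulL i m * ymulL j l : Module.End ℂ (Fock n N pos)) = ymulL j l * ymulL i m :=
    (ymulL_commute i j m l).eq
  have e : (PhiL kappa lam i m * PhiL kappa lam j l - PhiL kappa lam j l * PhiL kappa lam i m :
      Module.End ℂ (Fock n N pos))
      = (PhiDot kappa i m * ymulL j l - ymulL j l * PhiDot kappa i m)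
        - (PhiDot kappa j l * ymulL i m - ymulL i m * PhiDot kappa j l) := by
    refine LinearMap.ext fun u => ?_
    have hDu : PhiDot kappa i m (PhiDot kappa j l u) = PhiDot kappa j l (PhiDot kappa i m u) :=
      LinearMap.congr_fun hD u
    have hyu : ymulL i m (ymulL j l u) = ymulL j l (ymulL i m u) := LinearMap.congr_fun hy u
    simp only [PhiL, LinearMap.sub_apply, Module.End.mul_apply, LinearMap.add_apply,
      LinearMap.smul_apply, Module.End.one_apply, map_add, map_sub, map_smul, hDu, hyu]
    module
  have anti : cnum kappa l (-m) = -cnum kappa m (-l) := by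
    have := hE1 (-m - l)
    simp only [cnum, ← Finset.sum_neg_distrib]
    rw [← sub_eq_zero, ← Finset.sum_sub_distrib, ← neg_eq_zero, ← Finset.sum_neg_distrib, ← this]
    refine Finset.sum_congr rfl fun p _ => ?_
    rw [show -l + -m = -m - l by abel, show -m + -l = -m - l by abel]
    simp only [Pi.sub_apply, Pi.neg_apply, Int.cast_sub, Int.cast_neg]
    ring
  have symm_ij : cartan j i = cartan i j := by
    simp only [cartan, eq_comm]
    ring
  rw [e, PhiDot_ymulL_commutator kappa hi hj hjn, PhiDot_ymulL_commutator kappa hj hi hin, anti,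
    symm_ij]
  refine LinearMap.ext fun u => ?_
  simp only [LinearMap.sub_apply, LinearMap.smul_apply, Module.End.one_apply]
  rw [← sub_smul]
  congr 1
  rcases htri m with hm | rfl | hm
  · have hm' := hdisj _ hm
    rcases htri l with hl | rfl | hl
    · have hl' := hdisj _ hl
      have : cnum kappa m (-l) = 0 := by
        simpa only [cnum, sub_eq_add_neg] using hE2 m l hm hl
      simp [hm', hl', this]
    · have : cnum kappa m 0 = 0 := by
        have := hE1 (-m)
        simp only [cnum, add_zero]
        rw [← neg_eq_zero, ← Finset.sum_neg_distrib, ← this]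
        refine Finset.sum_congr rfl fun p _ => ?_
        simp
      simp [hzero, this]
    · simp [hm, hm', hl, theta]
  · simp [cnum]
  · have hm' : ¬ pos m := fun h => hdisj _ h hm
    rcases htri l with hl | rfl | hl
    · have hl' := hdisj _ hl
      simp [hm, hl, hl', theta]
    · have := hE1 (-m)
      have h0 : cnum kappa m 0 = 0 := by
        simp only [cnum, add_zero]
        rw [← neg_eq_zero, ← Finset.sum_neg_distrib, ← this]
        refine Finset.sum_congr rfl fun p _ => ?_
        simp
      simp [h0]
    · have hl' : ¬ pos l := fun h => hdisj _ h hl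
      simp only [theta, hm, hl, hm', hl', if_true, if_false, cartan]
      split_ifs <;> first | omega | ring

end Bosons

section Operators

variable {n N : ℕ} {pos : MM N → Prop}

lemma modeMul_family_degree {V : Type*} [AddCommGroup V] [Module ℂ V]
    (Z : MM N → Module.End ℂ V) (p : Fin (N + 1)) (Θ : Module.End ℂ (Loop N V)) (m : MM N) :
    modeMul (fun q => (q p : ℂ) • Z q) Θ m
      = (m p : ℂ) • modeMul Z Θ m + modeMul Z (euler p * Θ) m := by
  have h : contract (fun q => (q p : ℂ) • Z q) m
      = (m p : ℂ) • contract Z m + contract Z m ∘ₗ euler p := by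
    refine Finsupp.lhom_ext fun l u => ?_
    simp only [contract_single, LinearMap.add_apply, LinearMap.smul_apply, LinearMap.comp_apply,
      euler_single, map_smul, Pi.sub_apply, Int.cast_sub]
    module
  rw [modeMul, h]
  rfl

lemma modeMul_euler_hat (Z : MM N → Module.End ℂ (Fock n N pos)) (p : Fin (N + 1))
    (P : Coord n) (m : MM N) :
    modeMul Z (euler p * hat P) m = modeMul Z (eulerD p P) m := by
  have h : modeMul Z (hat P * euler p) m = 0 := by
    refine LinearMap.ext fun u => ?_
    simp [modeMul]
  rw [eulerD, modeMul_sub, h, sub_zero]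

/-- Bracket of modes of two families whose bracket is central. -/
lemma modeL_commutator {kappa : MM N → Fin (N + 1) → ℂ} (c : ℂ)
    {X Y : MM N → Module.End ℂ (Fock n N pos)}
    (hX : ∀ l i j m, Commute (X l) (starL i j m)) (hY : ∀ l i j m, Commute (Y l) (starL i j m))
    (hXY : ∀ m l, X m * Y l - Y l * X m = (c * cnum kappa m (-l)) • 1)
    (m l : MM N) (g h : Coord n) :
    modeL X m g * modeL Y l h - modeL Y l h * modeL X m g
      = c • (formL kappa (m + l) h g + scalL kappa m (m + l) (g * h)) := by
  have hA : ∀ i j q, Commute (modeL X m g) (starL i j q) := fun i j q =>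
    (commute_modeMul (fun l => (hX l i j q).symm)
      (lift_comm_hat (fun _ _ _ => starL_commute _ _ _ _ _ _) g) m).symm
  have hAY : ∀ k, modeL X m g * Y k - Y k * modeL X m g
      = ∑ p : Fin (N + 1), c • modeMul (kmode kappa p)
          (eulerD p g + (m p : ℂ) • hat g) (m + k) := by
    intro k
    have h0 : (lift (Y k) * hat g - hat g * lift (Y k) : Module.End ℂ (Loop N (Fock n N pos)))
        = 0 := by rw [(lift_comm_hat (hY k) g).eq, sub_self]
    have h1 : (fun q => Y k * X q - X q * Y k)
        = fun q => ∑ p : Fin (N + 1), (-c) • ((q p : ℂ) • kmode kappa p (k + q)) := by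
      funext q
      rw [← neg_sub, hXY]
      refine LinearMap.ext fun u => ?_
      simp only [cnum, kmode, LinearMap.neg_apply, LinearMap.smul_apply, Module.End.one_apply,
        smul_smul, ← Finset.sum_smul, ← neg_smul, Finset.mul_sum,
        ← Finset.sum_neg_distrib]
      refine congrArg (· • u) (Finset.sum_congr rfl fun p _ => ?_)
      rw [show -q + -k = -(k + q) by abel]
      ring
    rw [← neg_sub, modeL_apply, commutator_modeMul, h0, modeMul_zero, add_zero, h1,
      modeMul_family_sum, ← Finset.sum_neg_distrib]
    refine Finset.sum_congr rfl fun p _ => ?_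
    rw [modeMul_family_smul, modeMul_family_degree (fun q => kmode kappa p (k + q)),
      modeMul_translate, modeMul_translate, modeMul_euler_hat, modeMul_add, modeMul_smul,
      add_comm k m, add_comm]
    refine LinearMap.ext fun u => ?_
    simp only [LinearMap.neg_apply, LinearMap.smul_apply]
    module
  have h2 : (fun k => modeL X m g * Y k - Y k * modeL X m g)
      = fun k => ∑ p : Fin (N + 1), c • modeMul (kmode kappa p)
          (eulerD p g + (m p : ℂ) • hat g) (m + k) := funext hAY
  rw [modeL_apply Y, commutator_modeMul, h2, (lift_comm_hat hA h).eq, sub_self, modeMul_zero,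
    add_zero, modeMul_family_sum, formL_apply, scalL_apply, ← Finset.sum_add_distrib,
    Finset.smul_sum]
  refine Finset.sum_congr rfl fun p _ => ?_
  have h3 : ∀ k, Commute (eulerD p g + (m p : ℂ) • hat g :
      Module.End ℂ (Loop N (Fock n N pos))) (shift k) := fun k =>
    (eulerD_comm_shift p g k).add_left ((hat_comm_shift g k).smul_left _)
  rw [modeMul_family_smul, modeMul_translate (modeMul (kmode kappa p) _), modeMul_modeMul _ h3,
    add_mul, smul_mul_assoc, ← map_mul, modeMul_add, modeMul_smul]

lemma modeL_commute_formL {X : MM N → Module.End ℂ (Fock n N pos)}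
    (hX : ∀ l i j m, Commute (X l) (starL i j m)) (kappa : MM N → Fin (N + 1) → ℂ)
    (m l : MM N) (g P Q : Coord n) : Commute (modeL X m g) (formL kappa l P Q) :=
  commute_formL (fun i j q => (commute_modeMul (fun l => (hX l i j q).symm)
      (lift_comm_hat (fun _ _ _ => starL_commute _ _ _ _ _ _) g) m).symm) _ _ _ _

/-- The operator attached to a vector field `v`, functions `g r` and an exact form `dy`. -/
def opE (kappa : MM N → Fin (N + 1) → ℂ) (lam : ℕ → ℂ)
    (v : Derivation ℂ (Coord n) (Coord n)) (g : ℕ → Coord n) (y : Coord n) (m : MM N) :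
    Module.End ℂ (Fock n N pos) :=
  vecL m v + ∑ r ∈ Finset.Icc 1 n, modeL (PhiL kappa lam r) m (g r) + formL kappa m 1 y

/-- The operator attached to a vector field `v`, functions `h r` and a form `Σ p_r dq_r`. -/
def opF (kappa : MM N → Fin (N + 1) → ℂ) (lam : ℕ → ℂ)
    (v : Derivation ℂ (Coord n) (Coord n)) (h p q : ℕ → Coord n) (m : MM N) :
    Module.End ℂ (Fock n N pos) :=
  vecL m v + ∑ r ∈ Finset.Icc 1 n, modeL (PhiL kappa lam r) m (h r)
    + ∑ r ∈ Finset.Icc 1 n, formL kappa m (p r) (q r)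

lemma opE_opF_commutator {kappa : MM N → Fin (N + 1) → ℂ} (lam : ℕ → ℂ)
    (htri : ∀ a : MM N, pos a ∨ a = 0 ∨ pos (-a))
    (hzero : ¬ pos (0 : MM N))
    (hdisj : ∀ a : MM N, pos a → ¬ pos (-a))
    (hE1 : ∀ m : MM N, ∑ p : Fin (N + 1), (m p : ℂ) * kappa m p = 0)
    (hE2 : ∀ m k : MM N, pos m → pos k →
      ∑ p : Fin (N + 1), (m p : ℂ) * kappa (-m - k) p = 0)
    (v w : Derivation ℂ (Coord n) (Coord n)) (g : ℕ → Coord n) (y : Coord n)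
    (h p q : ℕ → Coord n) (m l : MM N) :
    (opE kappa lam v g y m * opF kappa lam w h p q l
        - opF kappa lam w h p q l * opE kappa lam v g y m : Module.End ℂ (Fock n N pos))
      = vecL (m + l) ⁅v, w⁆
        + ∑ r ∈ Finset.Icc 1 n, modeL (PhiL kappa lam r) (m + l) (v (h r) - w (g r))
        + ∑ r ∈ Finset.Icc 1 n, (formL kappa (m + l) (v (p r)) (q r)
            + formL kappa (m + l) (p r) (v (q r)))
        - ∑ i ∈ Finset.Icc 1 n, ∑ j ∈ Finset.Icc 1 n,
            cartan i j • formL kappa (m + l) (h j) (g i)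
        + scalL kappa m (m + l) (∑ r ∈ Finset.Icc 1 n, p r * v (q r) + w y
            - ∑ i ∈ Finset.Icc 1 n, ∑ j ∈ Finset.Icc 1 n, cartan i j • (g i * h j)) := by
  have hst : ∀ r l i j k, Commute (PhiL kappa lam r l : Module.End ℂ (Fock n N pos))
      (starL i j k) := fun r l i j k => (starL_commute_PhiL kappa lam r l i j k).symm
  have e1 : (vecL m v * vecL l w - vecL l w * vecL m v : Module.End ℂ (Fock n N pos))
      = vecL (m + l) ⁅v, w⁆ := vecOp_commutator v w m l
  have e2 : (vecL m v * (∑ r ∈ Finset.Icc 1 n, modeL (PhiL kappa lam r) l (h r))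
      - (∑ r ∈ Finset.Icc 1 n, modeL (PhiL kappa lam r) l (h r)) * vecL m v :
        Module.End ℂ (Fock n N pos))
      = ∑ r ∈ Finset.Icc 1 n, modeL (PhiL kappa lam r) (m + l) (v (h r)) := by
    rw [Finset.mul_sum, Finset.sum_mul, ← Finset.sum_sub_distrib]
    exact Finset.sum_congr rfl fun r _ =>
      vecOp_commutator_modeL v m (fun k => vecOp_commute_PhiL v m kappa lam r k) (h r) l
  have e3 : (vecL m v * (∑ r ∈ Finset.Icc 1 n, formL kappa l (p r) (q r))
      - (∑ r ∈ Finset.Icc 1 n, formL kappa l (p r) (q r)) * vecL m v :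
        Module.End ℂ (Fock n N pos))
      = ∑ r ∈ Finset.Icc 1 n, (formL kappa (m + l) (v (p r)) (q r)
            + formL kappa (m + l) (p r) (v (q r)))
        + ∑ r ∈ Finset.Icc 1 n, scalL kappa m (m + l) (p r * v (q r)) := by
    rw [Finset.mul_sum, Finset.sum_mul, ← Finset.sum_sub_distrib, ← Finset.sum_add_distrib]
    exact Finset.sum_congr rfl fun r _ => vecOp_commutator_formL kappa v m l (p r) (q r)
  have e4 : ((∑ r ∈ Finset.Icc 1 n, modeL (PhiL kappa lam r) m (g r)) * vecL l w
      - vecL l w * (∑ r ∈ Finset.Icc 1 n, modeL (PhiL kappa lam r) m (g r)) :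
        Module.End ℂ (Fock n N pos))
      = -∑ r ∈ Finset.Icc 1 n, modeL (PhiL kappa lam r) (m + l) (w (g r)) := by
    rw [Finset.mul_sum, Finset.sum_mul, ← Finset.sum_sub_distrib, ← Finset.sum_neg_distrib]
    refine Finset.sum_congr rfl fun r _ => ?_
    rw [← neg_sub, vecL_apply,
      vecOp_commutator_modeL w l (fun k => vecOp_commute_PhiL w l kappa lam r k) (g r) m,
      add_comm l m]
  have e5 : ((∑ r ∈ Finset.Icc 1 n, modeL (PhiL kappa lam r) m (g r))
        * (∑ r ∈ Finset.Icc 1 n, modeL (PhiL kappa lam r) l (h r))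
      - (∑ r ∈ Finset.Icc 1 n, modeL (PhiL kappa lam r) l (h r))
        * (∑ r ∈ Finset.Icc 1 n, modeL (PhiL kappa lam r) m (g r)) :
        Module.End ℂ (Fock n N pos))
      = -(∑ i ∈ Finset.Icc 1 n, ∑ j ∈ Finset.Icc 1 n,
            cartan i j • formL kappa (m + l) (h j) (g i))
        - ∑ i ∈ Finset.Icc 1 n, ∑ j ∈ Finset.Icc 1 n,
            cartan i j • scalL kappa m (m + l) (g i * h j) := by
    rw [Finset.sum_mul_sum, Finset.sum_mul_sum, Finset.sum_comm (s := Finset.Icc 1 n)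
      (f := fun i j => modeL (PhiL kappa lam i) l (h i) * modeL (PhiL kappa lam j) m (g j)),
      ← Finset.sum_sub_distrib, ← Finset.sum_neg_distrib, ← Finset.sum_sub_distrib]
    refine Finset.sum_congr rfl fun i hi => ?_
    rw [← Finset.sum_sub_distrib, ← Finset.sum_neg_distrib, ← Finset.sum_sub_distrib]
    refine Finset.sum_congr rfl fun j hj => ?_
    rw [Finset.mem_Icc] at hi hj
    rw [modeL_commutator (-cartan i j) (hst i) (hst j) (PhiL_commutator lam htri hzero hdisj hE1
      hE2 hi.1 hi.2 hj.1 hj.2)]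
    refine LinearMap.ext fun u => ?_
    simp only [LinearMap.sub_apply, LinearMap.neg_apply, LinearMap.add_apply,
      LinearMap.smul_apply]
    module
  have e6 : ((∑ r ∈ Finset.Icc 1 n, modeL (PhiL kappa lam r) m (g r))
        * (∑ r ∈ Finset.Icc 1 n, formL kappa l (p r) (q r)) :
        Module.End ℂ (Fock n N pos)) = (∑ r ∈ Finset.Icc 1 n, formL kappa l (p r) (q r))
          * (∑ r ∈ Finset.Icc 1 n, modeL (PhiL kappa lam r) m (g r)) :=
    (Commute.sum_left _ _ _ fun i _ => Commute.sum_right _ _ _ fun j _ =>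
      modeL_commute_formL (hst i) _ _ _ _ _ _).eq
  have e7 : (formL kappa m 1 y * vecL l w - vecL l w * formL kappa m 1 y :
        Module.End ℂ (Fock n N pos)) = scalL kappa m (m + l) (w y) :=
    formL_one_left_commutator_vecOp hE1 w m l y
  have e8 : (formL kappa m 1 y * (∑ r ∈ Finset.Icc 1 n, modeL (PhiL kappa lam r) l (h r)) :
        Module.End ℂ (Fock n N pos))
      = (∑ r ∈ Finset.Icc 1 n, modeL (PhiL kappa lam r) l (h r)) * formL kappa m 1 y :=
    (Commute.sum_right _ _ _ fun j _ => (modeL_commute_formL (hst j) _ _ _ _ _ _).symm).eq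
  have e9 : (formL kappa m 1 y * (∑ r ∈ Finset.Icc 1 n, formL kappa l (p r) (q r)) :
        Module.End ℂ (Fock n N pos))
      = (∑ r ∈ Finset.Icc 1 n, formL kappa l (p r) (q r)) * formL kappa m 1 y :=
    (Commute.sum_right _ _ _ fun j _ => formL_commute_formL _ _ _ _ _ _ _).eq
  have expand : ∀ {R : Type} [Ring R] (a b c a' b' c' : R), b * c' = c' * b → c * b' = b' * c →
      c * c' = c' * c → (a + b + c) * (a' + b' + c') - (a' + b' + c') * (a + b + c)
        = (a * a' - a' * a) + (a * b' - b' * a) + (a * c' - c' * a) + (b * a' - a' * b)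
          + (b * b' - b' * b) + (c * a' - a' * c) := by
    intro R _ a b c a' b' c' h1 h2 h3
    simp only [add_mul, mul_add, h1, h2, h3]
    abel
  rw [opE, opF, expand _ _ _ _ _ _ e6 e8 e9, e1, e2, e3, e4, e5, e7]
  simp only [map_sub, map_add, map_sum, map_smul, Finset.sum_sub_distrib]
  abel

end Operators

section Translation

variable {n N : ℕ} {pos : MM N → Prop}

lemma contract_eq_finsum {V : Type*} [AddCommGroup V] [Module ℂ V]
    (X : MM N → Module.End ℂ V) (m : MM N) (f : Loop N V) :
    contract X m f = ∑ᶠ k : MM N, X k (f (m - k)) := by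
  have h : contract X m f = ∑ᶠ l : MM N, X (m - l) (f l) := by
    rw [finsum_eq_sum_of_support_subset (s := f.support)]
    · rw [contract, Finsupp.lsum_apply, Finsupp.sum]
    · intro l hl
      rw [Finset.mem_coe, Finsupp.mem_support_iff]
      intro h0
      rw [Function.mem_support, h0, map_zero] at hl
      exact hl rfl
  rw [h, ← finsum_comp_equiv (Equiv.subLeft m)]
  refine finsum_congr fun k => ?_
  simp

/-- The delta family, supported at `0`. -/
def delta (k : MM N) : Module.End ℂ (Fock n N pos) := (if k = 0 then (1 : ℂ) else 0) • 1

lemma contract_delta_family (m : MM N) (f : Loop N (Fock n N pos)) :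
    contract delta m f = f m := by
  have h := contract_delta 1 m 0 f
  simp only [add_zero, one_smul] at h
  exact h

lemma modeL_delta_apply (P : Coord n) (m : MM N) (w : Fock n N pos) :
    modeL delta m P w = hat P (const w) m :=
  contract_delta_family m _

lemma modeL_modeL (X : MM N → Module.End ℂ (Fock n N pos)) (P Q : Coord n) (m : MM N) :
    modeL (fun k => modeL X k P) m Q = modeL X m (P * Q) := by
  rw [modeL_apply X, map_mul, ← modeMul_modeMul X (hat_comm_shift P)]
  rfl

lemma modeL_delta_zc (i j : ℕ) (m : MM N) :
    (modeL delta m (zc n i j) : Module.End ℂ (Fock n N pos)) = starL i j m := by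
  refine LinearMap.ext fun w => ?_
  rw [modeL_delta_apply, hat_zc, starField, const_apply, field_single, shift_apply, sub_zero,
    series_apply]

lemma fmul_modeL_delta (X : MM N → Module.End ℂ (Fock n N pos)) (P : Coord n) (m : MM N) :
    fmul n N pos (fun k => ⇑(X k)) (fun k => ⇑(modeL delta k P)) m = ⇑(modeL X m P) := by
  funext w
  rw [fmul, modeL_apply, modeMul, LinearMap.comp_apply, LinearMap.comp_apply, contract_eq_finsum]
  refine finsum_congr fun k => ?_
  rw [modeL_delta_apply]

lemma fmul_astar {Z : MM N → Module.End ℂ (Fock n N pos)} {i j : ℕ}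
    (hZ : ∀ k l, Commute (Z k) (starL i j l)) (m : MM N) :
    fmul n N pos (astar n N pos i j) (fun k => ⇑(Z k)) m = ⇑(modeL Z m (zc n i j)) := by
  funext w
  rw [fmul, modeL_apply, modeMul, LinearMap.comp_apply, LinearMap.comp_apply, contract_eq_finsum]
  refine Eq.trans ?_ (finsum_comp_equiv (Equiv.subLeft m)
    (f := fun k => Z k (hat (zc n i j) (const w) (m - k))))
  refine finsum_congr fun k => ?_
  have h1 : hat (zc n i j) (const w) k = starL i j k w := by
    rw [hat_zc, starField, const_apply, field_single, shift_apply, sub_zero, series_apply]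
  have h2 : m - (m - k) = k := sub_sub_cancel m k
  change astar n N pos i j k (Z (m - k) w) = Z (m - k) (hat (zc n i j) (const w) (m - (m - k)))
  rw [h2, h1, ← coe_starL]
  exact (LinearMap.congr_fun (hZ (m - k) k).eq w).symm

end Translation

section Generators

variable {n N : ℕ} {pos : MM N → Prop}

lemma fmul_aop_astar (i j k l : ℕ) (m : MM N) :
    fmul n N pos (aop n N pos i j) (astar n N pos k l) m = ⇑(modeL (aL i j) m (zc n k l)) := by
  rw [← fmul_modeL_delta]
  simp only [modeL_delta_zc, coe_aL, coe_starL]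

lemma fmul_astar_astar (i j k l : ℕ) (m : MM N) :
    fmul n N pos (astar n N pos i j) (astar n N pos k l) m
      = ⇑(modeL delta m (zc n k l * zc n i j)) := by
  rw [← modeL_modeL, ← fmul_astar (fun _ _ => by
    rw [modeL_delta_zc]; exact starL_commute _ _ _ _ _ _)]
  simp only [modeL_delta_zc, coe_starL]

lemma fmul_aop_fmul_astar_astar (i j k l p q : ℕ) (m : MM N) :
    fmul n N pos (aop n N pos i j) (fmul n N pos (astar n N pos k l) (astar n N pos p q)) m
      = ⇑(modeL (aL i j) m (zc n p q * zc n k l)) := by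
  rw [← fmul_modeL_delta]
  simp only [← fmul_astar_astar, coe_aL]

lemma fmul_fmul_aop_astar_astar (i j k l p q : ℕ) (m : MM N) :
    fmul n N pos (fmul n N pos (aop n N pos i j) (astar n N pos k l)) (astar n N pos p q) m
      = ⇑(modeL (aL i j) m (zc n k l * zc n p q)) := by
  rw [← modeL_modeL, ← fmul_modeL_delta]
  simp only [← fmul_aop_astar, modeL_delta_zc, coe_starL]

lemma fmul_astar_Phi (kappa : MM N → Fin (N + 1) → ℂ) (lam : ℕ → ℂ) (i j r : ℕ) (m : MM N) :
    fmul n N pos (astar n N pos i j) (Phi n N pos kappa lam r) m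
      = ⇑(modeL (PhiL kappa lam r) m (zc n i j)) := by
  rw [← fmul_astar (fun k l => (starL_commute_PhiL kappa lam r k i j l).symm)]
  simp only [coe_PhiL]

lemma kD_eq_formL (kappa : MM N → Fin (N + 1) → ℂ) (i j : ℕ) (v : MM N) :
    kD n N pos kappa i j v = ⇑(formL kappa v 1 (zc n i j)) := by
  funext w
  set f : Loop N (Fock n N pos) := series (starL i j) (starL_finite i j) w with hf
  have h1 : hat (zc n i j) (const w) = f := by
    rw [hat_zc, starField, const_apply, field_single, shift_zero]
    rfl
  have h2 : ∀ f : Loop N (Fock n N pos), ∑ p, contract (kmode kappa p) v (euler p f)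
      = f.sum fun q u => (∑ p : Fin (N + 1), kappa (q - v) p * (-(q p : ℂ))) • u := by
    intro f
    induction f using Finsupp.induction_linear with
    | zero => simp
    | add f g hf hg =>
      rw [Finsupp.sum_add_index' (fun _ => smul_zero _) (fun _ => smul_add _), ← hf, ← hg]
      simp only [map_add, Finset.sum_add_distrib]
    | single q u =>
      rw [Finsupp.sum_single_index (by rw [smul_zero]), Finset.sum_smul]
      refine Finset.sum_congr rfl fun p _ => ?_
      rw [euler_single, map_smul, contract_single, kmode, LinearMap.smul_apply,
        Module.End.one_apply, smul_smul, neg_sub, mul_comm]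
  have h3 : formL kappa v 1 (zc n i j) w = ∑ p, contract (kmode kappa p) v (euler p f) := by
    rw [formL_apply, LinearMap.sum_apply]
    refine Finset.sum_congr rfl fun p _ => ?_
    rw [map_one, mul_one, ← modeMul_euler_hat, ← h1]
    rfl
  rw [h3, h2, kD, finsum_eq_sum_of_support_subset (s := f.support)]
  · rw [Finsupp.sum]
    refine Finset.sum_congr rfl fun q _ => ?_
    rw [hf, series_apply, coe_starL]
  · intro q hq
    rw [Finset.mem_coe, Finsupp.mem_support_iff]
    intro h0
    rw [hf, series_apply, coe_starL] at h0
    rw [Function.mem_support, h0, smul_zero] at hq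
    exact hq rfl

/-- The vector field of `ρ(E_s)`, `1 ≤ s ≤ n`. -/
def vE (n s : ℕ) : Derivation ℂ (Coord n) (Coord n) :=
  (zc n s (s + 1) * zc n s (s + 1)) • del n s (s + 1)
    - ∑ j ∈ Finset.Icc (s + 2) (n + 1), zc n s j • del n (s + 1) j
    + ∑ j ∈ Finset.Ico 1 s, zc n j (s + 1) • del n j s
    + ∑ j ∈ Finset.Icc (s + 2) (n + 1), ((zc n s j * zc n s (s + 1)) • del n s j
        - (zc n (s + 1) j * zc n s (s + 1)) • del n (s + 1) j)

/-- The vector field of `ρ(F_r)`, `1 ≤ r ≤ n`. -/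
def vF (n r : ℕ) : Derivation ℂ (Coord n) (Coord n) :=
  del n r (r + 1) - ∑ j ∈ Finset.Ico 1 r, zc n j r • del n j (r + 1)

/-- The vector field of `ρ(H_r)`, `1 ≤ r ≤ n`. -/
def vH (n r : ℕ) : Derivation ℂ (Coord n) (Coord n) :=
  (2 : ℂ) • (zc n r (r + 1) • del n r (r + 1))
    + ∑ i ∈ Finset.Ico 1 r, (zc n i (r + 1) • del n i (r + 1) - zc n i r • del n i r)
    + ∑ j ∈ Finset.Icc (r + 2) (n + 1),
        (zc n r j • del n r j - zc n (r + 1) j • del n (r + 1) j)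

lemma rhoEn_eq (kappa : MM N → Fin (N + 1) → ℂ) (lam : ℕ → ℂ) {s : ℕ} (hs : 1 ≤ s) (hsn : s ≤ n)
    (m : MM N) :
    rhoEn n N pos kappa lam s m = ⇑(opE kappa lam (vE n s)
      (fun r => if r = s then zc n s (s + 1) else 0) (zc n s (s + 1)) m) := by
  have h : ∑ r ∈ Finset.Icc 1 n, modeL (PhiL kappa lam r) m
      (if r = s then zc n s (s + 1) else 0)
      = (modeL (PhiL kappa lam s) m (zc n s (s + 1)) : Module.End ℂ (Fock n N pos)) := by
    rw [Finset.sum_eq_single_of_mem s (Finset.mem_Icc.2 ⟨hs, hsn⟩), if_pos rfl]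
    intro r _ hr
    rw [if_neg hr, map_zero]
  funext w
  simp only [rhoEn, opE, h, vE, fmul_aop_astar, fmul_aop_fmul_astar_astar,
    fmul_fmul_aop_astar_astar, fmul_astar_Phi, kD_eq_formL, map_add, map_sub, map_sum,
    vecL_smul_del, Pi.add_apply, Pi.sub_apply, Finset.sum_apply, LinearMap.add_apply,
    LinearMap.sub_apply, LinearMap.sum_apply]

lemma rhoF_eq (r : ℕ) (kappa : MM N → Fin (N + 1) → ℂ) (lam : ℕ → ℂ) (m : MM N) :
    rhoF n N pos r m = ⇑(opF kappa lam (vF n r) 0 0 0 m) := by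
  funext w
  simp only [rhoF, opF, vF, fmul_aop_astar, map_sub, map_sum, vecL_smul_del, vecL_del,
    Pi.sub_apply, Finset.sum_apply, LinearMap.sub_apply,
    LinearMap.sum_apply, coe_aL, Pi.zero_apply, map_zero,
    Finset.sum_const_zero, add_zero]

lemma rhoHn_eq (kappa : MM N → Fin (N + 1) → ℂ) (lam : ℕ → ℂ) (r : ℕ) (m : MM N) :
    rhoHn n N pos kappa lam r m
      = ⇑(vecL m (vH n r) + PhiL kappa lam r m : Module.End ℂ (Fock n N pos)) := by
  funext w
  simp only [rhoHn, vH, fmul_aop_astar, map_add, map_sub, map_sum, LinearMap.map_smul, vecL_smul_del,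
    Pi.add_apply, Pi.smul_apply, Pi.sub_apply, Finset.sum_apply, LinearMap.add_apply,
    LinearMap.sub_apply, LinearMap.sum_apply, LinearMap.smul_apply, coe_PhiL]

lemma rhoE_zero_eq (kappa : MM N → Fin (N + 1) → ℂ) (lam : ℕ → ℂ) (m : MM N) :
    rhoE n N pos kappa lam 0 m = ⇑(opE kappa lam (-del n 1 (n + 1)) 0 0 m) := by
  funext w
  simp only [rhoE, opE, if_true, map_neg, vecL_del, Pi.neg_apply,
    LinearMap.neg_apply, coe_aL, Pi.zero_apply, map_zero, Finset.sum_const_zero, add_zero]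

end Generators

section Paths

/-- The path generating function `Σ Π z_{q_l,q_{l+1}}` over sequences from `1` to `j`. -/
def pathSum (n j : ℕ) : Coord n :=
  (if j = 1 then 1 else 0) + ∑ k : Fin j, pathSum n k * zc n k j

/-- The generating function of paths from `1` to `j` with penultimate entry at most `r`. -/
def pathSumLE (n r j : ℕ) : Coord n :=
  ∑ k ∈ Finset.Icc 1 r, pathSum n k * zc n k j

/-- The product of the coordinates attached to a list of pairs. -/
def pathProd (n : ℕ) (ps : List (ℕ × ℕ)) : Coord n := (ps.map fun p => zc n p.1 p.2).prod

lemma zc_eq_zero {n i j : ℕ} (h : ¬(1 ≤ i ∧ i < j ∧ j ≤ n + 1)) : zc n i j = 0 := dif_neg h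

lemma pathSum_eq (n j : ℕ) :
    pathSum n j = (if j = 1 then 1 else 0) + pathSumLE n (j - 1) j := by
  rw [pathSum, pathSumLE, Fin.sum_univ_eq_sum_range fun k => pathSum n k * zc n k j]
  congr 1
  symm
  refine Finset.sum_subset (fun k hk => ?_) fun k _ hk => ?_
  · rw [Finset.mem_Icc] at hk
    rw [Finset.mem_range]
    omega
  · rw [Finset.mem_Icc] at hk
    rw [zc_eq_zero (by omega), mul_zero]

lemma pathSum_one (n : ℕ) : pathSum n 1 = 1 := by
  rw [pathSum_eq, if_pos rfl, pathSumLE, Finset.Icc_eq_empty (by omega), Finset.sum_empty, add_zero]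

lemma ql_insert {s : Finset ℕ} {j : ℕ} (h : ∀ k ∈ s, k < j) :
    ql (insert j s) = ql s ++ [j] := by
  have hj : j ∉ s := fun hj => lt_irrefl _ (h j hj)
  have : (insert j s).sort (· ≤ ·) = s.sort (· ≤ ·) ++ [j] := by
    refine List.Perm.eq_of_pairwise (le := (· ≤ ·)) (fun a b _ _ => le_antisymm)
      (Finset.pairwise_sort _ _) ?_ ?_
    · rw [List.pairwise_append]
      refine ⟨Finset.pairwise_sort _ _, List.pairwise_singleton _ _, fun a ha b hb => ?_⟩
      rw [List.mem_singleton] at hb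
      rw [hb]
      exact (h a ((Finset.mem_sort _).1 ha)).le
    · refine ((Finset.sort_perm_toList _ _).trans (Finset.toList_insert hj)).trans ?_
      exact ((List.Perm.cons j (Finset.sort_perm_toList s _).symm)).trans
        (List.perm_append_singleton j _).symm
  rw [ql, this]
  rfl

lemma qend_insert {s : Finset ℕ} {j : ℕ} (h : ∀ k ∈ s, k < j) : qend (insert j s) = j := by
  rw [qend, ql_insert h, List.getLast?_concat, Option.getD_some]

lemma qpen_insert {s : Finset ℕ} {j : ℕ} (h : ∀ k ∈ s, k < j) :
    qpen (insert j s) = qend s := by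
  rw [qpen, ql_insert h, List.dropLast_concat, qend]

lemma qend_empty : qend ∅ = 1 := by
  simp [qend, ql]

lemma exists_insert_of_nonempty {s : Finset ℕ} (hs : s.Nonempty) :
    ∃ j t, (∀ k ∈ t, k < j) ∧ s = insert j t :=
  ⟨s.max' hs, s.erase (s.max' hs), fun _ hk => s.lt_max'_of_mem_erase_max' hs hk,
    (Finset.insert_erase (s.max'_mem hs)).symm⟩

lemma qend_cases (s : Finset ℕ) :
    (s = ∅ ∧ qend s = 1) ∨ (qend s ∈ s ∧ ∀ k ∈ s.erase (qend s), k < qend s) := by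
  rcases s.eq_empty_or_nonempty with rfl | hs
  · exact Or.inl ⟨rfl, qend_empty⟩
  · obtain ⟨j, t, ht, rfl⟩ := exists_insert_of_nonempty hs
    have hj : j ∉ t := fun hj => lt_irrefl _ (ht j hj)
    rw [qend_insert ht, Finset.erase_insert hj]
    exact Or.inr ⟨Finset.mem_insert_self _ _, ht⟩

lemma le_qend {s : Finset ℕ} {k : ℕ} (hk : k ∈ s) : k ≤ qend s := by
  rcases qend_cases s with ⟨rfl, _⟩ | ⟨_, h⟩
  · simp at hk
  · by_cases e : k = qend s
    · exact e.le
    · exact (h k (Finset.mem_erase.2 ⟨e, hk⟩)).le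

lemma ql_getLast? (s : Finset ℕ) : (ql s).getLast? = some (qend s) := by
  rw [qend, ql, List.getLast?_eq_some_getLast (List.cons_ne_nil _ _), Option.getD_some]

lemma qpairs_concat {l : List ℕ} {a : ℕ} (h : l.getLast? = some a) (j : ℕ) :
    qpairs (l ++ [j]) = qpairs l ++ [(a, j)] := by
  induction l with
  | nil => simp at h
  | cons b l ih =>
    cases l with
    | nil =>
      simp only [List.getLast?_singleton, Option.some.injEq] at h
      simp [qpairs, h]
    | cons c l =>
      rw [List.getLast?_cons_cons] at h
      have := ih h
      simp only [qpairs, List.cons_append, List.tail_cons, List.zip_cons_cons] at this ⊢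
      rw [this]

lemma pathProd_concat (n : ℕ) (s : Finset ℕ) (j : ℕ) :
    pathProd n (qpairs (ql s ++ [j])) = pathProd n (qpairs (ql s)) * zc n (qend s) j := by
  rw [qpairs_concat (ql_getLast? s), pathProd, pathProd, List.map_append, List.prod_append]
  simp

lemma pathProd_insert (n : ℕ) {s : Finset ℕ} {j : ℕ} (h : ∀ k ∈ s, k < j) :
    pathProd n (qpairs (ql (insert j s))) = pathProd n (qpairs (ql s)) * zc n (qend s) j := by
  rw [ql_insert h, pathProd_concat]

lemma qend_mem_Icc {n : ℕ} {s : Finset ℕ} (hs : s ∈ (Finset.Icc 2 (n + 1)).powerset) :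
    1 ≤ qend s ∧ qend s ≤ n + 1 := by
  rcases qend_cases s with ⟨_, h⟩ | ⟨h, _⟩
  · omega
  · have := Finset.mem_Icc.1 (Finset.mem_powerset.1 hs h)
    omega

/-- Splitting off the last step of the paths counted by `pathSumLE`. -/
lemma sum_paths_last (n : ℕ) {r j : ℕ} (hr : r < j) (hj : 2 ≤ j) (hjn : j ≤ n + 1) :
    ∑ s ∈ (Finset.Icc 2 (n + 1)).powerset with (r < j ∧ qend s = j ∧ qpen s ≤ r),
        pathProd n (qpairs (ql s))
      = ∑ s ∈ (Finset.Icc 2 (n + 1)).powerset with qend s ≤ r,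
        pathProd n (qpairs (ql s)) * zc n (qend s) j := by
  have hlt : ∀ t ∈ (Finset.Icc 2 (n + 1)).powerset.filter (fun s => qend s ≤ r),
      ∀ k ∈ t, k < j := fun t ht k hk =>
    (le_qend hk).trans_lt ((Finset.mem_filter.1 ht).2.trans_lt hr)
  symm
  refine Finset.sum_bij' (fun t _ => insert j t) (fun s _ => s.erase j) ?_ ?_ ?_ ?_ ?_
  · intro t ht
    have h := Finset.mem_filter.1 ht
    rw [Finset.mem_filter, qend_insert (hlt t ht), qpen_insert (hlt t ht), Finset.mem_powerset,
      Finset.insert_subset_iff, Finset.mem_Icc]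
    exact ⟨⟨⟨hj, hjn⟩, Finset.mem_powerset.1 h.1⟩, hr, rfl, h.2⟩
  · intro s hs
    obtain ⟨h1, -, h2, h3⟩ := Finset.mem_filter.1 hs
    rcases qend_cases s with ⟨_, h⟩ | ⟨h, h'⟩
    · omega
    · rw [h2] at h h'
      rw [Finset.mem_filter, ← qpen_insert h', Finset.insert_erase h]
      exact ⟨Finset.mem_powerset.2 ((Finset.erase_subset _ _).trans (Finset.mem_powerset.1 h1)),
        h3⟩
  · intro t ht
    exact Finset.erase_insert fun h => lt_irrefl _ (hlt t ht j h)
  · intro s hs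
    obtain ⟨h1, -, h2, h3⟩ := Finset.mem_filter.1 hs
    rcases qend_cases s with ⟨_, h⟩ | ⟨h, h'⟩
    · omega
    · rw [h2] at h
      exact Finset.insert_erase h
  · intro t ht
    exact (pathProd_insert n (hlt t ht)).symm

lemma sum_paths_group (n r j : ℕ) :
    ∑ s ∈ (Finset.Icc 2 (n + 1)).powerset with qend s ≤ r,
        pathProd n (qpairs (ql s)) * zc n (qend s) j
      = ∑ k ∈ Finset.Icc 1 r, (∑ s ∈ (Finset.Icc 2 (n + 1)).powerset with qend s = k,
        pathProd n (qpairs (ql s))) * zc n k j := by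
  rw [← Finset.sum_fiberwise_of_maps_to (t := Finset.Icc 1 r) (g := qend)]
  · refine Finset.sum_congr rfl fun k hk => ?_
    rw [Finset.sum_mul, Finset.filter_filter]
    have hk' := Finset.mem_Icc.1 hk
    refine Finset.sum_congr (Finset.filter_congr fun _ _ => ?_) fun s hs => ?_
    · omega
    · rw [(Finset.mem_filter.1 hs).2]
  · intro s hs
    have h := Finset.mem_filter.1 hs
    exact Finset.mem_Icc.2 ⟨(qend_mem_Icc h.1).1, h.2⟩

lemma qpen_lt_qend {s : Finset ℕ} (h2 : 2 ≤ qend s) : qpen s < qend s := by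
  rcases qend_cases s with ⟨_, h⟩ | ⟨h, h'⟩
  · omega
  · rw [← Finset.insert_erase h, qpen_insert h', qend_insert h']
    rcases qend_cases (s.erase (qend s)) with ⟨_, h3⟩ | ⟨h3, _⟩
    · omega
    · exact h' _ h3

lemma sum_paths_qend (n j : ℕ) (hj : 1 ≤ j) (hjn : j ≤ n + 1) :
    ∑ s ∈ (Finset.Icc 2 (n + 1)).powerset with qend s = j, pathProd n (qpairs (ql s))
      = pathSum n j := by
  induction j using Nat.strong_induction_on with
  | _ j ih =>
    rcases Nat.eq_or_lt_of_le hj with rfl | hj2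
    · rw [pathSum_one, Finset.sum_eq_single_of_mem ∅]
      · simp [ql, qpairs, pathProd]
      · simp [qend_empty]
      · intro s hs hne
        obtain ⟨h1, h2⟩ := Finset.mem_filter.1 hs
        rcases qend_cases s with ⟨h, _⟩ | ⟨h, _⟩
        · exact absurd h hne
        · have := Finset.mem_Icc.1 (Finset.mem_powerset.1 h1 h)
          omega
    · rw [pathSum_eq, if_neg (by omega), zero_add, pathSumLE]
      have h1 := sum_paths_last n (r := j - 1) (j := j) (by omega) hj2 hjn
      rw [sum_paths_group] at h1
      rw [← Finset.sum_congr rfl fun k hk => congrArg (· * zc n k j)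
        (ih k (by have := Finset.mem_Icc.1 hk; omega) (Finset.mem_Icc.1 hk).1
          (by have := Finset.mem_Icc.1 hk; omega)), ← h1]
      refine Finset.sum_congr (Finset.filter_congr fun s _ => ?_) fun _ _ => rfl
      constructor
      · intro h
        have := qpen_lt_qend (s := s) (by omega)
        omega
      · exact fun h => h.2.1

lemma sum_paths_qend_le (n r j : ℕ) (hr : r ≤ n + 1) :
    ∑ s ∈ (Finset.Icc 2 (n + 1)).powerset with qend s ≤ r,
        pathProd n (qpairs (ql s)) * zc n (qend s) j = pathSumLE n r j := by
  rw [sum_paths_group, pathSumLE]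
  refine Finset.sum_congr rfl fun k hk => ?_
  rw [Finset.mem_Icc] at hk
  rw [sum_paths_qend n k hk.1 (by omega)]

end Paths

section Affine

variable {n N : ℕ} {pos : MM N → Prop}

lemma fprod_nil : fprod n N pos [] = fun k => ⇑(delta k : Module.End ℂ (Fock n N pos)) := by
  funext k w
  by_cases h : k = 0 <;> simp [fprod, delta, h]

lemma fprod_singleton (Z : MM N → Module.End ℂ (Fock n N pos)) :
    fprod n N pos [fun k => ⇑(Z k)] = fun k => ⇑(Z k) := by
  funext k
  have h := fmul_modeL_delta Z 1 k
  simp only [modeL_one] at h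
  rw [fprod, fprod_nil, h]

lemma fprod_map_astar {Z : MM N → Module.End ℂ (Fock n N pos)}
    (hZ : ∀ i j k l, Commute (Z k) (starL i j l))
    {L : List (MM N → Fock n N pos → Fock n N pos)} (hL : fprod n N pos L = fun k => ⇑(Z k))
    (ps : List (ℕ × ℕ)) :
    fprod n N pos ((ps.map fun p => astar n N pos p.1 p.2) ++ L)
      = fun k => ⇑(modeL Z k (pathProd n ps)) := by
  induction ps with
  | nil => simp only [List.map_nil, List.nil_append, hL, pathProd, List.prod_nil, modeL_one]
  | cons p ps ih =>
    funext k
    have hc : ∀ q l, Commute (modeL Z q (pathProd n ps)) (starL p.1 p.2 l) := fun q l =>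
      (commute_modeMul (fun k => (hZ p.1 p.2 k l).symm)
        (lift_comm_hat (fun _ _ _ => starL_commute _ _ _ _ _ _) _) q).symm
    rw [List.map_cons, List.cons_append, fprod, ih, fmul_astar hc, modeL_modeL, pathProd,
      pathProd, List.map_cons, List.prod_cons, mul_comm]

lemma fprod_aop_map_astar (r j : ℕ) (ps : List (ℕ × ℕ)) (m : MM N) :
    fprod n N pos (aop n N pos r j ::
        ((ps.map fun p => astar n N pos p.1 p.2) ++ [astar n N pos r (n + 1)])) m
      = ⇑(modeL (aL r j) m (zc n r (n + 1) * pathProd n ps)) := by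
  have h : fprod n N pos [astar n N pos r (n + 1)]
      = fun k => ⇑(modeL delta k (zc n r (n + 1)) : Module.End ℂ (Fock n N pos)) := by
    rw [← fprod_singleton]
    simp only [modeL_delta_zc, coe_starL]
  rw [fprod, fprod_map_astar (fun i j k l => ?_) h]
  · simp only [modeL_modeL]
    rw [← fmul_modeL_delta]
    simp only [coe_aL]
  · rw [modeL_delta_zc]
    exact starL_commute _ _ _ _ _ _

lemma fprod_map_astar_Phi (kappa : MM N → Fin (N + 1) → ℂ) (lam : ℕ → ℂ) (r : ℕ)
    (ps : List (ℕ × ℕ)) (m : MM N) :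
    fprod n N pos ((ps.map fun p => astar n N pos p.1 p.2) ++ [Phi n N pos kappa lam r]) m
      = ⇑(modeL (PhiL kappa lam r) m (pathProd n ps)) := by
  have h : fprod n N pos [Phi n N pos kappa lam r]
      = fun k => ⇑(PhiL kappa lam r k : Module.End ℂ (Fock n N pos)) := by
    rw [← fprod_singleton]
    simp only [coe_PhiL]
  rw [fprod_map_astar (fun i j k l => (starL_commute_PhiL kappa lam r k i j l).symm) h]

lemma modeL_formL (kappa : MM N → Fin (N + 1) → ℂ) (Q P R : Coord n) (m : MM N) :
    modeL (fun k => formL kappa k Q P) m R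
      = (formL kappa m (Q * R) P : Module.End ℂ (Fock n N pos)) := by
  have h : (fun k => formL kappa k Q P : MM N → Module.End ℂ (Fock n N pos))
      = fun k => ∑ p : Fin (N + 1), modeMul (kmode kappa p) (eulerD p P * hat Q) k := rfl
  rw [modeL_apply, h, modeMul_family_sum, formL_apply]
  refine Finset.sum_congr rfl fun p _ => ?_
  rw [modeMul_modeMul _ fun k => (eulerD_comm_shift p P k).mul_left (hat_comm_shift Q k),
    map_mul, mul_assoc]

lemma fprod_map_astar_kD (kappa : MM N → Fin (N + 1) → ℂ) (i j : ℕ)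
    (ps : List (ℕ × ℕ)) (m : MM N) :
    fprod n N pos ((ps.map fun p => astar n N pos p.1 p.2) ++ [kD n N pos kappa i j]) m
      = ⇑(formL kappa m (pathProd n ps) (zc n i j)) := by
  have h : fprod n N pos [kD n N pos kappa i j]
      = fun k => ⇑(formL kappa k 1 (zc n i j) : Module.End ℂ (Fock n N pos)) := by
    rw [← fprod_singleton]
    simp only [← kD_eq_formL]
  rw [fprod_map_astar (fun _ _ _ _ => starL_commute_formL _ _ _ _ _ _ _) h]
  simp only [modeL_formL, one_mul]

lemma sum_ite_coe {ι V : Type*} [AddCommGroup V] [Module ℂ V] (s : Finset ι) (c : ι → Prop)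
    [DecidablePred c] (f : Coord n →ₗ[ℂ] Module.End ℂ V) (W : ι → Coord n) :
    ∑ i ∈ s, (if c i then ⇑(f (W i)) else 0 : V → V) = ⇑(f (∑ i ∈ s with c i, W i)) := by
  funext w
  rw [map_sum, LinearMap.sum_apply, Finset.sum_filter, Finset.sum_apply]
  refine Finset.sum_congr rfl fun i _ => ?_
  split_ifs <;> rfl

/-- The vector field of `ρ(F_0)`. -/
def vF0 (n : ℕ) : Derivation ℂ (Coord n) (Coord n) :=
  -∑ r ∈ Finset.Icc 1 (n + 1), ∑ j ∈ Finset.Icc 1 (n + 1),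
    (zc n r (n + 1) * pathSumLE n r j) • del n r j

lemma rhoF0_vec (r j : ℕ) (hr : 1 ≤ r) (hjn : j ≤ n + 1) (m : MM N) :
    ∑ s ∈ (Finset.Icc 2 (n + 1)).powerset,
        (if r < j ∧ qend s = j ∧ qpen s ≤ r then
          fprod n N pos
            (aop n N pos r j ::
              ((qpairs (ql s)).map fun p => astar n N pos p.1 p.2)
                ++ [astar n N pos r (n + 1)]) m
        else 0)
      = ⇑(vecL m ((zc n r (n + 1) * pathSumLE n r j) • del n r j) :
          Module.End ℂ (Fock n N pos)) := by
  simp only [List.cons_append, fprod_aop_map_astar, vecL_smul_del]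
  rw [sum_ite_coe _ _ (modeL (aL r j) m), ← Finset.mul_sum]
  by_cases h : r < j
  · rw [sum_paths_last n h (by omega) hjn, sum_paths_qend_le n r j (by omega)]
  · have h0 : (aL r j : MM N → Module.End ℂ (Fock n N pos)) = fun _ => 0 := by
      funext k
      rw [aL, dif_neg (by omega)]
    rw [h0]
    simp [modeL_apply, modeMul, contract_zero]

lemma rhoF0_eq (kappa : MM N → Fin (N + 1) → ℂ) (lam : ℕ → ℂ) (m : MM N) :
    rhoF0 n N pos kappa lam m = ⇑(opF kappa lam (vF0 n) (fun r => -pathSumLE n r (n + 1))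
      (fun r => -pathSum n r) (fun r => zc n r (n + 1)) m) := by
  have h1 : ∑ r ∈ Finset.Icc 1 (n + 1), ∑ j ∈ Finset.Icc 1 (n + 1),
      ∑ s ∈ (Finset.Icc 2 (n + 1)).powerset,
        (if r < j ∧ qend s = j ∧ qpen s ≤ r then
          fprod n N pos
            (aop n N pos r j ::
              ((qpairs (ql s)).map fun p => astar n N pos p.1 p.2)
                ++ [astar n N pos r (n + 1)]) m
        else 0) = ∑ r ∈ Finset.Icc 1 (n + 1), ∑ j ∈ Finset.Icc 1 (n + 1),
      ⇑(vecL m ((zc n r (n + 1) * pathSumLE n r j) • del n r j) :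
          Module.End ℂ (Fock n N pos)) :=
    Finset.sum_congr rfl fun r hr => Finset.sum_congr rfl fun j hj =>
      rhoF0_vec r j (Finset.mem_Icc.1 hr).1 (Finset.mem_Icc.1 hj).2 m
  have h2 : ∑ r ∈ Finset.Icc 1 n, ∑ s ∈ (Finset.Icc 2 (n + 1)).powerset,
      (if qend s ≤ r then
        fprod n N pos
          (((qpairs (ql s ++ [n + 1])).map fun p => astar n N pos p.1 p.2)
            ++ [Phi n N pos kappa lam r]) m
      else 0) = ∑ r ∈ Finset.Icc 1 n, ⇑(modeL (PhiL kappa lam r) m (pathSumLE n r (n + 1)) :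
          Module.End ℂ (Fock n N pos)) := by
    refine Finset.sum_congr rfl fun r hr => ?_
    simp only [fprod_map_astar_Phi]
    rw [sum_ite_coe _ _ (modeL (PhiL kappa lam r) m),
      ← sum_paths_qend_le n r (n + 1) (by have := Finset.mem_Icc.1 hr; omega)]
    simp only [pathProd_concat]
  have h3 : ∑ r ∈ Finset.Icc 1 n, ∑ s ∈ (Finset.Icc 2 (n + 1)).powerset,
      (if qend s = r then
        fprod n N pos
          (((qpairs (ql s)).map fun p => astar n N pos p.1 p.2)
            ++ [kD n N pos kappa r (n + 1)]) m
      else 0) = ∑ r ∈ Finset.Icc 1 n, ⇑(formL kappa m (pathSum n r) (zc n r (n + 1)) :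
          Module.End ℂ (Fock n N pos)) := by
    refine Finset.sum_congr rfl fun r hr => ?_
    have hr' := Finset.mem_Icc.1 hr
    simp only [fprod_map_astar_kD]
    rw [← sum_paths_qend n r hr'.1 (by omega)]
    have h := sum_ite_coe (Finset.Icc 2 (n + 1)).powerset (fun s => qend s = r)
      ((formL kappa m : Coord n →ₗ[ℂ] Coord n →ₗ[ℂ] Module.End ℂ (Fock n N pos)).flip
        (zc n r (n + 1))) fun s => pathProd n (qpairs (ql s))
    simp only [LinearMap.flip_apply] at h
    exact h
  rw [rhoF0, h1, h2, h3]
  funext w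
  simp only [opF, vF0, map_neg, map_sum, Pi.neg_apply, Pi.add_apply, Finset.sum_apply,
    LinearMap.add_apply, LinearMap.neg_apply, LinearMap.sum_apply, Finset.sum_neg_distrib,
    sub_eq_add_neg]

end Affine

section VectorFields

variable {n : ℕ}

/-- The matrix entries `z_{ij} - δ_{ij}`. -/
def mc (n i j : ℕ) : Coord n := zc n i j - if i = j then 1 else 0

lemma mc_of_ne {i j : ℕ} (h : i ≠ j) : mc n i j = zc n i j := by
  rw [mc, if_neg h, sub_zero]

lemma mc_self (n i : ℕ) : mc n i i = -1 := by
  rw [mc, zc_eq_zero (by omega), if_pos rfl, zero_sub]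

lemma mc_eq_zero {i j : ℕ} (h : ¬(1 ≤ i ∧ i < j ∧ j ≤ n + 1)) (hij : i ≠ j) : mc n i j = 0 := by
  rw [mc_of_ne hij, zc_eq_zero h]

lemma derivation_mc (v : Derivation ℂ (Coord n) (Coord n)) (i j : ℕ) :
    v (mc n i j) = v (zc n i j) := by
  rw [mc, map_sub]
  split_ifs <;> simp

lemma derivation_mc_eq_zero (v : Derivation ℂ (Coord n) (Coord n)) {i j : ℕ}
    (h : ¬(1 ≤ i ∧ i < j ∧ j ≤ n + 1)) : v (mc n i j) = 0 := by
  rw [derivation_mc, zc_eq_zero h, map_zero]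

lemma derivation_ext_mc {v w : Derivation ℂ (Coord n) (Coord n)}
    (h : ∀ i j, 1 ≤ i → i < j → j ≤ n + 1 → v (mc n i j) = w (mc n i j)) : v = w := by
  refine MvPolynomial.derivation_ext fun σ => ?_
  have := h σ.1.1 σ.1.2 σ.2.1 σ.2.2.1 σ.2.2.2
  rwa [derivation_mc, derivation_mc, zc, dif_pos σ.2] at this

lemma del_zc {i j : ℕ} (h : 1 ≤ i ∧ i < j ∧ j ≤ n + 1) (a b : ℕ) :
    del n a b (zc n i j) = if a = i ∧ b = j then 1 else 0 := by
  classical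
  by_cases hab : 1 ≤ a ∧ a < b ∧ b ≤ n + 1
  · rw [del, dif_pos hab, zc, dif_pos h, MvPolynomial.pderiv_X, Pi.single_apply]
    simp only [Subtype.mk.injEq, Prod.mk.injEq, eq_comm]
  · rw [del, dif_neg hab, if_neg (by rintro ⟨rfl, rfl⟩; exact hab h)]
    rfl

lemma del_mc (i j : ℕ) {a b : ℕ} (h : 1 ≤ a ∧ a < b ∧ b ≤ n + 1) :
    del n a b (mc n i j) = if a = i ∧ b = j then 1 else 0 := by
  by_cases hij : 1 ≤ i ∧ i < j ∧ j ≤ n + 1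
  · rw [derivation_mc, del_zc hij]
  · rw [derivation_mc_eq_zero _ hij, if_neg (by rintro ⟨rfl, rfl⟩; exact hij h)]

lemma vE_mc {s : ℕ} (hs : 1 ≤ s) (hsn : s ≤ n) (i j : ℕ) :
    vE n s (mc n i j) = (if i = s then mc n s (s + 1) * mc n s j else 0)
      - (if i = s + 1 then mc n s j + mc n s (s + 1) * mc n (s + 1) j else 0)
      + (if j = s then mc n i (s + 1) else 0) := by
  by_cases h : 1 ≤ i ∧ i < j ∧ j ≤ n + 1
  · simp only [derivation_mc, vE, Derivation.add_apply, Derivation.sub_apply,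
      derivation_sum_apply, Derivation.smul_apply, smul_eq_mul, del_zc h, ite_and, mul_ite,
      mul_one, mul_zero, Finset.sum_sub_distrib, Finset.sum_ite_irrel, Finset.sum_ite_eq',
      Finset.sum_const_zero, Finset.mem_Icc, Finset.mem_Ico]
    by_cases hi : i = s
    · subst hi
      by_cases hj : j = i + 1
      · subst hj
        simp [mc_of_ne]
      · have h1 : i + 2 ≤ j := by omega
        have h2 : j ≠ i := by omega
        simp [h1, h2, h.2.2, Ne.symm hj, mc_of_ne, Ne.symm h2, mul_comm]
    · by_cases hi' : i = s + 1
      · subst hi'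
        have h1 : s + 2 ≤ j := by omega
        have h2 : s ≠ j := by omega
        have h3 : s + 1 ≠ j := by omega
        simp [h1, h2, h.2.2, h2.symm, mc_of_ne, h3]
        ring
      · by_cases hj : j = s
        · subst hj
          simp [hi, hi', h.1, h.2.1, Ne.symm hi, Ne.symm hi', mc_of_ne]
        · simp [hi, hi', Ne.symm hi, Ne.symm hi', hj, Ne.symm hj]
  · rw [derivation_mc_eq_zero _ h]
    by_cases hi : i = s
    · subst hi
      by_cases hj : j = i
      · subst hj; simp [mc_self]
      · simp [hj, mc_eq_zero h (Ne.symm hj)]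
    · by_cases hi' : i = s + 1
      · subst hi'
        by_cases hj : j = s
        · subst hj; simp [mc_self, mc_eq_zero h hi]
        · by_cases hj' : j = s + 1
          · subst hj'; simp [mc_self]
          · simp [hj, mc_eq_zero h (Ne.symm hj'),
              mc_eq_zero (n := n) (i := s) (j := j) (by omega) (Ne.symm hj)]
      · by_cases hj : j = s
        · subst hj
          simp [hi, hi', mc_eq_zero (n := n) (i := i) (j := j + 1) (by omega) hi']
        · simp [hi, hi', hj]

lemma vF_mc {r : ℕ} (hr : 1 ≤ r) (hrn : r ≤ n) (i j : ℕ) :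
    vF n r (mc n i j) = if j = r + 1 then -mc n i r else 0 := by
  by_cases h : 1 ≤ i ∧ i < j ∧ j ≤ n + 1
  · simp only [derivation_mc, vF, Derivation.sub_apply,
      derivation_sum_apply, Derivation.smul_apply, smul_eq_mul, del_zc h, ite_and, mul_ite,
      mul_one, mul_zero, Finset.sum_ite_eq', Finset.mem_Ico]
    by_cases hj : j = r + 1
    · subst hj
      by_cases hi : i = r
      · subst hi
        simp [mc_self]
      · have h1 : i < r := by omega
        simp [mc_of_ne hi, h.1, h1, Ne.symm hi]
    · simp [hj, Ne.symm hj]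
  · rw [derivation_mc_eq_zero _ h]
    split_ifs with hj
    · rw [mc_eq_zero (by omega) (by omega), neg_zero]
    · rfl

lemma vH_mc {r : ℕ} (hr : 1 ≤ r) (hrn : r ≤ n) (i j : ℕ) :
    vH n r (mc n i j) = ((if i = r then (1 : ℂ) else 0) - (if i = r + 1 then 1 else 0)
      - (if j = r then 1 else 0) + (if j = r + 1 then 1 else 0)) • mc n i j := by
  by_cases h : 1 ≤ i ∧ i < j ∧ j ≤ n + 1
  · simp only [derivation_mc, vH, Derivation.add_apply, Derivation.sub_apply,
      derivation_sum_apply, Derivation.smul_apply, smul_eq_mul, del_zc h, ite_and, mul_ite,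
      mul_one, mul_zero, Finset.sum_sub_distrib, Finset.sum_ite_irrel, Finset.sum_ite_eq',
      Finset.sum_const_zero, Finset.mem_Icc, Finset.mem_Ico]
    rw [mc_of_ne (by omega)]
    by_cases hi : i = r
    · subst hi
      by_cases hj : j = i + 1
      · subst hj
        simp
        module
      · have h1 : i + 2 ≤ j := by omega
        have h2 : j ≠ i := by omega
        simp [h1, h2, h.2.2, Ne.symm hj, hj]
    · by_cases hi' : i = r + 1
      · subst hi'
        have h1 : r + 2 ≤ j := by omega
        have h2 : j ≠ r := by omega
        have h3 : j ≠ r + 1 := by omega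
        simp [h1, h2, h.2.2, h3]
      · by_cases hj : j = r
        · subst hj
          simp [hi, hi', h.1, h.2.1, Ne.symm hi, Ne.symm hi']
        · by_cases hj' : j = r + 1
          · subst hj'
            have h1 : i < r := by omega
            simp [hi, hi', h.1, h1, Ne.symm hi, Ne.symm hi']
          · simp [hi, hi', Ne.symm hi, Ne.symm hi', hj, Ne.symm hj, hj', Ne.symm hj']
  · rw [derivation_mc_eq_zero _ h]
    by_cases hij : i = j
    · subst hij
      simp
    · rw [mc_eq_zero h hij, smul_zero]

end VectorFields

section PathPartial

variable {n : ℕ}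

/-- The partial path sums `δ_{1j} + ∑_{k ≤ r} U_k (z_{kj} - δ_{kj})`, where `U_k` is
`pathSum n k`. -/
def pathPartial (n : ℕ) : ℕ → ℕ → Coord n
  | 0, j => if j = 1 then 1 else 0
  | r + 1, j => pathPartial n r j + pathPartial n r (r + 1) * mc n (r + 1) j

lemma pathPartial_zero (n j : ℕ) : pathPartial n 0 j = if j = 1 then 1 else 0 := rfl

lemma pathPartial_succ (n r j : ℕ) : pathPartial n (r + 1) j
    = pathPartial n r j + pathPartial n r (r + 1) * mc n (r + 1) j := rfl

lemma pathSumLE_succ (n r j : ℕ) :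
    pathSumLE n (r + 1) j = pathSumLE n r j + pathSum n (r + 1) * zc n (r + 1) j := by
  rw [pathSumLE, Finset.sum_Icc_succ_top (by omega), pathSumLE]

lemma pathSumLE_zero (n j : ℕ) : pathSumLE n 0 j = 0 := by
  rw [pathSumLE, Finset.Icc_eq_empty (by omega), Finset.sum_empty]

lemma pathPartial_eq {r j : ℕ} (h : r < j) :
    pathPartial n r j = (if j = 1 then 1 else 0) + pathSumLE n r j := by
  induction r generalizing j with
  | zero => rw [pathPartial_zero, pathSumLE_zero, add_zero]
  | succ r ih =>
    rw [pathPartial_succ, ih (by omega), ih (by omega), pathSumLE_succ, pathSum_eq n (r + 1),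
      mc_of_ne (by omega), Nat.add_sub_cancel, add_assoc]

lemma pathSum_succ (n r : ℕ) : pathSum n (r + 1) = pathPartial n r (r + 1) := by
  rw [pathPartial_eq r.lt_succ_self, pathSum_eq, Nat.add_sub_cancel]

lemma pathSumLE_eq_pathPartial {r j : ℕ} (h : r < j) (hj : j ≠ 1) :
    pathSumLE n r j = pathPartial n r j := by
  rw [pathPartial_eq h, if_neg hj, zero_add]

lemma pathPartial_zero_right (n r : ℕ) : pathPartial n r 0 = 0 := by
  induction r with
  | zero => rfl
  | succ r ih => rw [pathPartial_succ, ih, mc_eq_zero (by omega) (by omega), mul_zero, add_zero]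

lemma pathPartial_eq_zero {r j : ℕ} (h : j ≤ r) : pathPartial n r j = 0 := by
  induction r with
  | zero => rw [Nat.le_zero.1 h, pathPartial_zero_right]
  | succ r ih =>
    rcases h.eq_or_lt with rfl | h
    · rw [pathPartial_succ, mc_self]
      ring
    · rw [pathPartial_succ, ih (by omega), mc_eq_zero (by omega) (by omega), mul_zero, add_zero]

lemma pathPartial_eq_zero_of_gt {r j : ℕ} (hj : n + 1 < j) : pathPartial n r j = 0 := by
  by_cases h : r < j
  · rw [pathPartial_eq h, if_neg (by omega), zero_add, pathSumLE]
    exact Finset.sum_eq_zero fun k _ => by rw [zc_eq_zero (by omega), mul_zero]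
  · exact pathPartial_eq_zero (by omega)

lemma vE_pathPartial {s : ℕ} (hs : 1 ≤ s) (hsn : s ≤ n) (r j : ℕ) :
    vE n s (pathPartial n r j) = (if r = s then pathPartial n s (s + 1) * mc n s j else 0)
      + (if j = s then pathPartial n r (s + 1) else 0) := by
  induction r generalizing j with
  | zero =>
    rw [pathPartial_zero, pathPartial_zero, if_neg (by omega : 0 ≠ s),
      if_neg (by omega : s + 1 ≠ 1)]
    split_ifs <;> simp
  | succ r ih =>
    rw [pathPartial_succ, map_add, Derivation.leibniz, ih, ih, vE_mc hs hsn, smul_eq_mul,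
      smul_eq_mul, pathPartial_succ n r (s + 1)]
    by_cases h1 : r = s
    · subst h1
      by_cases h2 : j = r
      · subst h2
        simp
        ring
      · simp [h2]
        ring
    · by_cases h3 : r + 1 = s
      · subst h3
        by_cases h2 : j = r + 1
        · subst h2
          simp [pathPartial_succ]
          ring
        · simp [h2, pathPartial_succ]
          ring
      · by_cases h2 : j = s
        · subst h2
          simp [h1, h3]
        · simp [h1, h2, h3]

lemma del_pathPartial {r : ℕ} (hn : 1 ≤ n) (hr : r ≤ n) (j : ℕ) :
    del n 1 (n + 1) (pathPartial n r j) = if 1 ≤ r ∧ j = n + 1 then 1 else 0 := by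
  induction r generalizing j with
  | zero =>
    rw [pathPartial_zero]
    split_ifs <;> simp_all
  | succ r ih =>
    rw [pathPartial_succ, map_add, Derivation.leibniz, ih (by omega), ih (by omega),
      del_mc _ _ (by omega), smul_eq_mul, smul_eq_mul]
    rcases Nat.eq_zero_or_pos r with rfl | h
    · by_cases hj : j = n + 1
      · simp [hj, pathPartial_zero]
      · simp [hj, Ne.symm hj]
    · by_cases hj : j = n + 1
      · simp [hj, h.ne', (show 1 ≤ r from h), show r ≠ n by omega]
      · simp [hj, Ne.symm hj, show r ≠ n by omega]

lemma vF0_mc (i j : ℕ) : vF0 n (mc n i j) = -(mc n i (n + 1) * pathPartial n i j) := by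
  by_cases h : 1 ≤ i ∧ i < j ∧ j ≤ n + 1
  · rw [← pathSumLE_eq_pathPartial h.2.1 (by omega), mc_of_ne (by omega : i ≠ n + 1)]
    have h1 : 1 ≤ j := by omega
    have h2 : i ≤ n + 1 := by omega
    simp [derivation_mc, vF0, derivation_sum_apply, del_zc h, ite_and, h1, h2, h.1, h.2.2]
  · rw [derivation_mc_eq_zero _ h]
    by_cases hi : i = 0
    · rw [mc_eq_zero (by omega) (by omega), zero_mul, neg_zero]
    · by_cases hj : j ≤ i
      · rw [pathPartial_eq_zero hj, mul_zero, neg_zero]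
      · rw [pathPartial_eq_zero_of_gt (by omega), mul_zero, neg_zero]

end PathPartial

section Brackets

variable {n : ℕ}

lemma commutator_vE_vF0 {s : ℕ} (hs : 1 ≤ s) (hsn : s ≤ n) : ⁅vE n s, vF0 n⁆ = 0 := by
  refine derivation_ext_mc fun i j _ _ _ => ?_
  rw [Derivation.commutator_apply, vF0_mc, vE_mc hs hsn, map_neg, Derivation.leibniz,
    vE_pathPartial hs hsn, vE_mc hs hsn, Derivation.zero_apply]
  by_cases h1 : i = s
  · subst h1
    have h2 : j ≠ i := by omega
    have h3 : n + 1 ≠ i := by omega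
    simp [h2, h3, vF0_mc, Derivation.leibniz]
    ring
  · by_cases h2 : i = s + 1
    · subst h2
      have h3 : j ≠ s := by omega
      have h4 : n + 1 ≠ s := by omega
      simp [h3, h4, vF0_mc, Derivation.leibniz, pathPartial_succ]
      ring
    · have h4 : n + 1 ≠ s := by omega
      by_cases h3 : j = s
      · simp [h1, h2, h3, h4, vF0_mc]
      · simp [h1, h2, h3, h4]

lemma vF_entry {r s : ℕ} (hr : 1 ≤ r) (hrn : r ≤ n) :
    vF n r (mc n s (s + 1)) = if r = s then 1 else 0 := by
  rw [vF_mc hr hrn]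
  by_cases h : r = s
  · subst h
    simp [mc_self]
  · simp [h, Ne.symm h]

lemma commutator_vE_vF {s r : ℕ} (hs : 1 ≤ s) (hsn : s ≤ n) (hr : 1 ≤ r) (hrn : r ≤ n) :
    ⁅vE n s, vF n r⁆ = (-(if s = r then (1 : ℂ) else 0)) • vH n r := by
  refine derivation_ext_mc fun i j _ hij _ => ?_
  rw [Derivation.commutator_apply, vF_mc hr hrn, vE_mc hs hsn, Derivation.smul_apply,
    vH_mc hr hrn, map_add, map_sub, apply_ite (vE n s), map_neg, map_zero, vE_mc hs hsn,
    apply_ite (vF n r), apply_ite (vF n r), apply_ite (vF n r), map_zero, map_add,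
    Derivation.leibniz, Derivation.leibniz, vF_entry hr hrn, vF_mc hr hrn, vF_mc hr hrn,
    vF_mc hr hrn]
  simp only [smul_eq_mul]
  by_cases hsr : s = r
  · subst hsr
    by_cases h1 : i = s
    · subst h1
      have h2 : j ≠ i := by omega
      by_cases h3 : j = i + 1
      · subst h3
        simp [mc_self]
        module
      · simp [h2, h3]
    · by_cases h2 : i = s + 1
      · subst h2
        have h3 : j ≠ s := by omega
        have h4 : j ≠ s + 1 := by omega
        simp [h3, h4]
      · by_cases h3 : j = s
        · subst h3
          simp [h1, h2]
        · by_cases h4 : j = s + 1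
          · subst h4
            simp [h1, h2]
          · simp [h1, h2, h3, h4]
  · by_cases h4 : j = r + 1
    · subst h4
      by_cases h1 : i = s
      · simp [h1, hsr, Ne.symm hsr]
      · by_cases h2 : i = s + 1
        · simp [h2, hsr, Ne.symm hsr]
          ring
        · simp [h1, h2, hsr, Ne.symm hsr]
    · simp [h4, hsr, Ne.symm hsr]

lemma sum_vH_mc {i j : ℕ} (hi : 1 ≤ i) (hij : i < j) (hj : j ≤ n + 1) :
    ∑ r ∈ Finset.Icc 1 n, vH n r (mc n i j)
      = ((if i = 1 then (1 : ℂ) else 0) + (if j = n + 1 then 1 else 0)) • mc n i j := by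
  rw [Finset.sum_congr rfl fun r hr => vH_mc (Finset.mem_Icc.1 hr).1 (Finset.mem_Icc.1 hr).2 i j,
    ← Finset.sum_smul]
  congr 1
  have h := Finset.sum_range_sub' (fun r => (if i = r + 1 then (1 : ℂ) else 0)
    - (if j = r + 1 then 1 else 0)) n
  rw [Finset.range_eq_Ico, Finset.sum_Ico_add' (fun r => ((if i = r then (1 : ℂ) else 0)
    - (if j = r then 1 else 0)) - ((if i = r + 1 then (1 : ℂ) else 0)
    - (if j = r + 1 then 1 else 0))) 0 n 1] at h
  have h1 : Finset.Ico (0 + 1) (n + 1) = Finset.Icc 1 n := by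
    ext
    simp only [Finset.mem_Ico, Finset.mem_Icc]
    omega
  rw [h1] at h
  rw [Finset.sum_congr rfl fun r _ => (by ring : _ = ((if i = r then (1 : ℂ) else 0)
    - (if j = r then 1 else 0)) - ((if i = r + 1 then (1 : ℂ) else 0)
    - (if j = r + 1 then 1 else 0))), h, if_neg (by omega : j ≠ 0 + 1),
    if_neg (by omega : i ≠ n + 1)]
  simp

lemma commutator_del_vF0 (hn : 1 ≤ n) :
    ⁅-del n 1 (n + 1), vF0 n⁆ = ∑ r ∈ Finset.Icc 1 n, vH n r := by
  refine derivation_ext_mc fun i j hi hij hj => ?_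
  rw [derivation_sum_apply, sum_vH_mc hi hij hj, Derivation.commutator_apply, vF0_mc,
    Derivation.neg_apply, Derivation.neg_apply, map_neg, map_neg, del_mc _ _ (by omega),
    Derivation.leibniz, del_mc _ _ (by omega), smul_eq_mul, smul_eq_mul, apply_ite (vF0 n),
    Derivation.map_one_eq_zero, map_zero, ite_self, del_pathPartial hn (by omega)]
  have h1 : pathPartial n 1 j = mc n 1 j := by
    rw [pathPartial_succ, pathPartial_zero, pathPartial_zero, if_neg (by omega), if_pos rfl,
      zero_add, one_mul]
  by_cases h2 : i = 1
  · subst h2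
    by_cases h3 : j = n + 1
    · subst h3
      simp [h1]
      module
    · simp [h1, h3]
  · by_cases h3 : j = n + 1
    · subst h3
      simp [h2, Ne.symm h2, hi]
    · simp [h2, Ne.symm h2, h3]

lemma commutator_del_vF {r : ℕ} (hn : 1 ≤ n) (hr : 1 ≤ r) (hrn : r ≤ n) :
    ⁅-del n 1 (n + 1), vF n r⁆ = 0 := by
  refine derivation_ext_mc fun i j hi hij hj => ?_
  rw [Derivation.commutator_apply, vF_mc hr hrn, Derivation.neg_apply, Derivation.neg_apply,
    map_neg, del_mc _ _ (by omega), apply_ite (del n 1 (n + 1)), map_neg, map_zero,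
    del_mc _ _ (by omega), apply_ite (vF n r), Derivation.map_one_eq_zero, map_zero, ite_self,
    if_neg (by omega : ¬ (1 = i ∧ n + 1 = r))]
  simp

end Brackets

section Pairings

variable {n : ℕ}

/-- The sum over `1 ≤ r ≤ n` of a family supported on `{s, s + 1}`. -/
lemma sum_Icc_pair {X : Type*} [AddCommMonoid X] {s : ℕ} (hs : 1 ≤ s) (hsn : s ≤ n) {f : ℕ → X}
    (hf : ∀ r, r ≠ s → r ≠ s + 1 → f r = 0) (hn : f (n + 1) = 0) :
    ∑ r ∈ Finset.Icc 1 n, f r = f s + f (s + 1) := by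
  have h : ∑ r ∈ Finset.Icc 1 n, f r = ∑ r ∈ Finset.Icc 1 (n + 1), f r := by
    rw [Finset.sum_Icc_succ_top (by omega), hn, add_zero]
  rw [h, ← Finset.sum_pair (by omega : s ≠ s + 1)]
  refine (Finset.sum_subset (fun r hr => ?_) fun r _ hr => ?_).symm
  · simp only [Finset.mem_insert, Finset.mem_singleton] at hr
    rw [Finset.mem_Icc]
    omega
  · simp only [Finset.mem_insert, Finset.mem_singleton, not_or] at hr
    exact hf r hr.1 hr.2

variable {X : Type*} [AddCommGroup X] [Module ℂ X]

lemma pathPartial_pathSum {s : ℕ} (hs : 1 ≤ s) (j : ℕ) :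
    pathPartial n s j = pathPartial n (s - 1) j + pathSum n s * mc n s j := by
  obtain ⟨s, rfl⟩ : ∃ k, s = k + 1 := ⟨s - 1, by omega⟩
  rw [pathPartial_succ, pathSum_succ, Nat.add_sub_cancel]

lemma vE_pathSum {s r : ℕ} (hs : 1 ≤ s) (hsn : s ≤ n) (hr : 1 ≤ r) :
    vE n s (pathSum n r) = (if r = s + 1 then mc n s (s + 1) * pathSum n (s + 1) else 0)
      + (if r = s then pathSum n (s + 1) - mc n s (s + 1) * pathSum n s else 0) := by
  obtain ⟨r, rfl⟩ : ∃ k, r = k + 1 := ⟨r - 1, by omega⟩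
  rw [pathSum_succ, vE_pathPartial hs hsn, pathSum_succ]
  by_cases h : r = s
  · subst h
    simp [mul_comm]
  · by_cases h' : r + 1 = s
    · subst h'
      simp [pathPartial_succ n r (r + 1 + 1), pathSum_succ]
      ring
    · simp [h, h']

lemma vE_column {s : ℕ} (hs : 1 ≤ s) (hsn : s ≤ n) (r : ℕ) :
    vE n s (mc n r (n + 1)) = (if r = s then mc n s (s + 1) * mc n s (n + 1) else 0)
      - (if r = s + 1 then mc n s (n + 1) + mc n s (s + 1) * mc n (s + 1) (n + 1) else 0) := by
  rw [vE_mc hs hsn, if_neg (by omega : n + 1 ≠ s), add_zero]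

lemma sum_pairing_vE_right (B : Coord n →ₗ[ℂ] Coord n →ₗ[ℂ] X) {s : ℕ} (hs : 1 ≤ s)
    (hsn : s ≤ n) :
    ∑ r ∈ Finset.Icc 1 n, B (pathSum n r) (vE n s (mc n r (n + 1)))
      = B (pathSum n s) (mc n s (s + 1) * mc n s (n + 1))
        - B (pathSum n (s + 1))
          (mc n s (n + 1) + mc n s (s + 1) * mc n (s + 1) (n + 1)) := by
  rw [sum_Icc_pair hs hsn]
  · simp [vE_column hs hsn, sub_eq_add_neg]
  · intro r h1 h2
    simp [vE_column hs hsn, h1, h2]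
  · rw [mc_self, map_neg, Derivation.map_one_eq_zero, neg_zero, map_zero]

lemma sum_pairing_vE_left (B : Coord n →ₗ[ℂ] Coord n →ₗ[ℂ] X) (hB : ∀ Q, B Q 1 = 0) {s : ℕ}
    (hs : 1 ≤ s) (hsn : s ≤ n) :
    ∑ r ∈ Finset.Icc 1 n, B (vE n s (pathSum n r)) (mc n r (n + 1))
      = B (pathSum n (s + 1) - mc n s (s + 1) * pathSum n s) (mc n s (n + 1))
        + B (mc n s (s + 1) * pathSum n (s + 1)) (mc n (s + 1) (n + 1)) := by
  rw [Finset.sum_congr rfl fun r hr => by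
    rw [vE_pathSum hs hsn (Finset.mem_Icc.1 hr).1], sum_Icc_pair hs hsn]
  · simp
  · intro r h1 h2
    simp [h1, h2]
  · rw [mc_self, map_neg, hB, neg_zero]

lemma sum_cartan_smul {s : ℕ} (hs : 1 ≤ s) (hsn : s ≤ n) {f : ℕ → X} (h0 : f 0 = 0)
    (hn : f (n + 1) = 0) :
    ∑ j ∈ Finset.Icc 1 n, cartan s j • f j = (2 : ℂ) • f s - f (s - 1) - f (s + 1) := by
  have h1 : ∀ j, cartan s j • f j = (if s = j then (2 : ℂ) • f j else 0)
      - (if s - 1 = j then f j else 0) - (if s + 1 = j then f j else 0) := by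
    intro j
    have h2 : (if s = j + 1 then (1 : ℂ) else 0) = if s - 1 = j then 1 else 0 :=
      if_congr (by omega) rfl rfl
    rw [cartan, h2]
    split_ifs <;> module
  simp only [h1, Finset.sum_sub_distrib, Finset.sum_ite_eq, Finset.mem_Icc]
  have h2 : (if 1 ≤ s - 1 ∧ s - 1 ≤ n then f (s - 1) else 0) = f (s - 1) := by
    split_ifs with h
    · rfl
    · rw [(by omega : s - 1 = 0), h0]
  have h3 : (if 1 ≤ s + 1 ∧ s + 1 ≤ n then f (s + 1) else 0) = f (s + 1) := by
    split_ifs with h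
    · rfl
    · rw [(by omega : s + 1 = n + 1), hn]
  rw [if_pos ⟨hs, hsn⟩, h2, h3]

lemma sum_cartan_pathSumLE {s : ℕ} (hs : 1 ≤ s) (hsn : s ≤ n) :
    ∑ j ∈ Finset.Icc 1 n, cartan s j • pathSumLE n j (n + 1)
      = pathSum n s * mc n s (n + 1) - pathSum n (s + 1) * mc n (s + 1) (n + 1) := by
  rw [Finset.sum_congr rfl fun j hj => by
    rw [pathSumLE_eq_pathPartial (by have := (Finset.mem_Icc.1 hj).2; omega) (by omega)],
    sum_cartan_smul hs hsn]
  · rw [pathPartial_pathSum (s := s + 1) (by omega), Nat.add_sub_cancel,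
      pathPartial_pathSum hs, two_smul]
    ring
  · rw [pathPartial_zero, if_neg (by omega)]
  · rw [pathPartial_eq_zero le_rfl]

lemma sum_cartan_pairing (B : Coord n →ₗ[ℂ] Coord n →ₗ[ℂ] X) {s : ℕ} (hs : 1 ≤ s)
    (hsn : s ≤ n) (z : Coord n) :
    ∑ i ∈ Finset.Icc 1 n, ∑ j ∈ Finset.Icc 1 n,
        cartan i j • B (-pathSumLE n j (n + 1)) (if i = s then z else 0)
      = -B (pathSum n s * mc n s (n + 1) - pathSum n (s + 1) * mc n (s + 1) (n + 1)) z := by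
  rw [Finset.sum_eq_single_of_mem s (Finset.mem_Icc.2 ⟨hs, hsn⟩)]
  · rw [← sum_cartan_pathSumLE hs hsn, if_pos rfl, map_sum, LinearMap.sum_apply,
      ← Finset.sum_neg_distrib]
    refine Finset.sum_congr rfl fun j _ => ?_
    rw [map_neg, LinearMap.neg_apply, smul_neg, map_smul, LinearMap.smul_apply]
  · intro i _ hi
    simp [hi]

end Pairings

section Relations

variable {n N : ℕ} {pos : MM N → Prop}

lemma opE_opF_commutator_ne {kappa : MM N → Fin (N + 1) → ℂ} (lam : ℕ → ℂ)
    (htri : ∀ a : MM N, pos a ∨ a = 0 ∨ pos (-a))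
    (hzero : ¬ pos (0 : MM N))
    (hdisj : ∀ a : MM N, pos a → ¬ pos (-a))
    (hE1 : ∀ m : MM N, ∑ p : Fin (N + 1), (m p : ℂ) * kappa m p = 0)
    (hE2 : ∀ m k : MM N, pos m → pos k →
      ∑ p : Fin (N + 1), (m p : ℂ) * kappa (-m - k) p = 0)
    {s r : ℕ} (hs : 1 ≤ s) (hsn : s ≤ n) (hr : 1 ≤ r) (hrn : r ≤ n) (m l : MM N) :
    (opE kappa lam (vE n s) (fun i => if i = s then zc n s (s + 1) else 0) (zc n s (s + 1)) m
          * opF kappa lam (vF n r) 0 0 0 l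
        - opF kappa lam (vF n r) 0 0 0 l
          * opE kappa lam (vE n s) (fun i => if i = s then zc n s (s + 1) else 0)
            (zc n s (s + 1)) m : Module.End ℂ (Fock n N pos))
      = (-(if s = r then (1 : ℂ) else 0)) • (vecL (m + l) (vH n r) + PhiL kappa lam r (m + l)
          - (∑ p : Fin (N + 1), (m p : ℂ) * kappa (-(m + l)) p) • 1) := by
  have hz : vF n r (zc n s (s + 1)) = if s = r then 1 else 0 := by
    rw [← derivation_mc, vF_entry hr hrn]
    exact if_congr eq_comm rfl rfl
  have h1 : ∑ i ∈ Finset.Icc 1 n, modeL (PhiL kappa lam i) (m + l)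
      (vE n s ((0 : ℕ → Coord n) i) - vF n r (if i = s then zc n s (s + 1) else 0))
      = ((-(if s = r then (1 : ℂ) else 0)) • PhiL kappa lam r (m + l) :
        Module.End ℂ (Fock n N pos)) := by
    rw [Finset.sum_eq_single_of_mem s (Finset.mem_Icc.2 ⟨hs, hsn⟩)]
    · rw [if_pos rfl, hz, Pi.zero_apply, map_zero, zero_sub, map_neg]
      by_cases h : s = r
      · subst h
        rw [if_pos rfl, if_pos rfl, modeL_one]
        module
      · rw [if_neg h, if_neg h, map_zero]
        module
    · intro i _ hi
      rw [if_neg hi, Pi.zero_apply, map_zero, map_zero, sub_zero, map_zero]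
  rw [opE_opF_commutator lam htri hzero hdisj hE1 hE2, h1, commutator_vE_vF hs hsn hr hrn, hz,
    LinearMap.map_smul]
  simp only [Pi.zero_apply, map_zero, LinearMap.zero_apply, mul_zero, smul_zero,
    Finset.sum_const_zero, add_zero, sub_zero, zero_add]
  by_cases h : s = r
  · subst h
    rw [if_pos rfl, if_pos rfl, scalL_one]
    refine LinearMap.ext fun u => ?_
    simp only [LinearMap.add_apply, LinearMap.sub_apply, LinearMap.smul_apply]
    module
  · rw [if_neg h, if_neg h, map_zero]
    refine LinearMap.ext fun u => ?_
    simp only [LinearMap.add_apply, LinearMap.smul_apply, LinearMap.zero_apply]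
    module

lemma opE_opF_commutator_affine {kappa : MM N → Fin (N + 1) → ℂ} (lam : ℕ → ℂ)
    (htri : ∀ a : MM N, pos a ∨ a = 0 ∨ pos (-a))
    (hzero : ¬ pos (0 : MM N))
    (hdisj : ∀ a : MM N, pos a → ¬ pos (-a))
    (hE1 : ∀ m : MM N, ∑ p : Fin (N + 1), (m p : ℂ) * kappa m p = 0)
    (hE2 : ∀ m k : MM N, pos m → pos k →
      ∑ p : Fin (N + 1), (m p : ℂ) * kappa (-m - k) p = 0)
    {s : ℕ} (hs : 1 ≤ s) (hsn : s ≤ n) (m l : MM N) :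
    (opE kappa lam (vE n s) (fun i => if i = s then zc n s (s + 1) else 0) (zc n s (s + 1)) m
          * opF kappa lam (vF0 n) (fun r => -pathSumLE n r (n + 1)) (fun r => -pathSum n r)
            (fun r => zc n r (n + 1)) l
        - opF kappa lam (vF0 n) (fun r => -pathSumLE n r (n + 1)) (fun r => -pathSum n r)
            (fun r => zc n r (n + 1)) l
          * opE kappa lam (vE n s) (fun i => if i = s then zc n s (s + 1) else 0)
            (zc n s (s + 1)) m : Module.End ℂ (Fock n N pos)) = 0 := by
  have hcol : ∀ r ∈ Finset.Icc 1 n, zc n r (n + 1) = mc n r (n + 1) := fun r hr =>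
    (mc_of_ne (by have := (Finset.mem_Icc.1 hr).2; omega)).symm
  have hzm : zc n s (s + 1) = mc n s (s + 1) := (mc_of_ne (by omega)).symm
  have h1 : ∑ i ∈ Finset.Icc 1 n, modeL (PhiL kappa lam i) (m + l)
      (vE n s (-pathSumLE n i (n + 1)) - vF0 n (if i = s then zc n s (s + 1) else 0))
      = (0 : Module.End ℂ (Fock n N pos)) := by
    refine Finset.sum_eq_zero fun i hi => ?_
    have hi' := Finset.mem_Icc.1 hi
    rw [pathSumLE_eq_pathPartial (by omega) (by omega), map_neg, vE_pathPartial hs hsn,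
      if_neg (by omega : n + 1 ≠ s), apply_ite (vF0 n), map_zero, hzm, vF0_mc]
    split_ifs
    · rw [add_zero, mul_comm, sub_self, map_zero]
    · rw [add_zero, neg_zero, sub_zero, map_zero]
  have h2 : ∑ r ∈ Finset.Icc 1 n, (formL kappa (m + l) (vE n s (-pathSum n r)) (zc n r (n + 1))
        + formL kappa (m + l) (-pathSum n r) (vE n s (zc n r (n + 1))))
      = (-formL kappa (m + l) (pathSum n s * mc n s (n + 1)
          - pathSum n (s + 1) * mc n (s + 1) (n + 1)) (mc n s (s + 1)) :
        Module.End ℂ (Fock n N pos)) := by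
    rw [Finset.sum_congr rfl fun r hr => by
        rw [hcol r hr, map_neg, map_neg, map_neg, LinearMap.neg_apply, LinearMap.neg_apply,
          ← neg_add],
      Finset.sum_neg_distrib, Finset.sum_add_distrib, sum_pairing_vE_right _ hs hsn,
      sum_pairing_vE_left _ (formL_one_right kappa _) hs hsn]
    simp only [map_add, map_sub, LinearMap.sub_apply, formL_leibniz,
      mul_comm (mc n s (s + 1))]
    abel
  have h3 : ∑ r ∈ Finset.Icc 1 n, -pathSum n r * vE n s (zc n r (n + 1))
      = -(pathSum n s * (mc n s (s + 1) * mc n s (n + 1)) - pathSum n (s + 1)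
          * (mc n s (n + 1) + mc n s (s + 1) * mc n (s + 1) (n + 1))) := by
    rw [Finset.sum_congr rfl fun r hr => by rw [hcol r hr, neg_mul], Finset.sum_neg_distrib]
    exact congrArg Neg.neg (sum_pairing_vE_right (LinearMap.mul ℂ (Coord n)) hs hsn)
  have h4 : ∑ i ∈ Finset.Icc 1 n, ∑ j ∈ Finset.Icc 1 n,
        cartan i j • ((if i = s then mc n s (s + 1) else 0) * -pathSumLE n j (n + 1))
      = -((pathSum n s * mc n s (n + 1) - pathSum n (s + 1) * mc n (s + 1) (n + 1))
        * mc n s (s + 1)) := by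
    simp only [mul_comm (ite _ _ _)]
    exact sum_cartan_pairing (LinearMap.mul ℂ (Coord n)) hs hsn _
  rw [opE_opF_commutator lam htri hzero hdisj hE1 hE2, h1, h2, h3, commutator_vE_vF0 hs hsn,
    map_zero, hzm, h4, sum_cartan_pairing _ hs hsn, vF0_mc, pathSum_succ]
  have h5 : ∀ S U A W V : Coord n, -(U * (A * W) - S * (W + A * V)) + -(W * S)
      - -((U * W - S * V) * A) = 0 := fun S U A W V => by ring
  rw [h5, map_zero]
  abel

lemma affine_opF_commutator_affine {kappa : MM N → Fin (N + 1) → ℂ} (lam : ℕ → ℂ)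
    (htri : ∀ a : MM N, pos a ∨ a = 0 ∨ pos (-a))
    (hzero : ¬ pos (0 : MM N))
    (hdisj : ∀ a : MM N, pos a → ¬ pos (-a))
    (hE1 : ∀ m : MM N, ∑ p : Fin (N + 1), (m p : ℂ) * kappa m p = 0)
    (hE2 : ∀ m k : MM N, pos m → pos k →
      ∑ p : Fin (N + 1), (m p : ℂ) * kappa (-m - k) p = 0)
    (hn : 1 ≤ n) (m l : MM N) :
    (opE kappa lam (-del n 1 (n + 1)) 0 0 m
          * opF kappa lam (vF0 n) (fun r => -pathSumLE n r (n + 1)) (fun r => -pathSum n r)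
            (fun r => zc n r (n + 1)) l
        - opF kappa lam (vF0 n) (fun r => -pathSumLE n r (n + 1)) (fun r => -pathSum n r)
            (fun r => zc n r (n + 1)) l
          * opE kappa lam (-del n 1 (n + 1)) 0 0 m : Module.End ℂ (Fock n N pos))
      = ∑ r ∈ Finset.Icc 1 n, (vecL (m + l) (vH n r) + PhiL kappa lam r (m + l))
        + (∑ p : Fin (N + 1), (m p : ℂ) * kappa (-(m + l)) p) • 1 := by
  have hcol : ∀ r ∈ Finset.Icc 1 n, del n 1 (n + 1) (zc n r (n + 1)) = if r = 1 then 1 else 0 :=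
    fun r hr => by
      have hr' := Finset.mem_Icc.1 hr
      rw [del_zc (by omega)]
      exact if_congr (by omega) rfl rfl
  have h1 : ∀ r ∈ Finset.Icc 1 n,
      del n 1 (n + 1) (pathSumLE n r (n + 1)) = 1 := fun r hr => by
    have hr' := Finset.mem_Icc.1 hr
    rw [pathSumLE_eq_pathPartial (by omega) (by omega), del_pathPartial hn hr'.2,
      if_pos ⟨hr'.1, rfl⟩]
  have h2 : ∀ r ∈ Finset.Icc 1 n, del n 1 (n + 1) (pathSum n r) = 0 := fun r hr => by
    have hr' := Finset.mem_Icc.1 hr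
    obtain ⟨k, rfl⟩ : ∃ k, r = k + 1 := ⟨r - 1, by omega⟩
    rw [pathSum_succ, del_pathPartial hn (by omega), if_neg (by omega)]
  have h3 : ∑ r ∈ Finset.Icc 1 n, modeL (PhiL kappa lam r) (m + l)
      ((-del n 1 (n + 1)) (-pathSumLE n r (n + 1)) - vF0 n ((0 : ℕ → Coord n) r))
      = (∑ r ∈ Finset.Icc 1 n, PhiL kappa lam r (m + l) : Module.End ℂ (Fock n N pos)) := by
    refine Finset.sum_congr rfl fun r hr => ?_
    rw [Derivation.neg_apply, map_neg, neg_neg, h1 r hr, Pi.zero_apply, map_zero, sub_zero,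
      modeL_one]
  have h4 : ∑ r ∈ Finset.Icc 1 n,
      (formL kappa (m + l) ((-del n 1 (n + 1)) (-pathSum n r)) (zc n r (n + 1))
        + formL kappa (m + l) (-pathSum n r) ((-del n 1 (n + 1)) (zc n r (n + 1))))
      = (0 : Module.End ℂ (Fock n N pos)) := by
    refine Finset.sum_eq_zero fun r hr => ?_
    rw [Derivation.neg_apply, Derivation.neg_apply, Derivation.map_neg, h2 r hr, hcol r hr,
      neg_zero, neg_zero, map_zero, LinearMap.zero_apply, map_neg]
    split_ifs
    · rw [formL_one_right, neg_zero, add_zero]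
    · rw [map_zero, neg_zero, add_zero]
  have h5 : ∑ r ∈ Finset.Icc 1 n, -pathSum n r * (-del n 1 (n + 1)) (zc n r (n + 1)) = 1 := by
    rw [Finset.sum_eq_single_of_mem 1 (Finset.mem_Icc.2 ⟨le_rfl, hn⟩)]
    · rw [Derivation.neg_apply, hcol 1 (Finset.mem_Icc.2 ⟨le_rfl, hn⟩), if_pos rfl, pathSum_one,
        neg_mul_neg, one_mul]
    · intro r hr h
      rw [Derivation.neg_apply, hcol r hr, if_neg h, neg_zero, mul_zero]
  rw [opE_opF_commutator lam htri hzero hdisj hE1 hE2, h3, h4, h5, commutator_del_vF0 hn, map_sum]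
  simp only [Pi.zero_apply, map_zero, zero_mul, smul_zero,
    Finset.sum_const_zero, add_zero, sub_zero, scalL_one, Finset.sum_add_distrib]

lemma affine_opF_commutator {kappa : MM N → Fin (N + 1) → ℂ} (lam : ℕ → ℂ)
    (htri : ∀ a : MM N, pos a ∨ a = 0 ∨ pos (-a))
    (hzero : ¬ pos (0 : MM N))
    (hdisj : ∀ a : MM N, pos a → ¬ pos (-a))
    (hE1 : ∀ m : MM N, ∑ p : Fin (N + 1), (m p : ℂ) * kappa m p = 0)
    (hE2 : ∀ m k : MM N, pos m → pos k →
      ∑ p : Fin (N + 1), (m p : ℂ) * kappa (-m - k) p = 0)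
    {r : ℕ} (hr : 1 ≤ r) (hrn : r ≤ n) (m l : MM N) :
    (opE kappa lam (-del n 1 (n + 1)) 0 0 m * opF kappa lam (vF n r) 0 0 0 l
        - opF kappa lam (vF n r) 0 0 0 l * opE kappa lam (-del n 1 (n + 1)) 0 0 m :
      Module.End ℂ (Fock n N pos)) = 0 := by
  rw [opE_opF_commutator lam htri hzero hdisj hE1 hE2, commutator_del_vF (hr.trans hrn) hr hrn]
  simp

end Relations

section Assembly

variable {n N : ℕ} {pos : MM N → Prop}

lemma comm_coe (A B : Module.End ℂ (Fock n N pos)) : comm ⇑A ⇑B = ⇑(A * B - B * A) := rfl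

end Assembly

/-- For all `0 ≤ i, j ≤ n` and `m, n ∈ ℤ^{N+1}`,
`[ρ(E_i)_m, ρ(F_j)_n] = -δ_{ij} (ρ(H_i)_{m+n} - (Σ_{l=0}^N m_l κ_{-m-n,l}) · id_V)`
as operators on `V`. -/
theorem stmt14 (n N : ℕ) (hn : 2 ≤ n) (hN : 1 ≤ N)
    (pos : MM N → Prop)
    (hadd : ∀ a b : MM N, pos a → pos b → pos (a + b))
    (htri : ∀ a : MM N, pos a ∨ a = 0 ∨ pos (-a))
    (hzero : ¬ pos (0 : MM N))
    (hdisj : ∀ a : MM N, pos a → ¬ pos (-a))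
    (kappa : MM N → Fin (N + 1) → ℂ) (lam : ℕ → ℂ)
    (hE1 : ∀ m : MM N, ∑ p : Fin (N + 1), (m p : ℂ) * kappa m p = 0)
    (hE2 : ∀ m k : MM N, pos m → pos k →
      ∑ p : Fin (N + 1), (m p : ℂ) * kappa (-m - k) p = 0) :
    ∀ i j : ℕ, i ≤ n → j ≤ n → ∀ m mm : MM N,
      comm (rhoE n N pos kappa lam i m) (rhoFa n N pos kappa lam j mm)
        = (-(if i = j then (1 : ℂ) else 0)) •
            (rhoH n N pos kappa lam i (m + mm)
              - (∑ l : Fin (N + 1), (m l : ℂ) * kappa (-m - mm) l)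
                  • (id : Fock n N pos → Fock n N pos)) := by
  intro i j hi hj m mm
  have hn1 : 1 ≤ n := by omega
  have hneg : -m - mm = -(m + mm) := by abel
  rw [hneg, rhoFa]
  rcases Nat.eq_zero_or_pos i with rfl | hi0
  · rcases Nat.eq_zero_or_pos j with rfl | hj0
    · rw [rhoE_zero_eq, if_pos rfl, rhoF0_eq, comm_coe,
        affine_opF_commutator_affine lam htri hzero hdisj hE1 hE2 hn1]
      funext u
      simp only [rhoH, if_true, rhoHn_eq, Pi.smul_apply, Pi.sub_apply, Pi.neg_apply,
        Finset.sum_apply, LinearMap.add_apply, LinearMap.sum_apply, LinearMap.smul_apply, id,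
        Module.End.one_apply]
      module
    · rw [rhoE_zero_eq, if_neg hj0.ne', rhoF_eq j kappa lam, comm_coe,
        affine_opF_commutator lam htri hzero hdisj hE1 hE2 hj0 hj, if_neg hj0.ne, neg_zero,
        zero_smul]
      rfl
  · rw [rhoE, if_neg hi0.ne', rhoEn_eq kappa lam hi0 hi, rhoH, if_neg hi0.ne', rhoHn_eq]
    rcases Nat.eq_zero_or_pos j with rfl | hj0
    · rw [if_pos rfl, rhoF0_eq, comm_coe,
        opE_opF_commutator_affine lam htri hzero hdisj hE1 hE2 hi0 hi, if_neg hi0.ne', neg_zero,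
        zero_smul]
      rfl
    · rw [if_neg hj0.ne', rhoF_eq j kappa lam, comm_coe,
        opE_opF_commutator_ne lam htri hzero hdisj hE1 hE2 hi0 hi hj0 hj]
      by_cases hij : i = j
      · subst hij
        rfl
      · rw [if_neg hij, neg_zero, zero_smul, zero_smul]
        rfl

end Stmt14
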